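/- arXiv:1708.05378 — 3 statements merged into one kernel-verified Lean document; each statement's English description precedes it below -/
import Mathlib

section
/- Let k be an algebraically closed field of characteristic zero and let f₁, f₂ ∈ k⟨x₁,…,x_g⟩ be such that there exist scalar points α, β ∈ k^g with f₁(α) ≠ 0 and f₂(β) ≠ 0. Then the following are equivalent: (a) for every n ∈ ℕ and every X ∈ M_n(k)^g, det f₁(X) = 0 implies det f₂(X) = 0 (i.e. FL(f₁) ⊆ FL(f₂)); (b) there exist λ₁, λ₂ ∈ k∖{0}, integers ℓ, m ≥ 0, and atoms a₁,…,a_ℓ, b₁,…,b_m ∈ k⟨x⟩ with f₁ = λ₁·a₁⋯a_ℓ and f₂ = λ₂·b₁⋯b_m, such that for every i ∈ {1,…,ℓ} there is some j ∈ {1,…,m} with a_i stably associated to b_j. -/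
open Matrix MvPolynomial

noncomputable section

/-- Evaluation of a noncommutative polynomial at a `g`-tuple of matrices. -/
def scalarEval {k : Type*} [CommRing k] {g n : ℕ} {R : Type*} [CommRing R] [Algebra k R]
    (f : FreeAlgebra k (Fin g)) (X : Fin g → Matrix (Fin n) (Fin n) R) :
    Matrix (Fin n) (Fin n) R :=
  FreeAlgebra.lift k X f

/-- A constant (scalar) element of the free algebra. -/
def IsConstant {k : Type*} [CommRing k] {g : ℕ} (p : FreeAlgebra k (Fin g)) : Prop :=
  ∃ c : k, p = algebraMap k (FreeAlgebra k (Fin g)) c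

/-- An atom of the free algebra: a nonconstant element that is not a product of two
nonconstant elements. -/
def ScalarAtom {k : Type*} [CommRing k] {g : ℕ} (p : FreeAlgebra k (Fin g)) : Prop :=
  ¬IsConstant p ∧ ∀ u v : FreeAlgebra k (Fin g), p = u * v → IsConstant u ∨ IsConstant v

/-- The block-diagonal sum `p ⊕ I_e ∈ M_{1+e}(k⟨x⟩)`. -/
def scalarDSum {k : Type*} [CommRing k] {g : ℕ} (p : FreeAlgebra k (Fin g)) (e : ℕ) :
    Matrix (Fin (1 + e)) (Fin (1 + e)) (FreeAlgebra k (Fin g)) :=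
  Matrix.reindex finSumFinEquiv finSumFinEquiv
    (Matrix.fromBlocks (Matrix.diagonal fun _ : Fin 1 => p) 0 0 1)

/-- Stable associativity of elements of the free algebra: `p ⊕ I_e = P (q ⊕ I_e) Q` for some
`e` and invertible `P, Q ∈ M_{1+e}(k⟨x⟩)`. -/
def StablyAssociatedScalar {k : Type*} [CommRing k] {g : ℕ}
    (p q : FreeAlgebra k (Fin g)) : Prop :=
  ∃ (e : ℕ) (P Q : Matrix (Fin (1 + e)) (Fin (1 + e)) (FreeAlgebra k (Fin g))),
    IsUnit P ∧ IsUnit Q ∧ scalarDSum p e = P * scalarDSum q e * Q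

/-- The `g`-tuple of `n × n` generic matrices. -/
def genX (k : Type*) [CommRing k] (g n : ℕ) :
    Fin g → Matrix (Fin n) (Fin n) (MvPolynomial (Fin g × Fin n × Fin n) k) :=
  fun j => Matrix.of fun ι κ => MvPolynomial.X (j, ι, κ)

namespace FreeLocus

open FreeAlgebra (ι)
open MulOpposite (op unop)

variable {k : Type*} [Field k] {σ : Type*}

/-- The constant term of a noncommutative polynomial. -/
abbrev constTerm : FreeAlgebra k σ →ₐ[k] k := FreeAlgebra.algebraMapInv

@[simp] lemma constTerm_ι (i : σ) : constTerm (ι k i) = 0 := by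
  simp [FreeAlgebra.algebraMapInv]

@[simp] lemma constTerm_algebraMap (c : k) :
    constTerm (algebraMap k (FreeAlgebra k σ) c) = c :=
  FreeAlgebra.algebraMap_leftInverse c

section Strip

variable [DecidableEq σ]

/-- The triangular representation whose off-diagonal entry is the left Fox derivative. -/
def stripHom (i : σ) : FreeAlgebra k σ →ₐ[k] Matrix (Fin 2) (Fin 2) (FreeAlgebra k σ) :=
  FreeAlgebra.lift k fun j => !![0, if i = j then 1 else 0; 0, ι k j]

lemma stripHom_apply (i : σ) (p : FreeAlgebra k σ) :
    stripHom i p 0 0 = algebraMap k _ (constTerm p) ∧ stripHom i p 1 0 = 0 ∧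
      stripHom i p 1 1 = p := by
  induction p using FreeAlgebra.induction with
  | grade0 r => simp [Matrix.algebraMap_matrix_apply]
  | grade1 x => simp [stripHom]
  | mul a b ha hb => simp [Matrix.mul_apply, Fin.sum_univ_two, ha, hb]
  | add a b ha hb => simp [ha, hb]

/-- `strip i p` is the cofactor of the variable `i` in `p = p(0) + ∑ x_i p_i`. -/
def strip (i : σ) : FreeAlgebra k σ →ₗ[k] FreeAlgebra k σ where
  toFun p := stripHom i p 0 1
  map_add' := by simp
  map_smul' := by simp

@[simp] lemma strip_algebraMap (i : σ) (c : k) :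
    strip i (algebraMap k (FreeAlgebra k σ) c) = 0 := by
  simp [strip, Matrix.algebraMap_matrix_apply]

@[simp] lemma strip_one (i : σ) : strip i (1 : FreeAlgebra k σ) = 0 := by
  simpa using strip_algebraMap i (1 : k)

lemma strip_mul (i : σ) (p q : FreeAlgebra k σ) :
    strip i (p * q) = strip i p * q + constTerm p • strip i q := by
  have hp := stripHom_apply i p
  have hq := stripHom_apply i q
  simp only [strip, LinearMap.coe_mk, AddHom.coe_mk, map_mul, Matrix.mul_apply, Fin.sum_univ_two,
    hp, hq, Algebra.smul_def]
  rw [add_comm]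

lemma strip_ι (i j : σ) : strip i (ι k j) = if i = j then 1 else 0 := by
  simp [strip, stripHom]

lemma strip_ι_mul (i j : σ) (p : FreeAlgebra k σ) :
    strip i (ι k j * p) = if i = j then p else 0 := by
  rw [strip_mul, strip_ι]
  split_ifs <;> simp

lemma strip_eq [Fintype σ] (p : FreeAlgebra k σ) :
    algebraMap k _ (constTerm p) + ∑ i, ι k i * strip i p = p := by
  induction p using FreeAlgebra.induction with
  | grade0 r => simp
  | grade1 x => simp [strip_ι]
  | mul a b ha hb =>
    have h : constTerm a • b = constTerm a •
        (algebraMap k (FreeAlgebra k σ) (constTerm b) + ∑ i, ι k i * strip i b) := by rw [hb]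
    conv_rhs => rw [← ha, add_mul, ← Algebra.smul_def, h]
    simp only [strip_mul, map_mul, mul_add, Finset.sum_add_distrib, Finset.sum_mul, mul_assoc,
      mul_smul_comm, smul_add, Finset.smul_sum]
    rw [← Algebra.smul_def]
    abel
  | add a b ha hb =>
    conv_rhs => rw [← ha, ← hb]
    simp only [map_add, mul_add, Finset.sum_add_distrib]
    abel

lemma eq_zero_of_strip [Fintype σ] {p : FreeAlgebra k σ} (h0 : constTerm p = 0)
    (h : ∀ i, strip i p = 0) : p = 0 := by
  rw [← strip_eq p]; simp [h0, h]

end Strip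

section Degree

/-- The homomorphism `x_i ↦ x_i t`, whose coefficients are the homogeneous components. -/
def grading : FreeAlgebra k σ →ₐ[k] Polynomial (FreeAlgebra k σ) :=
  FreeAlgebra.lift k fun i => Polynomial.C (ι k i) * Polynomial.X

@[simp] lemma grading_ι (i : σ) :
    grading (ι k i) = Polynomial.C (ι k i) * Polynomial.X := by simp [grading]

lemma grading_algebraMap (c : k) :
    grading (algebraMap k (FreeAlgebra k σ) c) = Polynomial.C (algebraMap k _ c) := by
  rw [AlgHom.commutes]; rfl

lemma grading_injective : Function.Injective (grading : FreeAlgebra k σ →ₐ[k] _) := by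
  let ev : Polynomial (FreeAlgebra k σ) →+* FreeAlgebra k σ :=
    Polynomial.eval₂RingHom' (RingHom.id _) 1 fun a => Commute.one_right a
  have h : ∀ p : FreeAlgebra k σ, ev (grading p) = p := by
    intro p
    induction p using FreeAlgebra.induction with
    | grade0 r => rw [grading_algebraMap]; simp [ev, Polynomial.eval₂RingHom']
    | grade1 x => 
      rw [grading_ι, map_mul]
      simp [ev, Polynomial.eval₂RingHom']
    | mul a b ha hb => rw [map_mul, map_mul, ha, hb]
    | add a b ha hb => rw [map_add, map_add, ha, hb]
  exact Function.LeftInverse.injective h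

/-- The degree of a noncommutative polynomial. -/
def deg (p : FreeAlgebra k σ) : ℕ := (grading p).natDegree

lemma grading_ne_zero {p : FreeAlgebra k σ} (hp : p ≠ 0) : grading p ≠ 0 := fun h =>
  hp (grading_injective (by rw [h, map_zero]))

lemma deg_mul {p q : FreeAlgebra k σ} (hp : p ≠ 0) (hq : q ≠ 0) :
    deg (p * q) = deg p + deg q := by
  rw [deg, map_mul, Polynomial.natDegree_mul (grading_ne_zero hp) (grading_ne_zero hq), deg, deg]

/-- Noncommutative polynomials of degree at most `n`. -/
def degLE (n : ℕ) : Submodule k (FreeAlgebra k σ) where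
  carrier := {p | deg p ≤ n}
  add_mem' {p q} hp hq := by
    have := Polynomial.natDegree_add_le (grading p) (grading q)
    simp only [Set.mem_ofPred_eq, deg, map_add] at *
    omega
  zero_mem' := by simp [deg]
  smul_mem' c p hp := by
    have := Polynomial.natDegree_smul_le c (grading p)
    simp only [Set.mem_ofPred_eq, deg, map_smul] at *
    omega

lemma mem_degLE {n : ℕ} {p : FreeAlgebra k σ} : p ∈ degLE n ↔ deg p ≤ n := Iff.rfl

lemma deg_algebraMap (c : k) : deg (algebraMap k (FreeAlgebra k σ) c) = 0 := by
  rw [deg, grading_algebraMap, Polynomial.natDegree_C]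

lemma one_mem_degLE (n : ℕ) : (1 : FreeAlgebra k σ) ∈ degLE n := by
  simp [mem_degLE, deg]

variable [Fintype σ] [DecidableEq σ]

lemma coeff_grading_strip (i : σ) (p : FreeAlgebra k σ) (n : ℕ) :
    (grading (strip i p)).coeff n = strip i ((grading p).coeff (n + 1)) := by
  conv_rhs => rw [← strip_eq p]
  simp only [map_add, map_sum, map_mul, grading_ι, Polynomial.coeff_add,
    Polynomial.finsetSum_coeff, grading_algebraMap, mul_assoc, Polynomial.coeff_C_mul,
    Polynomial.coeff_X_mul, Polynomial.coeff_C_succ, strip_ι_mul, zero_add]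
  simp

lemma deg_strip_le (i : σ) (p : FreeAlgebra k σ) : deg (strip i p) ≤ deg p - 1 := by
  refine Polynomial.natDegree_le_iff_coeff_eq_zero.2 fun n hn => ?_
  rw [coeff_grading_strip, Polynomial.coeff_eq_zero_of_natDegree_lt, map_zero]
  change deg p < n + 1
  omega

lemma eq_algebraMap_of_deg_eq_zero {p : FreeAlgebra k σ} (h : deg p = 0) :
    p = algebraMap k _ (constTerm p) := by
  have : ∀ i, strip i p = 0 := fun i => by
    apply grading_injective
    ext1 n
    rw [coeff_grading_strip, Polynomial.coeff_eq_zero_of_natDegree_lt, map_zero, map_zero,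
      Polynomial.coeff_zero]
    change deg p < n + 1
    omega
  conv_lhs => rw [← strip_eq p]
  simp [this]

lemma strip_mem_degLE {n : ℕ} {p : FreeAlgebra k σ} (i : σ) (hp : p ∈ degLE n) :
    strip i p ∈ degLE n :=
  (deg_strip_le i p).trans ((Nat.sub_le _ _).trans hp)

instance finite_degLE (n : ℕ) : Module.Finite k (degLE n : Submodule k (FreeAlgebra k σ)) := by
  induction n with
  | zero =>
    refine Module.Finite.of_injective (constTerm.toLinearMap ∘ₗ (degLE 0).subtype) ?_
    rw [← LinearMap.ker_eq_bot, LinearMap.ker_eq_bot']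
    rintro ⟨p, hp⟩ h
    have h' : constTerm p = 0 := h
    have := eq_algebraMap_of_deg_eq_zero (Nat.le_zero.1 hp)
    rw [h', map_zero] at this
    simpa using this
  | succ n ih =>
    let s (i : σ) : (degLE (n + 1) : Submodule k (FreeAlgebra k σ)) →ₗ[k]
        (degLE n : Submodule k (FreeAlgebra k σ)) :=
      (strip i).restrict fun p hp => by
        have := deg_strip_le i p
        rw [mem_degLE] at *
        omega
    refine Module.Finite.of_injective
      ((constTerm.toLinearMap ∘ₗ (degLE (n + 1)).subtype).prod (LinearMap.pi s)) ?_
    rw [← LinearMap.ker_eq_bot, LinearMap.ker_eq_bot']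
    rintro ⟨p, hp⟩ h
    have h0 : constTerm p = 0 := congrArg Prod.fst h
    have hs : ∀ i, strip i p = 0 := fun i =>
      congrArg Subtype.val (congrFun (congrArg Prod.snd h) i)
    simpa using eq_zero_of_strip h0 hs

end Degree

/-- A left ideal not contained in the augmentation ideal and closed under stripping the
variables from its elements without constant term is principal. -/
lemma exists_generator [Fintype σ] [DecidableEq σ] (I : Submodule (FreeAlgebra k σ) (FreeAlgebra k σ))
    (hI : I ≠ ⊥) (h : ∀ p ∈ I, constTerm p = 0 → ∀ i, strip i p ∈ I) :
    ∃ c ∈ I, ∀ p ∈ I, ∃ q, p = q * c := by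
  classical
  have hex : ∃ n, ∃ c ∈ I, c ≠ 0 ∧ deg c = n := by
    obtain ⟨c, hc, hc0⟩ := Submodule.exists_mem_ne_zero_of_ne_bot hI
    exact ⟨_, c, hc, hc0, rfl⟩
  obtain ⟨c, hc, hc0, hcn⟩ := Nat.find_spec hex
  have hmin : ∀ p ∈ I, p ≠ 0 → deg c ≤ deg p := fun p hp hp0 => by
    rw [hcn]; exact Nat.find_min' hex ⟨p, hp, hp0, rfl⟩
  have hconst : constTerm c ≠ 0 := by
    intro h0
    obtain ⟨i, hi⟩ : ∃ i, strip i c ≠ 0 := by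
      by_contra! hs
      exact hc0 (eq_zero_of_strip h0 hs)
    have h1 := hmin _ (h c hc h0 i) hi
    have h2 := deg_strip_le i c
    have h3 := eq_algebraMap_of_deg_eq_zero (p := c) (by omega)
    rw [h0, map_zero] at h3
    exact hc0 h3
  refine ⟨c, hc, fun p hp => ?_⟩
  induction hn : deg p using Nat.strong_induction_on generalizing p with
  | _ n ih =>
    by_cases hp0 : p = 0
    · exact ⟨0, by simp [hp0]⟩
    set l : k := constTerm p / constTerm c
    set p' := p - l • c with hp'
    have hpI : p' ∈ I := I.sub_mem hp (by
      rw [Algebra.smul_def]; exact I.smul_mem _ hc)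
    have hp'0 : constTerm p' = 0 := by simp [hp', l, hconst]
    have hdeg : p' ∈ degLE (deg p) :=
      (degLE _).sub_mem (mem_degLE.2 le_rfl) ((degLE _).smul_mem _ (mem_degLE.2 (hmin p hp hp0)))
    have key : ∀ i, ∃ q, strip i p' = q * c := by
      intro i
      by_cases h0 : deg p = 0
      · have h3 := eq_algebraMap_of_deg_eq_zero (p := p') (Nat.le_zero.1 (h0 ▸ mem_degLE.1 hdeg))
        rw [hp'0, map_zero] at h3
        exact ⟨0, by simp [h3]⟩
      · have := deg_strip_le i p'
        rw [mem_degLE] at hdeg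
        exact ih (deg (strip i p')) (by omega) _ (h _ hpI hp'0 i) rfl
    choose q hq using key
    refine ⟨algebraMap k _ l + ∑ i, ι k i * q i, ?_⟩
    rw [add_mul, Finset.sum_mul, ← Algebra.smul_def]
    simp_rw [mul_assoc, ← hq]
    have := strip_eq p'
    rw [hp'0, map_zero, zero_add] at this
    rw [this, hp']
    abel

/-- Modules `M` on which the variables act by an isomorphism `M^σ → M`, whose inverse is encoded
by a right action of the free algebra. -/
class IsLeavittModule (k σ M : Type*) [Field k] [Fintype σ] [DecidableEq σ] [AddCommGroup M]
    [Module (FreeAlgebra k σ) M] [Module (FreeAlgebra k σ)ᵐᵒᵖ M] : Prop where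
  strip_ι_smul : ∀ (i j : σ) (m : M),
    op (ι k i) • ι k j • m = if i = j then m else 0
  sum_ι_smul_strip : ∀ m : M, ∑ i : σ, ι k i • op (ι k i) • m = m


section Leavitt

variable {k σ : Type*} [Field k]

/-- A `k`-linear map commuting with the variables is linear over the free algebra. -/
def linearMapOfι {M E : Type*} [AddCommGroup M] [Module k M] [Module (FreeAlgebra k σ) M]
    [IsScalarTower k (FreeAlgebra k σ) M] [AddCommGroup E] [Module k E]
    [Module (FreeAlgebra k σ) E] [IsScalarTower k (FreeAlgebra k σ) E]
    (Φ : M →ₗ[k] E) (h : ∀ (i : σ) (m : M), Φ (ι k i • m) = ι k i • Φ m) : M →ₗ[FreeAlgebra k σ] E where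
  toFun := Φ
  map_add' := Φ.map_add
  map_smul' p := by
    induction p using FreeAlgebra.induction with
    | grade0 r => intro m; simp
    | grade1 x => exact h x
    | mul a b ha hb => intro m; simp only [RingHom.id_apply] at *; rw [mul_smul, ha, hb, mul_smul]
    | add a b ha hb => intro m; simp only [RingHom.id_apply] at *; rw [add_smul, map_add, ha, hb, add_smul]

section Op

variable {M : Type*} [AddCommGroup M] [Module k M] [Module (FreeAlgebra k σ)ᵐᵒᵖ M]
  [IsScalarTower k (FreeAlgebra k σ)ᵐᵒᵖ M]

lemma op_smul_mem (N : Submodule k M)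
    (hN : ∀ i : σ, ∀ m ∈ N, op (ι k i) • m ∈ N) (p : (FreeAlgebra k σ)ᵐᵒᵖ) :
    ∀ m ∈ N, p • m ∈ N := by
  induction p using MulOpposite.rec' with
  | h p =>
  induction p using FreeAlgebra.induction with
  | grade0 r =>
    intro m hm
    have : op (algebraMap k (FreeAlgebra k σ) r) = algebraMap k (FreeAlgebra k σ)ᵐᵒᵖ r := rfl
    rw [this, algebraMap_smul]
    exact N.smul_mem _ hm
  | grade1 x => exact hN x
  | mul a b ha hb => intro m hm; rw [MulOpposite.op_mul, mul_smul]; exact hb _ (ha _ hm)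
  | add a b ha hb => intro m hm; rw [MulOpposite.op_add, add_smul]; exact N.add_mem (ha _ hm) (hb _ hm)

/-- A `k`-subspace stable under the right action of the variables. -/
def opSubmodule (N : Submodule k M)
    (hN : ∀ i : σ, ∀ m ∈ N, op (ι k i) • m ∈ N) : Submodule (FreeAlgebra k σ)ᵐᵒᵖ M where
  carrier := N
  add_mem' := N.add_mem
  zero_mem' := N.zero_mem
  smul_mem' p _ hm := op_smul_mem N hN p _ hm

/-- Elements all of whose `n`-fold strippings lie in `V`. -/
def stripPreimage (V : Submodule (FreeAlgebra k σ)ᵐᵒᵖ M) : ℕ → Submodule k M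
  | 0 => V.restrictScalars k
  | n + 1 => ⨅ i : σ, (stripPreimage V n).comap (Algebra.lsmul k k M (op (ι k i)))

lemma mem_stripPreimage_succ {V : Submodule (FreeAlgebra k σ)ᵐᵒᵖ M} {n : ℕ} {m : M} :
    m ∈ stripPreimage V (n + 1) ↔ ∀ i : σ, op (ι k i) • m ∈ stripPreimage V n := by
  simp [stripPreimage]

lemma stripPreimage_mono (V : Submodule (FreeAlgebra k σ)ᵐᵒᵖ M) : Monotone (stripPreimage V) := by
  refine monotone_nat_of_le_succ fun n => ?_
  induction n with
  | zero => exact fun m hm => mem_stripPreimage_succ.2 fun i => V.smul_mem _ hm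
  | succ n ih =>
    exact fun m hm => mem_stripPreimage_succ.2 fun i => ih (mem_stripPreimage_succ.1 hm i)

end Op

variable [Fintype σ] [DecidableEq σ]
variable {M : Type*} [AddCommGroup M] [Module k M]
  [Module (FreeAlgebra k σ) M] [IsScalarTower k (FreeAlgebra k σ) M]
  [Module (FreeAlgebra k σ)ᵐᵒᵖ M] [IsScalarTower k (FreeAlgebra k σ)ᵐᵒᵖ M]

variable (k σ M) in
/-- There are no nontrivial subspaces stable under both actions of the variables. -/
def IsSimpleLeavitt : Prop :=
  ∀ N : Submodule k M, (∀ i : σ, ∀ m ∈ N, ι k i • m ∈ N) → (∀ i : σ, ∀ m ∈ N, op (ι k i) • m ∈ N) →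
    N = ⊥ ∨ N = ⊤

variable [IsLeavittModule k σ M]

open IsLeavittModule

lemma exists_mem_stripPreimage (hM : IsSimpleLeavitt k σ M)
    (V : Submodule (FreeAlgebra k σ)ᵐᵒᵖ M) (hV : V ≠ ⊥) (m : M) : ∃ n, m ∈ stripPreimage V n := by
  have hdir : Directed (· ≤ ·) (stripPreimage V) := (stripPreimage_mono V).directed_le
  have hmem : ∀ {m}, m ∈ ⨆ n, stripPreimage V n ↔ ∃ n, m ∈ stripPreimage V n :=
    Submodule.mem_iSup_of_directed _ hdir
  have htop : ⨆ n, stripPreimage V n = ⊤ := by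
    refine (hM _ ?_ ?_).resolve_left ?_
    · intro i m hm
      obtain ⟨n, hn⟩ := hmem.1 hm
      refine hmem.2 ⟨n + 1, mem_stripPreimage_succ.2 fun j => ?_⟩
      rw [strip_ι_smul]
      split_ifs
      exacts [hn, zero_mem _]
    · intro i m hm
      obtain ⟨n, hn⟩ := hmem.1 hm
      exact hmem.2 ⟨n, mem_stripPreimage_succ.1 (stripPreimage_mono V n.le_succ hn) i⟩
    · intro hbot
      obtain ⟨v, hv, hv0⟩ := Submodule.exists_mem_ne_zero_of_ne_bot hV
      exact hv0 ((Submodule.eq_bot_iff _).1 hbot v (hmem.2 ⟨0, hv⟩))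
  exact hmem.1 (htop ▸ Submodule.mem_top)

variable {E : Type*} [AddCommGroup E] [Module (FreeAlgebra k σ) E]

lemma eq_zero_of_vanish (hM : IsSimpleLeavitt k σ M)
    (V : Submodule (FreeAlgebra k σ)ᵐᵒᵖ M) (hV : V ≠ ⊥)
    (Ψ : M →ₗ[FreeAlgebra k σ] E) (h : ∀ v ∈ V, Ψ v = 0) : Ψ = 0 := by
  have key : ∀ n, ∀ m ∈ stripPreimage V n, Ψ m = 0 := by
    intro n
    induction n with
    | zero => exact h
    | succ n ih =>
      intro m hm
      rw [← sum_ι_smul_strip (k := k) (σ := σ) m, map_sum]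
      refine Finset.sum_eq_zero fun i _ => ?_
      rw [map_smul, ih _ (mem_stripPreimage_succ.1 hm i), smul_zero]
  ext m
  obtain ⟨n, hn⟩ := exists_mem_stripPreimage hM V hV m
  exact key n m hn

variable [Module k E] [IsScalarTower k (FreeAlgebra k σ) E]

lemma exists_extend_hom (hM : IsSimpleLeavitt k σ M)
    (V : Submodule (FreeAlgebra k σ)ᵐᵒᵖ M) (hV : V ≠ ⊥) (φ : M →ₗ[k] E)
    (hφ : ∀ v ∈ V, φ v = ∑ i : σ, ι k i • φ (op (ι k i) • v)) :
    ∃ Φ : M →ₗ[FreeAlgebra k σ] E, ∀ v ∈ V, Φ v = φ v := by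
  let next : (M →ₗ[k] E) → (M →ₗ[k] E) := fun ψ =>
    ∑ i : σ, Algebra.lsmul k k E (ι k i) ∘ₗ ψ ∘ₗ Algebra.lsmul k k M (op (ι k i))
  let F : ℕ → M →ₗ[k] E := fun n => next^[n] φ
  have hF0 : F 0 = φ := rfl
  have hFs : ∀ n m, F (n + 1) m = ∑ i : σ, ι k i • F n (op (ι k i) • m) := by
    intro n m
    simp only [F, Function.iterate_succ_apply']
    simp [next, LinearMap.sum_apply]
  have step : ∀ n, ∀ m ∈ stripPreimage V n, F (n + 1) m = F n m := by
    intro n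
    induction n with
    | zero => intro m hm; rw [hFs, hF0, hφ m hm]
    | succ n ih =>
      intro m hm
      rw [hFs, hFs]
      exact Finset.sum_congr rfl fun i _ => by rw [ih _ (mem_stripPreimage_succ.1 hm i)]
  have stable : ∀ n d, ∀ m ∈ stripPreimage V n, F (n + d) m = F n m := by
    intro n d m hm
    induction d with
    | zero => rfl
    | succ d ih =>
      rw [← add_assoc, step _ _ (stripPreimage_mono V (Nat.le_add_right n d) hm), ih]
  have hex := exists_mem_stripPreimage hM V hV
  choose N hN using hex
  have hval : ∀ n m, m ∈ stripPreimage V n → F (N m) m = F n m := by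
    intro n m hm
    rw [← stable n (N m) m hm, ← stable (N m) n m (hN m), add_comm]
  let Φ : M →ₗ[k] E :=
    { toFun := fun m => F (N m) m
      map_add' := fun a b => by
        have ha := stripPreimage_mono V (le_max_left (N a) (N b)) (hN a)
        have hb := stripPreimage_mono V (le_max_right (N a) (N b)) (hN b)
        rw [hval _ _ ha, hval _ _ hb, hval _ _ (add_mem ha hb), map_add]
      map_smul' := fun c a => by
        rw [hval _ _ (Submodule.smul_mem _ c (hN a)), map_smul, RingHom.id_apply] }
  refine ⟨linearMapOfι Φ fun i m => ?_, fun v hv => hval 0 v hv⟩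
  have hm : ι k i • m ∈ stripPreimage V (N m + 1) := mem_stripPreimage_succ.2 fun j => by
    rw [strip_ι_smul]
    split_ifs
    exacts [hN m, zero_mem _]
  change F _ _ = _ • F _ _
  rw [hval _ _ hm, hFs, Finset.sum_eq_single i]
  · rw [strip_ι_smul, if_pos rfl]
  · intro j _ hj
    rw [strip_ι_smul, if_neg hj, map_zero, smul_zero]
  · simp

variable {M' : Type*} [AddCommGroup M'] [Module k M']
  [Module (FreeAlgebra k σ) M'] [IsScalarTower k (FreeAlgebra k σ) M']
  [Module (FreeAlgebra k σ)ᵐᵒᵖ M'] [IsScalarTower k (FreeAlgebra k σ)ᵐᵒᵖ M']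
  [IsLeavittModule k σ M']

lemma exists_extend_opHom (hM : IsSimpleLeavitt k σ M)
    (V : Submodule (FreeAlgebra k σ)ᵐᵒᵖ M) (hV : V ≠ ⊥)
    (θ : V →ₗ[(FreeAlgebra k σ)ᵐᵒᵖ] M') :
    ∃ Φ : M →ₗ[FreeAlgebra k σ] M', ∀ v : V, Φ v = θ v := by
  let θk : V.restrictScalars k →ₗ[k] M' := θ.restrictScalars k
  obtain ⟨φ, hφ⟩ := LinearMap.exists_extend θk
  have hφ' : ∀ v : V, φ v = θ v := fun v => LinearMap.congr_fun hφ v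
  obtain ⟨Φ, hΦ⟩ := exists_extend_hom hM V hV φ (fun v hv => by
    have h1 : ∀ i, φ (op (ι k i) • v) = op (ι k i) • θ ⟨v, hv⟩ := fun i => by
      rw [← map_smul]; exact hφ' (op (ι k i) • ⟨v, hv⟩)
    simp_rw [h1]
    rw [sum_ι_smul_strip]
    exact hφ' ⟨v, hv⟩)
  exact ⟨Φ, fun v => (hΦ v v.2).trans (hφ' v)⟩

/-- A simple module is determined by any nonzero subspace stable under stripping. -/
lemma nonempty_linearEquiv (hM : IsSimpleLeavitt k σ M) (hM' : IsSimpleLeavitt k σ M')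
    (V : Submodule (FreeAlgebra k σ)ᵐᵒᵖ M) (hV : V ≠ ⊥)
    (V' : Submodule (FreeAlgebra k σ)ᵐᵒᵖ M') (hV' : V' ≠ ⊥)
    (θ : V ≃ₗ[(FreeAlgebra k σ)ᵐᵒᵖ] V') : Nonempty (M ≃ₗ[FreeAlgebra k σ] M') := by
  obtain ⟨Φ, hΦ⟩ := exists_extend_opHom hM V hV (V'.subtype ∘ₗ θ.toLinearMap)
  obtain ⟨Φ', hΦ'⟩ := exists_extend_opHom hM' V' hV' (V.subtype ∘ₗ θ.symm.toLinearMap)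
  refine ⟨LinearEquiv.ofLinearMap Φ Φ' ?_ ?_⟩
  · refine sub_eq_zero.1 (eq_zero_of_vanish hM' V' hV' _ fun v hv => ?_)
    have h1 := hΦ' ⟨v, hv⟩
    have h2 := hΦ (θ.symm ⟨v, hv⟩)
    simp at h1 h2
    simp [h1, h2]
  · refine sub_eq_zero.1 (eq_zero_of_vanish hM V hV _ fun v hv => ?_)
    have h1 := hΦ ⟨v, hv⟩
    have h2 := hΦ' (θ ⟨v, hv⟩)
    simp at h1 h2
    simp [h1, h2]

end Leavitt

/-- Simple modules, one of which is finite-dimensional, are isomorphic once their annihilators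
are comparable. -/
lemma nonempty_linearEquiv_of_annihilator {k S V W : Type*} [Field k] [Ring S] [Algebra k S]
    [AddCommGroup V] [Module S V] [AddCommGroup W] [Module S W] [Module k W]
    [IsScalarTower k S W] [Module.Finite k W]
    [IsSimpleModule S V] [IsSimpleModule S W]
    (h : ∀ s : S, (∀ w : W, s • w = 0) → ∀ v : V, s • v = 0) : Nonempty (V ≃ₗ[S] W) := by
  have := IsSimpleModule.nontrivial S V
  obtain ⟨v, hv⟩ := exists_ne (0 : V)
  let b := Module.finBasis k W
  let γ : S →ₗ[S] (Fin (Module.finrank k W) → W) :=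
    LinearMap.pi fun i => LinearMap.toSpanSingleton S W (b i)
  let π : S →ₗ[S] V := LinearMap.toSpanSingleton S V v
  have hker : LinearMap.ker γ ≤ LinearMap.ker π := by
    intro s hs
    have hs' : ∀ i, s • b i = 0 := fun i => congrFun hs i
    have h0 : Algebra.lsmul k k W s = 0 := b.ext hs'
    exact h s (fun w => LinearMap.congr_fun h0 w) v
  let ρ : LinearMap.range γ →ₗ[S] V :=
    (LinearMap.ker γ).liftQ π hker ∘ₗ γ.quotKerEquivRange.symm.toLinearMap
  have hρ : ρ ≠ 0 := by
    intro h0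
    have h1 : ρ (γ.quotKerEquivRange (Submodule.Quotient.mk 1)) = v := by
      simp [ρ, π]
    rw [h0] at h1
    exact hv h1.symm
  obtain ⟨Q, ⟨e⟩⟩ := LinearMap.linearEquiv_of_ne_zero hρ
  obtain ⟨i, hi⟩ : ∃ i, (e v : Fin (Module.finrank k W) → W) i ≠ 0 := by
    by_contra! h0
    refine hv (e.map_eq_zero_iff.1 (Subtype.ext (Subtype.ext (funext h0))))
  have hne : LinearMap.proj i ∘ₗ (LinearMap.range γ).subtype ∘ₗ Q.subtype ∘ₗ e.toLinearMap ≠ 0 :=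
    fun h0 => hi (LinearMap.congr_fun h0 v)
  exact ⟨LinearEquiv.ofBijective _ (LinearMap.bijective_of_ne_zero hne)⟩

section TorsionModule

variable {k σ : Type*} [Field k]

/-- The cyclic left module `k⟨x⟩ / k⟨x⟩ a` of a polynomial with constant term `1`. -/
def TorsionModule (a : {a : FreeAlgebra k σ // constTerm a = 1}) : Type _ :=
  FreeAlgebra k σ ⧸ Submodule.span (FreeAlgebra k σ) {a.1}

namespace TorsionModule

variable (a : {a : FreeAlgebra k σ // constTerm a = 1})

instance : AddCommGroup (TorsionModule a) :=
  inferInstanceAs (AddCommGroup (FreeAlgebra k σ ⧸ Submodule.span (FreeAlgebra k σ) {a.1}))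

instance : Module (FreeAlgebra k σ) (TorsionModule a) :=
  inferInstanceAs (Module (FreeAlgebra k σ)
    (FreeAlgebra k σ ⧸ Submodule.span (FreeAlgebra k σ) {a.1}))

instance : Module k (TorsionModule a) :=
  inferInstanceAs (Module k (FreeAlgebra k σ ⧸ Submodule.span (FreeAlgebra k σ) {a.1}))

instance : IsScalarTower k (FreeAlgebra k σ) (TorsionModule a) :=
  inferInstanceAs (IsScalarTower k (FreeAlgebra k σ)
    (FreeAlgebra k σ ⧸ Submodule.span (FreeAlgebra k σ) {a.1}))

/-- The residue class of a polynomial. -/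
def mk : FreeAlgebra k σ →ₗ[FreeAlgebra k σ] TorsionModule a :=
  (Submodule.span (FreeAlgebra k σ) {a.1}).mkQ

lemma mk_surjective : Function.Surjective (mk a) := Submodule.mkQ_surjective _

lemma mk_eq_zero {p : FreeAlgebra k σ} : mk a p = 0 ↔ ∃ q, q * a.1 = p := by
  refine (Submodule.Quotient.mk_eq_zero _).trans ?_
  rw [Submodule.mem_span_singleton]
  rfl

variable [DecidableEq σ]

/-- Stripping of a variable, corrected so as to preserve the left ideal generated by `a`. -/
def strip (i : σ) : FreeAlgebra k σ →ₗ[k] FreeAlgebra k σ :=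
  FreeLocus.strip i - constTerm.toLinearMap.smulRight (FreeLocus.strip i a.1)

lemma strip_apply (i : σ) (p : FreeAlgebra k σ) :
    strip a i p = FreeLocus.strip i p - constTerm p • FreeLocus.strip i a.1 := rfl

lemma strip_mul_self (i : σ) (q : FreeAlgebra k σ) :
    strip a i (q * a.1) = FreeLocus.strip i q * a.1 := by
  rw [strip_apply, strip_mul, map_mul, a.2, mul_one, add_sub_cancel_right]

/-- Stripping of a variable on residue classes. -/
def stripQuot (i : σ) : Module.End k (TorsionModule a) :=
  (Submodule.Quotient.restrictScalarsEquiv k (Submodule.span (FreeAlgebra k σ) {a.1})).conj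
    (Submodule.mapQ _ _ (strip a i) (by
      intro p hp
      obtain ⟨q, rfl⟩ := Submodule.mem_span_singleton.1 hp
      refine Submodule.mem_span_singleton.2 ⟨FreeLocus.strip i q, ?_⟩
      rw [smul_eq_mul, smul_eq_mul, strip_mul_self]))

lemma stripQuot_mk (i : σ) (p : FreeAlgebra k σ) :
    stripQuot a i (mk a p) = mk a (strip a i p) := rfl

/-- The right action of the free algebra generated by the strippings. -/
def stripAction : (FreeAlgebra k σ)ᵐᵒᵖ →ₐ[k] Module.End k (TorsionModule a) :=
  AlgHom.opComm (FreeAlgebra.lift k fun i => op (stripQuot a i))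

instance : Module (FreeAlgebra k σ)ᵐᵒᵖ (TorsionModule a) :=
  Module.compHom _ (stripAction a).toRingHom

lemma op_smul_eq (p : (FreeAlgebra k σ)ᵐᵒᵖ) (m : TorsionModule a) :
    p • m = stripAction a p m := rfl

instance : IsScalarTower k (FreeAlgebra k σ)ᵐᵒᵖ (TorsionModule a) where
  smul_assoc c p m := by simp [op_smul_eq]

lemma op_ι_smul_mk (i : σ) (p : FreeAlgebra k σ) :
    op (ι k i) • mk a p = mk a (strip a i p) := by
  rw [op_smul_eq, ← stripQuot_mk]
  simp [stripAction, AlgHom.opComm]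

variable [Fintype σ]

instance : IsLeavittModule k σ (TorsionModule a) where
  strip_ι_smul i j m := by
    obtain ⟨p, rfl⟩ := mk_surjective a m
    rw [← map_smul, op_ι_smul_mk, smul_eq_mul, strip_apply, strip_ι_mul, map_mul]
    split_ifs <;> simp
  sum_ι_smul_strip m := by
    obtain ⟨p, rfl⟩ := mk_surjective a m
    simp_rw [op_ι_smul_mk, ← map_smul, ← map_sum, smul_eq_mul, strip_apply]
    rw [← sub_eq_zero, ← map_sub, mk_eq_zero]
    refine ⟨algebraMap k _ (-constTerm p), ?_⟩
    have h1 := strip_eq a.1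
    have h2 := strip_eq p
    rw [a.2, map_one] at h1
    conv_lhs => rw [← h1]
    nth_rewrite 4 [← h2]
    simp only [mul_sub, mul_smul_comm, Finset.sum_sub_distrib, ← Finset.smul_sum]
    rw [mul_add, mul_one, ← Algebra.smul_def, map_neg, neg_smul]
    abel

variable {a}

lemma isSimpleLeavitt
    (ha : ∀ u v : FreeAlgebra k σ, a.1 = u * v →
      (∃ c, u = algebraMap k _ c) ∨ ∃ c, v = algebraMap k _ c) :
    IsSimpleLeavitt k σ (TorsionModule a) := by
  intro N hN hN'
  have hsmul : ∀ (p : FreeAlgebra k σ), ∀ m ∈ N, p • m ∈ N := by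
    intro p
    induction p using FreeAlgebra.induction with
    | grade0 r => intro m hm; rw [algebraMap_smul]; exact N.smul_mem _ hm
    | grade1 x => exact hN x
    | mul a b ha hb => intro m hm; rw [mul_smul]; exact ha _ (hb _ hm)
    | add a b ha hb => intro m hm; rw [add_smul]; exact N.add_mem (ha _ hm) (hb _ hm)
  let I : Submodule (FreeAlgebra k σ) (FreeAlgebra k σ) :=
    { carrier := {p | mk a p ∈ N}
      add_mem' := fun {p q} hp hq => by
        change mk a (p + q) ∈ N
        rw [map_add]; exact N.add_mem hp hq
      zero_mem' := by
        change mk a 0 ∈ N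
        rw [map_zero]; exact N.zero_mem
      smul_mem' := fun p q hq => by
        change mk a (p • q) ∈ N
        rw [map_smul]; exact hsmul p _ hq }
  have hmem : ∀ {p}, p ∈ I ↔ mk a p ∈ N := Iff.rfl
  have ha0 : a.1 ≠ 0 := fun h => by simpa [h] using a.2
  have haI : a.1 ∈ I := by
    rw [hmem, (mk_eq_zero a).2 ⟨1, one_mul _⟩]
    exact N.zero_mem
  obtain ⟨c, hc, hgen⟩ := exists_generator I (fun h => ha0 (by simpa [h] using haI)) (by
    intro p hp h0 i
    have := hN' i _ hp
    rwa [op_ι_smul_mk, strip_apply, h0, zero_smul, sub_zero] at this)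
  obtain ⟨d, hd⟩ := hgen _ haI
  rcases ha d c hd with ⟨r, rfl⟩ | ⟨r, rfl⟩
  · left
    have hr : r ≠ 0 := by rintro rfl; simp [hd] at ha0
    rw [Submodule.eq_bot_iff]
    intro m hm
    obtain ⟨p, rfl⟩ := mk_surjective a m
    obtain ⟨q, rfl⟩ := hgen p hm
    refine (mk_eq_zero a).2 ⟨q * algebraMap k _ r⁻¹, ?_⟩
    rw [hd, mul_assoc, ← mul_assoc (algebraMap k _ r⁻¹), ← map_mul, inv_mul_cancel₀ hr, map_one,
      one_mul]
  · right
    have hr : r ≠ 0 := by rintro rfl; simp [hd] at ha0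
    rw [Submodule.eq_top_iff']
    intro m
    obtain ⟨p, rfl⟩ := mk_surjective a m
    have := I.smul_mem (p * algebraMap k _ r⁻¹) hc
    rwa [smul_eq_mul, mul_assoc, ← map_mul, inv_mul_cancel₀ hr, map_one, mul_one] at this

lemma mk_one_ne_zero (ha : ¬∃ c, a.1 = algebraMap k _ c) : mk a 1 ≠ 0 := by
  rw [Ne, mk_eq_zero]
  rintro ⟨q, hq⟩
  have hq0 : q ≠ 0 := by rintro rfl; simp at hq
  have ha0 : a.1 ≠ 0 := fun h => by simpa [h] using a.2
  have h1 := deg_mul hq0 ha0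
  rw [hq, ← map_one (algebraMap k (FreeAlgebra k σ)), deg_algebraMap] at h1
  exact ha ⟨_, eq_algebraMap_of_deg_eq_zero (by omega)⟩

lemma exists_isSimpleModule (ha : ¬∃ c, a.1 = algebraMap k _ c) :
    ∃ V : Submodule (FreeAlgebra k σ)ᵐᵒᵖ (TorsionModule a),
      IsSimpleModule (FreeAlgebra k σ)ᵐᵒᵖ V ∧ Module.Finite k V := by
  let mkk : FreeAlgebra k σ →ₗ[k] TorsionModule a := (mk a).restrictScalars k
  let U := opSubmodule ((degLE (deg a.1)).map mkk) (by
    rintro i _ ⟨p, hp, rfl⟩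
    refine ⟨strip a i p, ?_, (op_ι_smul_mk a i p).symm⟩
    exact sub_mem (strip_mem_degLE i hp)
      (Submodule.smul_mem _ _ (strip_mem_degLE i (mem_degLE.2 le_rfl))))
  have hfin : Module.Finite k U :=
    inferInstanceAs (Module.Finite k ((degLE (deg a.1)).map mkk))
  have : Nontrivial U := ⟨⟨⟨mk a 1, 1, one_mem_degLE _, rfl⟩, 0, fun h =>
    mk_one_ne_zero ha (congrArg Subtype.val h)⟩⟩
  have : IsArtinian (FreeAlgebra k σ)ᵐᵒᵖ U := isArtinian_of_tower k inferInstance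
  obtain ⟨W, hW⟩ := IsAtomic.exists_atom (Submodule (FreeAlgebra k σ)ᵐᵒᵖ U)
  have hWs := isSimpleModule_iff_isAtom.2 hW
  let e : W ≃ₗ[(FreeAlgebra k σ)ᵐᵒᵖ] W.map U.subtype :=
    Submodule.equivMapOfInjective U.subtype U.injective_subtype W
  refine ⟨W.map U.subtype, (LinearEquiv.isSimpleModule_iff e).1 hWs, ?_⟩
  have : Module.Finite k W := Module.Finite.of_injective
    ((W.subtype).restrictScalars k) W.injective_subtype
  exact Module.Finite.of_surjective (e.toLinearMap.restrictScalars k) e.surjective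

end TorsionModule

end TorsionModule

section TestModule

variable {k σ : Type*} [Field k]

namespace TorsionModule

variable {E : Type*} [AddCommGroup E] [Module (FreeAlgebra k σ) E]

/-- The homomorphism out of a cyclic module determined by the image of the generator. -/
def lift (a : {a : FreeAlgebra k σ // constTerm a = 1}) (e : E) (he : a.1 • e = 0) :
    TorsionModule a →ₗ[FreeAlgebra k σ] E :=
  (Submodule.span (FreeAlgebra k σ) {a.1}).liftQ
    (LinearMap.toSpanSingleton (FreeAlgebra k σ) E e) (by
      rw [Submodule.span_le, Set.singleton_subset_iff]
      exact he)

lemma lift_mk (a : {a : FreeAlgebra k σ // constTerm a = 1}) (e : E) (he : a.1 • e = 0)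
    (p : FreeAlgebra k σ) : lift a e he (mk a p) = p • e := rfl

end TorsionModule

variable [Fintype σ] [DecidableEq σ]

/-- Stripping of a variable, corrected so as to identify `h` with `1`. -/
def testStrip (h : FreeAlgebra k σ) (i : σ) :
    Module.End k (degLE (deg h) : Submodule k (FreeAlgebra k σ)) :=
  (strip i + constTerm.toLinearMap.smulRight (strip i h)).restrict fun _ hp =>
    add_mem (strip_mem_degLE i hp)
      (Submodule.smul_mem _ _ (strip_mem_degLE i (mem_degLE.2 le_rfl)))

lemma coe_testStrip (h : FreeAlgebra k σ) (i : σ)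
    (p : (degLE (deg h) : Submodule k (FreeAlgebra k σ))) :
    (testStrip h i p : FreeAlgebra k σ) = strip i p.1 + constTerm p.1 • strip i h := rfl

/-- A finite-dimensional module in which only the torsion modules in whose socle `h` has the
eigenvalue `1` are visible. -/
def TestModule (h : FreeAlgebra k σ) : Type _ :=
  Module.Dual k (degLE (deg h) : Submodule k (FreeAlgebra k σ))

namespace TestModule

variable (h : FreeAlgebra k σ)

instance : AddCommGroup (TestModule h) :=
  inferInstanceAs (AddCommGroup (Module.Dual k (degLE (deg h) : Submodule k (FreeAlgebra k σ))))

instance : Module k (TestModule h) :=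
  inferInstanceAs (Module k (Module.Dual k (degLE (deg h) : Submodule k (FreeAlgebra k σ))))

instance : Module.Finite k (TestModule h) :=
  inferInstanceAs
    (Module.Finite k (Module.Dual k (degLE (deg h) : Submodule k (FreeAlgebra k σ))))

/-- Evaluation of a functional. -/
def eval (p : (degLE (deg h) : Submodule k (FreeAlgebra k σ))) : TestModule h →ₗ[k] k :=
  Module.Dual.eval k _ p

variable {h} in
lemma ext {e e' : TestModule h} (hee : ∀ p, eval h p e = eval h p e') : e = e' :=
  LinearMap.ext hee

lemma eval_add (p q : (degLE (deg h) : Submodule k (FreeAlgebra k σ))) (e : TestModule h) :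
    eval h (p + q) e = eval h p e + eval h q e := LinearMap.map_add e p q

lemma eval_smul (c : k) (p : (degLE (deg h) : Submodule k (FreeAlgebra k σ)))
    (e : TestModule h) : eval h (c • p) e = c * eval h p e := LinearMap.map_smul e c p

/-- The transpose of a corrected stripping. -/
def dualStrip (i : σ) : Module.End k (TestModule h) := (testStrip h i).dualMap

/-- The action of the free algebra dual to the corrected strippings. -/
def action : FreeAlgebra k σ →ₐ[k] Module.End k (TestModule h) :=
  FreeAlgebra.lift k (dualStrip h)

instance : Module (FreeAlgebra k σ) (TestModule h) :=
  Module.compHom _ (action h).toRingHom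

lemma smul_eq (p : FreeAlgebra k σ) (e : TestModule h) : p • e = action h p e := rfl

instance : IsScalarTower k (FreeAlgebra k σ) (TestModule h) where
  smul_assoc c p e := by simp [smul_eq]

lemma eval_ι_smul (i : σ) (p : (degLE (deg h) : Submodule k (FreeAlgebra k σ)))
    (e : TestModule h) : eval h p (ι k i • e) = eval h (testStrip h i p) e := by
  rw [smul_eq, action, FreeAlgebra.lift_ι_apply]
  rfl

end TestModule

variable {M : Type*} [AddCommGroup M] [Module k M]
  [Module (FreeAlgebra k σ) M] [IsScalarTower k (FreeAlgebra k σ) M]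
  [Module (FreeAlgebra k σ)ᵐᵒᵖ M] [IsScalarTower k (FreeAlgebra k σ)ᵐᵒᵖ M]

lemma sum_op_strip_smul {p : FreeAlgebra k σ} (m : M) :
    ∑ i, op (strip i p) • op (ι k i) • m = op p • m - constTerm p • m := by
  have h1 : op (algebraMap k (FreeAlgebra k σ) (constTerm p)) • m = constTerm p • m :=
    algebraMap_smul (FreeAlgebra k σ)ᵐᵒᵖ (constTerm p) m
  rw [eq_sub_iff_add_eq', ← h1]
  simp_rw [← mul_smul, ← MulOpposite.op_mul, ← Finset.sum_smul, ← Finset.op_sum]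
  rw [← add_smul, ← MulOpposite.op_add, strip_eq]

variable {h : FreeAlgebra k σ}

lemma exists_smul_eq_zero {a : {a : FreeAlgebra k σ // constTerm a = 1}}
    (hM : IsSimpleLeavitt k σ (TorsionModule a)) (h0 : constTerm h = 0)
    (V : Submodule (FreeAlgebra k σ)ᵐᵒᵖ (TorsionModule a)) [Module.Finite k V]
    {v : V} (hv : v ≠ 0) (hhv : op h • v = v) : ∃ e : TestModule h, e ≠ 0 ∧ a.1 • e = 0 := by
  have hVbot : V ≠ ⊥ := by
    rintro rfl
    exact hv (Subsingleton.elim _ _)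
  let T : Module.End k V := Algebra.lsmul k k V (op h) - 1
  have hT : LinearMap.range T < ⊤ := by
    rw [lt_top_iff_ne_top, Ne, LinearMap.range_eq_top, ← LinearMap.injective_iff_surjective]
    intro hinj
    exact hv (hinj (by simp [T, hhv]))
  obtain ⟨ψ, hψ0, hψ⟩ := Submodule.exists_le_ker_of_lt_top _ hT
  have hψh : ∀ w : V, ψ (op h • w) = ψ w := by
    intro (w : V)
    have := hψ (LinearMap.mem_range_self T w)
    simpa [T, sub_eq_zero] using this
  obtain ⟨Ψ, hΨ⟩ := LinearMap.exists_extend (p := V.restrictScalars k) ψ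
  have hΨ' : ∀ w : V, Ψ w = ψ w := fun w => LinearMap.congr_fun hΨ w
  let φ : TorsionModule a →ₗ[k] TestModule h :=
    LinearMap.mk₂ k
      (fun (m : TorsionModule a) (p : (degLE (deg h) : Submodule k (FreeAlgebra k σ))) =>
        Ψ (op p.1 • m))
      (fun m m' p => by rw [smul_add, map_add])
      (fun c m p => by rw [smul_comm, map_smul])
      (fun m p q => by rw [Submodule.coe_add, MulOpposite.op_add, add_smul, map_add])
      (fun c m p => by rw [Submodule.coe_smul, MulOpposite.op_smul, smul_assoc, map_smul])
  have hφ : ∀ p m, TestModule.eval h p (φ m) = Ψ (op p.1 • m) := fun p m => rfl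
  have hφV : ∀ w ∈ V, φ w = ∑ i : σ, ι k i • φ (op (ι k i) • w) := by
    intro w hw
    refine TestModule.ext fun p => ?_
    rw [map_sum]
    simp_rw [TestModule.eval_ι_smul, hφ, coe_testStrip, MulOpposite.op_add, add_smul, map_add,
      MulOpposite.op_smul, smul_assoc, Ψ.map_smul]
    rw [Finset.sum_add_distrib, ← Finset.smul_sum, ← map_sum, ← map_sum, sum_op_strip_smul,
      sum_op_strip_smul, h0, zero_smul, sub_zero, map_sub, Ψ.map_smul]
    have h1 : Ψ (op h • w) = Ψ w := by
      have := hψh ⟨w, hw⟩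
      rw [← hΨ', ← hΨ'] at this
      exact this
    rw [h1, sub_add_cancel]
  obtain ⟨Φ, hΦ⟩ := exists_extend_hom hM V hVbot φ hφV
  refine ⟨Φ (TorsionModule.mk a 1), fun he => hψ0 ?_, ?_⟩
  · ext (w : V)
    have hΦ0 : Φ w = 0 := by
      obtain ⟨p, hp⟩ := TorsionModule.mk_surjective a w.1
      rw [← hp, ← mul_one p, ← smul_eq_mul, map_smul, map_smul, he, smul_zero]
    rw [← hΨ']
    have := hφ ⟨1, one_mem_degLE _⟩ w
    rw [← hΦ _ w.2, hΦ0, map_zero, MulOpposite.op_one, one_smul] at this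
    exact this.symm
  · rw [← map_smul, ← map_smul, smul_eq_mul, mul_one, (TorsionModule.mk_eq_zero a).2
      ⟨1, one_mul _⟩, map_zero]

lemma eq_zero_of_smul_eq_zero {b : {b : FreeAlgebra k σ // constTerm b = 1}}
    (hM : IsSimpleLeavitt k σ (TorsionModule b)) (h0 : constTerm h = 0)
    (V : Submodule (FreeAlgebra k σ)ᵐᵒᵖ (TorsionModule b)) (hV : V ≠ ⊥)
    (hhV : ∀ v : V, op h • v = 0) {e : TestModule h} (he : b.1 • e = 0) : e = 0 := by
  let Ψ := TorsionModule.lift b e he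
  have hrec : ∀ v p, TestModule.eval h p (Ψ v) =
      ∑ i, TestModule.eval h (testStrip h i p) (Ψ (op (ι k i) • v)) := by
    intro v p
    conv_lhs => rw [← IsLeavittModule.sum_ι_smul_strip (k := k) (σ := σ) v]
    simp_rw [map_sum, map_smul, TestModule.eval_ι_smul]
  let one : (degLE (deg h) : Submodule k (FreeAlgebra k σ)) := ⟨1, one_mem_degLE _⟩
  let st (i : σ) (p : (degLE (deg h) : Submodule k (FreeAlgebra k σ))) :
    (degLE (deg h) : Submodule k (FreeAlgebra k σ)) := ⟨strip i p.1, strip_mem_degLE i p.2⟩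
  let hh : (degLE (deg h) : Submodule k (FreeAlgebra k σ)) := ⟨h, mem_degLE.2 le_rfl⟩
  have hts : ∀ i p, testStrip h i p = st i p + constTerm p.1 • st i hh := fun i p => rfl
  have hone : ∀ v, TestModule.eval h one (Ψ v) =
      ∑ i, TestModule.eval h (st i hh) (Ψ (op (ι k i) • v)) := by
    intro v
    rw [hrec]
    refine Finset.sum_congr rfl fun i _ => ?_
    congr 2
    exact Subtype.ext (by simp [coe_testStrip, one, st, hh])
  have key : ∀ n v p, deg p.1 ≤ n →
      TestModule.eval h p (Ψ v) = TestModule.eval h one (Ψ (op p.1 • v)) := by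
    intro n
    induction n with
    | zero =>
      intro v p hp
      have hp' := eq_algebraMap_of_deg_eq_zero (Nat.le_zero.1 hp)
      have hp1 : p = constTerm p.1 • one := Subtype.ext (by
        rw [Submodule.coe_smul, ← Algebra.algebraMap_eq_smul_one]
        exact hp')
      rw [hp1, TestModule.eval_smul, Submodule.coe_smul, MulOpposite.op_smul, smul_assoc,
        MulOpposite.op_one, one_smul,
        LinearMap.map_smul_of_tower Ψ (constTerm p.1),
        (TestModule.eval h one).map_smul, smul_eq_mul]
    | succ n ih =>
      intro v p hp
      rw [hrec]
      simp_rw [hts, TestModule.eval_add, TestModule.eval_smul]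
      rw [Finset.sum_add_distrib, ← Finset.mul_sum, ← hone]
      have : ∀ i, TestModule.eval h (st i p) (Ψ (op (ι k i) • v)) =
          TestModule.eval h one (Ψ (op (strip i p.1) • op (ι k i) • v)) := fun i =>
        ih _ _ ((deg_strip_le i p.1).trans (by omega))
      simp_rw [this]
      rw [← map_sum, ← map_sum, sum_op_strip_smul, map_sub, map_sub, 
        LinearMap.map_smul_of_tower Ψ (constTerm p.1),
        (TestModule.eval h one).map_smul, smul_eq_mul, sub_add_cancel]
  have hzero : Ψ = 0 := by
    refine eq_zero_of_vanish hM V hV Ψ fun v hv => ?_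
    have h1 : ∀ v ∈ V, TestModule.eval h one (Ψ v) = 0 := by
      intro v hv
      rw [hone]
      simp_rw [key _ _ (st _ hh) le_rfl]
      change ∑ i, TestModule.eval h one (Ψ (op (strip i h) • op (ι k i) • v)) = 0
      have hv0 : op h • v = 0 := congrArg Subtype.val (hhV ⟨v, hv⟩)
      rw [← map_sum, ← map_sum, sum_op_strip_smul, h0, zero_smul, sub_zero, hv0, map_zero,
        map_zero]
    exact TestModule.ext fun p => by
      rw [key _ _ _ le_rfl, h1 _ (V.smul_mem _ hv), map_zero]
  have := TorsionModule.lift_mk b e he 1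
  rw [one_smul] at this
  rw [← this]
  exact LinearMap.congr_fun hzero _

end TestModule

section Core

/-- Matrices describing the action of the free algebra on a finite-dimensional module. -/
lemma exists_matrix_action {k σ : Type*} [Field k] (E : Type*) [AddCommGroup E] [Module k E]
    [Module.Finite k E] [Module (FreeAlgebra k σ) E] [IsScalarTower k (FreeAlgebra k σ) E] :
    ∃ (n : ℕ) (X : σ → Matrix (Fin n) (Fin n) k), ∀ p : FreeAlgebra k σ,
      (∃ e : E, e ≠ 0 ∧ p • e = 0) ↔ (FreeAlgebra.lift k X p).det = 0 := by
  let B := Module.finBasis k E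
  let F : FreeAlgebra k σ →ₐ[k] Matrix (Fin (Module.finrank k E)) (Fin (Module.finrank k E)) k :=
    (LinearMap.toMatrixAlgEquiv B).toAlgHom.comp (Algebra.lsmul k k E)
  refine ⟨_, fun i => F (ι k i), fun p => ?_⟩
  have hF : FreeAlgebra.lift k (fun i => F (ι k i)) = F := FreeAlgebra.hom_ext (by ext; simp)
  rw [hF]
  have hdet : (F p).det = LinearMap.det (Algebra.lsmul k k E p) :=
    LinearMap.det_toMatrix B _
  rw [hdet, LinearMap.det_eq_zero_iff_ker_ne_bot, Submodule.ne_bot_iff]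
  simp [and_comm]

/-- A common annihilator of finitely many modules need not kill a simple module that none of
them annihilates. -/
lemma exists_smul_ne_zero {S V J : Type*} [Ring S] [AddCommGroup V] [Module S V]
    [IsSimpleModule S V] (W : J → Type*) [∀ j, AddCommGroup (W j)] [∀ j, Module S (W j)]
    (h : ∀ j, ∃ s : S, (∀ w : W j, s • w = 0) ∧ ∃ v : V, s • v ≠ 0) (t : Finset J) :
    ∃ s : S, (∀ j ∈ t, ∀ w : W j, s • w = 0) ∧ ∃ v : V, s • v ≠ 0 := by
  classical
  induction t using Finset.induction_on with
  | empty =>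
    have := IsSimpleModule.nontrivial S V
    obtain ⟨v, hv⟩ := exists_ne (0 : V)
    exact ⟨1, by simp, v, by simpa using hv⟩
  | insert j t _ ih =>
    obtain ⟨s, hs, v, hv⟩ := ih
    obtain ⟨s', hs', v', hv'⟩ := h j
    obtain ⟨r, hr⟩ := IsSimpleModule.toSpanSingleton_surjective S hv v'
    have hr' : r • s • v = v' := hr
    refine ⟨s' * r * s, fun i hi w => ?_, v, ?_⟩
    · rcases Finset.mem_insert.1 hi with rfl | hi
      · rw [mul_smul, mul_smul, hs']
      · rw [mul_smul, hs i hi, smul_zero]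
    · rwa [mul_smul, mul_smul, hr']

variable {k σ : Type*} [Field k] [Fintype σ] [DecidableEq σ]

/-- A polynomial with constant term `1` all of whose factorizations are trivial. -/
structure IsAtomOne (a : FreeAlgebra k σ) : Prop where
  constTerm_eq : constTerm a = 1
  not_constant : ¬∃ c, a = algebraMap k _ c
  factor : ∀ u v, a = u * v → (∃ c, u = algebraMap k _ c) ∨ ∃ c, v = algebraMap k _ c

theorem exists_torsionModule_equiv {J : Type*} [Finite J] {a : FreeAlgebra k σ} (ha : IsAtomOne a)
    {b : J → FreeAlgebra k σ} (hb : ∀ j, IsAtomOne (b j))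
    (H : ∀ (n : ℕ) (X : σ → Matrix (Fin n) (Fin n) k), (FreeAlgebra.lift k X a).det = 0 →
      ∃ j, (FreeAlgebra.lift k X (b j)).det = 0) :
    ∃ j, Nonempty (TorsionModule ⟨a, ha.1⟩ ≃ₗ[FreeAlgebra k σ] TorsionModule ⟨b j, (hb j).1⟩) := by
  obtain ⟨V, hV, hVfin⟩ := TorsionModule.exists_isSimpleModule (a := ⟨a, ha.1⟩) ha.2
  have hMa : IsSimpleLeavitt k σ (TorsionModule ⟨a, ha.1⟩) := TorsionModule.isSimpleLeavitt ha.3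
  have hMb : ∀ j, IsSimpleLeavitt k σ (TorsionModule ⟨b j, (hb j).1⟩) := fun j =>
    TorsionModule.isSimpleLeavitt (hb j).3
  choose W hW hWfin using fun j =>
    TorsionModule.exists_isSimpleModule (a := ⟨b j, (hb j).1⟩) (hb j).2
  have hVbot : V ≠ ⊥ := hV.isAtom.1
  have hWbot : ∀ j, W j ≠ ⊥ := fun j => (hW j).isAtom.1
  by_contra! hne
  have hsep : ∀ j, ∃ s : (FreeAlgebra k σ)ᵐᵒᵖ, (∀ w : W j, s • w = 0) ∧ ∃ v : V, s • v ≠ 0 := by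
    intro j
    by_contra! hj
    obtain ⟨θ⟩ := nonempty_linearEquiv_of_annihilator (k := k)
      (S := (FreeAlgebra k σ)ᵐᵒᵖ) (V := V) (W := W j) hj
    obtain ⟨e⟩ := nonempty_linearEquiv hMa (hMb j) V hVbot (W j) (hWbot j) θ
    exact (hne j).false e
  cases nonempty_fintype J
  obtain ⟨s, hs, v, hv⟩ := exists_smul_ne_zero (S := (FreeAlgebra k σ)ᵐᵒᵖ) (V := V) (fun j => W j) hsep Finset.univ
  obtain ⟨i, hi⟩ : ∃ i : σ, op (ι k i) • s • v ≠ 0 := by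
    by_contra! h
    apply hv
    apply Subtype.ext
    refine (IsLeavittModule.sum_ι_smul_strip (k := k) (σ := σ) (s • v).1).symm.trans
      (Finset.sum_eq_zero fun i _ => ?_)
    have hi : op (ι k i) • (s • v).1 = 0 := congrArg Subtype.val (h i)
    rw [hi, smul_zero]
  obtain ⟨r, hr⟩ := IsSimpleModule.toSpanSingleton_surjective (FreeAlgebra k σ)ᵐᵒᵖ hi v
  let h : FreeAlgebra k σ := unop s * ι k i * unop r
  have hop : op h = r * (op (ι k i) * s) := by simp [h, mul_assoc]
  have h0 : constTerm h = 0 := by simp [h]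
  have hhv : op h • v = v := by
    rw [hop, mul_smul, mul_smul]
    exact hr
  have hv0 : v ≠ 0 := by rintro rfl; simp at hv
  obtain ⟨e, he0, he⟩ := exists_smul_eq_zero hMa h0 V hv0 hhv
  obtain ⟨n, X, hX⟩ := exists_matrix_action (k := k) (σ := σ) (TestModule h)
  obtain ⟨j, hj⟩ := H n X ((hX a).1 ⟨e, he0, he⟩)
  obtain ⟨e', he'0, he'⟩ := (hX (b j)).2 hj
  refine he'0 (eq_zero_of_smul_eq_zero (hMb j) h0 (W j) (hWbot j) (fun w => ?_) he')
  rw [hop, mul_smul, mul_smul, hs j (Finset.mem_univ j), smul_zero, smul_zero]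

end Core

section StableAssociation

/-- Similarity of two ring elements: the identities expressing an isomorphism `R / Ra ≃ R / Rb` of
left modules. -/
def IsSimilar {R : Type*} [Ring R] (a b : R) : Prop :=
  ∃ u v w z s t : R, a * u = v * b ∧ b * w = z * a ∧ u * w = 1 + s * a ∧ w * u = 1 + t * b

lemma IsSimilar.map {R S : Type*} [Ring R] [Ring S] (F : R →+* S) {a b : R} (h : IsSimilar a b) :
    IsSimilar (F a) (F b) := by
  obtain ⟨u, v, w, z, s, t, h1, h2, h3, h4⟩ := h
  refine ⟨F u, F v, F w, F z, F s, F t, ?_, ?_, ?_, ?_⟩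
  · rw [← map_mul, h1, map_mul]
  · rw [← map_mul, h2, map_mul]
  · rw [← map_mul, h3, map_add, map_mul, map_one]
  · rw [← map_mul, h4, map_add, map_mul, map_one]

lemma isSimilar_of_equiv {k σ : Type*} [Field k] {a b : {a : FreeAlgebra k σ // constTerm a = 1}}
    (e : TorsionModule a ≃ₗ[FreeAlgebra k σ] TorsionModule b) : IsSimilar a.1 b.1 := by
  open TorsionModule in
  have smul_mk_one : ∀ (c : {a : FreeAlgebra k σ // constTerm a = 1}) (p : FreeAlgebra k σ),
      p • mk c 1 = mk c p := fun c p => by rw [← map_smul, smul_eq_mul, mul_one]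
  obtain ⟨u, hu⟩ := mk_surjective b (e (mk a 1))
  obtain ⟨w, hw⟩ := mk_surjective a (e.symm (mk b 1))
  have hself : ∀ c : {a : FreeAlgebra k σ // constTerm a = 1}, mk c c.1 = 0 := fun c =>
    (mk_eq_zero c).2 ⟨1, one_mul _⟩
  have hu' : ∀ p, mk b (p * u) = e (mk a p) := fun p => by
    rw [← smul_eq_mul, map_smul, hu, ← map_smul, smul_mk_one]
  have hw' : ∀ p, mk a (p * w) = e.symm (mk b p) := fun p => by
    rw [← smul_eq_mul, map_smul, hw, ← map_smul, smul_mk_one]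
  obtain ⟨v, hv⟩ := (mk_eq_zero b).1 ((hu' a.1).trans (by rw [hself, map_zero]))
  obtain ⟨z, hz⟩ := (mk_eq_zero a).1 ((hw' b.1).trans (by rw [hself, map_zero]))
  obtain ⟨s, hs⟩ := (mk_eq_zero a (p := u * w - 1)).1 (by
    rw [map_sub, hw', hu, e.symm_apply_apply, sub_self])
  obtain ⟨t, ht⟩ := (mk_eq_zero b (p := w * u - 1)).1 (by
    rw [map_sub, hu', hw, e.apply_symm_apply, sub_self])
  exact ⟨u, v, w, z, s, t, hv.symm, hz.symm, by rw [hs, add_sub_cancel],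
    by rw [ht, add_sub_cancel]⟩

lemma scalarDSum_one {k : Type*} [CommRing k] {g : ℕ} (p : FreeAlgebra k (Fin g)) :
    scalarDSum p 1 = !![p, 0; 0, 1] := by
  ext i j
  fin_cases i <;> fin_cases j <;> rfl

lemma IsSimilar.stablyAssociated {k : Type*} [Field k] {g : ℕ} {a b : FreeAlgebra k (Fin g)}
    (ha : a ≠ 0) (hb : b ≠ 0) (h : IsSimilar a b) : StablyAssociatedScalar a b := by
  obtain ⟨u, v, w, z, s, t, h1, h2, h3, h4⟩ := h
  have h5 : v * z = 1 + a * s := mul_right_cancel₀ ha (by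
    rw [mul_assoc, ← h2, ← mul_assoc, ← h1, mul_assoc, h3]; noncomm_ring)
  have h6 : w * s = t * z := mul_right_cancel₀ ha (by
    rw [mul_assoc, mul_assoc, ← h2, ← mul_assoc t, ← sub_eq_iff_eq_add'.2 h4,
      ← sub_eq_iff_eq_add'.2 h3]
    noncomm_ring)
  have h7 : s * v = u * t := mul_right_cancel₀ hb (by
    rw [mul_assoc, mul_assoc, ← h1, ← mul_assoc s, ← sub_eq_iff_eq_add'.2 h4,
      ← sub_eq_iff_eq_add'.2 h3]
    noncomm_ring)
  have h8 : z * v = 1 + b * t := mul_right_cancel₀ hb (by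
    rw [mul_assoc, ← h1, ← mul_assoc, ← h2, mul_assoc, h4]; noncomm_ring)
  refine ⟨1, !![v, a; -t, -w], !![w, 1; 1 - u * w, -u], ?_, ?_, ?_⟩
  · refine isUnit_iff_exists.2 ⟨!![z, b; -s, -u], ?_, ?_⟩
    · refine (Matrix.mul_fin_two _ _ _ _ _ _ _ _).trans ((Matrix.one_fin_two).trans ?_).symm
      simp [h1, h4, h5, h6]
    · refine (Matrix.mul_fin_two _ _ _ _ _ _ _ _).trans ((Matrix.one_fin_two).trans ?_).symm
      simp [h2, h3, h7, h8]
  · refine isUnit_iff_exists.2 ⟨!![u, 1; 1 - w * u, -w], ?_, ?_⟩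
    · refine (Matrix.mul_fin_two _ _ _ _ _ _ _ _).trans ((Matrix.one_fin_two).trans ?_).symm
      congr! <;> noncomm_ring
    · refine (Matrix.mul_fin_two _ _ _ _ _ _ _ _).trans ((Matrix.one_fin_two).trans ?_).symm
      congr! <;> noncomm_ring
  · rw [scalarDSum_one, scalarDSum_one]
    have h9 : t * b = w * u - 1 := (sub_eq_iff_eq_add'.2 h4).symm
    refine ((congrArg (· * !![w, 1; 1 - u * w, -u]) (Matrix.mul_fin_two _ _ _ _ _ _ _ _)).trans
      ((Matrix.mul_fin_two _ _ _ _ _ _ _ _).trans ?_)).symm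
    simp only [mul_zero, mul_one, add_zero, zero_add, neg_mul, mul_neg, neg_neg, h9, ← h1,
      mul_sub, sub_mul, one_mul, mul_assoc]
    congr! <;> abel

lemma isUnit_fromBlocks_iff {S m : Type*} [Ring S] [Fintype m] [DecidableEq m] (p : S) :
    IsUnit (Matrix.fromBlocks (Matrix.diagonal fun _ : Fin 1 => p) 0 0 1 :
      Matrix (Fin 1 ⊕ m) (Fin 1 ⊕ m) S) ↔ IsUnit p := by
  constructor
  · intro h
    obtain ⟨N, h1, h2⟩ := isUnit_iff_exists.1 h
    refine isUnit_iff_exists.2 ⟨N (Sum.inl 0) (Sum.inl 0), ?_, ?_⟩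
    · simpa [Matrix.mul_apply] using congrFun₂ h1 (Sum.inl 0) (Sum.inl 0)
    · simpa [Matrix.mul_apply] using congrFun₂ h2 (Sum.inl 0) (Sum.inl 0)
  · intro h
    obtain ⟨q, h1, h2⟩ := isUnit_iff_exists.1 h
    refine isUnit_iff_exists.2
      ⟨Matrix.fromBlocks (Matrix.diagonal fun _ : Fin 1 => q) 0 0 1, ?_, ?_⟩
    · simp [Matrix.fromBlocks_multiply, h1]
    · simp [Matrix.fromBlocks_multiply, h2]

lemma isUnit_of_stablyAssociated {k S : Type*} [CommRing k] [Ring S] {g : ℕ}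
    {a b : FreeAlgebra k (Fin g)} (h : StablyAssociatedScalar a b)
    (F : FreeAlgebra k (Fin g) →+* S) (hb : IsUnit (F b)) : IsUnit (F a) := by
  obtain ⟨e, P, Q, hP, hQ, h⟩ := h
  have hmap : ∀ p, IsUnit (F.mapMatrix (scalarDSum p e)) ↔ IsUnit (F p) := by
    intro p
    rw [← isUnit_fromBlocks_iff (m := Fin e) (F p),
      ← MulEquiv.isUnit_map (Matrix.reindexRingEquiv S (finSumFinEquiv (m := 1) (n := e)))]
    congr!
    ext i j : 2
    change F (Matrix.fromBlocks (Matrix.diagonal fun _ : Fin 1 => p) 0 0 1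
        (finSumFinEquiv.symm i) (finSumFinEquiv.symm j)) =
      Matrix.fromBlocks (Matrix.diagonal fun _ : Fin 1 => F p) 0 0 1
        (finSumFinEquiv.symm i) (finSumFinEquiv.symm j)
    generalize finSumFinEquiv.symm i = i'
    generalize finSumFinEquiv.symm j = j'
    rcases i' with i' | i' <;> rcases j' with j' | j' <;>
      simp [Matrix.diagonal_apply, Matrix.one_apply, apply_ite F]
  rw [← hmap, h, map_mul, map_mul]
  exact ((hP.map F.mapMatrix).mul ((hmap b).2 hb)).mul (hQ.map F.mapMatrix)

end StableAssociation

section Main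

variable {k : Type*} [Field k] {g : ℕ}

/-- Translation of the variables. -/
def translateHom (β : Fin g → k) : FreeAlgebra k (Fin g) →ₐ[k] FreeAlgebra k (Fin g) :=
  FreeAlgebra.lift k fun i => ι k i + algebraMap k _ (β i)

/-- Translation of the variables as an automorphism. -/
def translate (β : Fin g → k) : FreeAlgebra k (Fin g) ≃ₐ[k] FreeAlgebra k (Fin g) :=
  AlgEquiv.ofAlgHom (translateHom β) (translateHom (-β))
    (FreeAlgebra.hom_ext (by ext; simp [translateHom]))
    (FreeAlgebra.hom_ext (by ext; simp [translateHom]))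

lemma lift_translate {A : Type*} [Ring A] [Algebra k A] (β : Fin g → k) (Y : Fin g → A)
    (p : FreeAlgebra k (Fin g)) :
    FreeAlgebra.lift k Y (translate β p) =
      FreeAlgebra.lift k (fun i => Y i + algebraMap k A (β i)) p := by
  change ((FreeAlgebra.lift k Y).comp (translateHom β)) p = _
  congr 1
  exact FreeAlgebra.hom_ext (by ext; simp [translateHom])

lemma constTerm_translate (β : Fin g → k) (p : FreeAlgebra k (Fin g)) :
    constTerm (translate β p) = FreeAlgebra.lift k β p := by
  refine (lift_translate β 0 p).trans ?_
  simp

lemma isAtomOne_translate {a : FreeAlgebra k (Fin g)} (ha : ScalarAtom a) {β : Fin g → k}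
    (h : FreeAlgebra.lift k β a = 1) : IsAtomOne (translate β a) where
  constTerm_eq := (constTerm_translate β a).trans h
  not_constant := fun ⟨c, hc⟩ => ha.1 ⟨c, (translate β).injective (by rw [hc, AlgEquiv.commutes])⟩
  factor u v huv := by
    have hconst : ∀ p, IsConstant ((translate β).symm p) → ∃ c, p = algebraMap k _ c :=
      fun p ⟨c, hc⟩ => ⟨c, by rw [← (translate β).apply_symm_apply p, hc, AlgEquiv.commutes]⟩
    refine (ha.2 _ _ ?_).imp (hconst u) (hconst v)
    rw [← map_mul, ← huv, AlgEquiv.symm_apply_apply]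

lemma isAtom_ne_zero {a : FreeAlgebra k (Fin g)} (ha : ScalarAtom a) : a ≠ 0 := by
  rintro rfl
  exact ha.1 ⟨0, (map_zero _).symm⟩

theorem exists_stablyAssociated {J : Type*} [Finite J] {a : FreeAlgebra k (Fin g)}
    (ha : ScalarAtom a) {b : J → FreeAlgebra k (Fin g)} (hb : ∀ j, ScalarAtom (b j))
    {β : Fin g → k} (haβ : FreeAlgebra.lift k β a = 1) (hbβ : ∀ j, FreeAlgebra.lift k β (b j) = 1)
    (H : ∀ (n : ℕ) (X : Fin g → Matrix (Fin n) (Fin n) k), (FreeAlgebra.lift k X a).det = 0 →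
      ∃ j, (FreeAlgebra.lift k X (b j)).det = 0) :
    ∃ j, StablyAssociatedScalar a (b j) := by
  obtain ⟨j, ⟨e⟩⟩ := exists_torsionModule_equiv (isAtomOne_translate ha haβ)
    (fun j => isAtomOne_translate (hb j) (hbβ j)) (fun n X hX => by
      simp_rw [lift_translate] at hX ⊢
      exact H n _ hX)
  refine ⟨j, IsSimilar.stablyAssociated (isAtom_ne_zero ha) (isAtom_ne_zero (hb j)) ?_⟩
  simpa using (isSimilar_of_equiv e).map (translate β).symm.toRingEquiv.toRingHom

lemma isConstant_smul {p : FreeAlgebra k (Fin g)} (hp : IsConstant p) (c : k) :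
    IsConstant (c • p) := by
  obtain ⟨d, rfl⟩ := hp
  exact ⟨c * d, by rw [Algebra.smul_def, map_mul]⟩

lemma scalarAtom_smul {p : FreeAlgebra k (Fin g)} (hp : ScalarAtom p) {c : k} (hc : c ≠ 0) :
    ScalarAtom (c • p) := by
  refine ⟨fun h => hp.1 ?_, fun u v huv => ?_⟩
  · simpa [smul_smul, inv_mul_cancel₀ hc] using isConstant_smul h c⁻¹
  · refine (hp.2 (c⁻¹ • u) v ?_).imp_left fun h => ?_
    · rw [smul_mul_assoc, ← huv, smul_smul, inv_mul_cancel₀ hc, one_smul]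
    · simpa [smul_smul, mul_inv_cancel₀ hc] using isConstant_smul h c

/-- Factorization into atoms normalized at a point of nonvanishing. -/
theorem exists_atomic_factorization (β : Fin g → k) (f : FreeAlgebra k (Fin g))
    (hf : FreeAlgebra.lift k β f ≠ 0) :
    ∃ (c : k) (l : List (FreeAlgebra k (Fin g))), c ≠ 0 ∧ f = c • l.prod ∧
      ∀ a ∈ l, ScalarAtom a ∧ FreeAlgebra.lift k β a = 1 := by
  induction hn : deg f using Nat.strong_induction_on generalizing f with
  | _ n ih =>
  by_cases hconst : IsConstant f
  · obtain ⟨c, rfl⟩ := hconst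
    rw [AlgHom.commutes] at hf
    exact ⟨c, [], hf, by simp [Algebra.algebraMap_eq_smul_one], by simp⟩
  by_cases hatom : ScalarAtom f
  · refine ⟨_, [(FreeAlgebra.lift k β f)⁻¹ • f], hf, ?_, ?_⟩
    · simp [smul_smul, mul_inv_cancel₀ hf]
    · simpa [inv_mul_cancel₀ hf] using scalarAtom_smul hatom (inv_ne_zero hf)
  obtain ⟨u, v, rfl, hu, hv⟩ : ∃ u v, f = u * v ∧ ¬IsConstant u ∧ ¬IsConstant v := by
    by_contra! h
    exact hatom ⟨hconst, fun u v huv => or_iff_not_imp_left.2 (h u v huv)⟩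
  rw [map_mul] at hf
  have hdeg : ∀ p : FreeAlgebra k (Fin g), ¬IsConstant p → p ≠ 0 ∧ deg p ≠ 0 := fun p hp =>
    ⟨fun h => hp ⟨0, by rw [h, map_zero]⟩, fun h => hp ⟨_, eq_algebraMap_of_deg_eq_zero h⟩⟩
  have hd := deg_mul (hdeg u hu).1 (hdeg v hv).1
  obtain ⟨c, l, hc, hl, hla⟩ := ih _ (by have := (hdeg v hv).2; omega) u
    (left_ne_zero_of_mul hf) rfl
  obtain ⟨d, l', hd, hl', hla'⟩ := ih _ (by have := (hdeg u hu).2; omega) v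
    (right_ne_zero_of_mul hf) rfl
  refine ⟨c * d, l ++ l', mul_ne_zero hc hd, ?_, fun a ha => ?_⟩
  · rw [hl, hl', List.prod_append, smul_mul_smul_comm]
  · exact (List.mem_append.1 ha).elim (hla a) (hla' a)

lemma det_lift_smul_prod_eq_zero_iff {n : ℕ} (X : Fin g → Matrix (Fin n) (Fin n) k) {c : k}
    (hc : c ≠ 0) (l : List (FreeAlgebra k (Fin g))) :
    (FreeAlgebra.lift k X (c • l.prod)).det = 0 ↔
      ∃ a ∈ l, (FreeAlgebra.lift k X a).det = 0 := by
  have h : (FreeAlgebra.lift k X l.prod).det =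
      (l.map fun a => (FreeAlgebra.lift k X a).det).prod := by
    rw [map_list_prod, ← Matrix.coe_detMonoidHom, map_list_prod, List.map_map]
    rfl
  rw [map_smul, Matrix.det_smul, mul_eq_zero_iff_left (pow_ne_zero _ hc), h,
    List.prod_eq_zero_iff]
  simp

lemma lift_ne_zero_of_freeLocus_subset {f₁ f₂ : FreeAlgebra k (Fin g)} {β : Fin g → k}
    (hβ : FreeAlgebra.lift k β f₂ ≠ 0)
    (H : ∀ (n : ℕ) (X : Fin g → Matrix (Fin n) (Fin n) k),
      (FreeAlgebra.lift k X f₁).det = 0 → (FreeAlgebra.lift k X f₂).det = 0) :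
    FreeAlgebra.lift k β f₁ ≠ 0 := by
  have hdet : ∀ f : FreeAlgebra k (Fin g),
      (FreeAlgebra.lift k (fun i => algebraMap k (Matrix (Fin 1) (Fin 1) k) (β i)) f).det =
        FreeAlgebra.lift k β f := by
    intro f
    have : FreeAlgebra.lift k (fun i => algebraMap k (Matrix (Fin 1) (Fin 1) k) (β i)) =
        (Algebra.ofId k _).comp (FreeAlgebra.lift k β) :=
      FreeAlgebra.hom_ext (by ext1; simp [Algebra.ofId_apply])
    rw [this, AlgHom.comp_apply, Algebra.ofId_apply, Matrix.det_fin_one]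
    simp [Matrix.algebraMap_matrix_apply]
  intro h
  rw [← hdet] at h hβ
  exact hβ (H 1 _ h)

end Main

end FreeLocus

open FreeLocus

/-- Free locus Nullstellensatz for noncommutative polynomials: `FL(f₁) ⊆ FL(f₂)` if and only
if each atomic factor of `f₁` is, up to stable associativity, an atomic factor of `f₂`. -/
theorem freeLocus_subset_iff_atomic_factors
    {k : Type*} [Field k] [IsAlgClosed k] [CharZero k] {g : ℕ}
    (f₁ f₂ : FreeAlgebra k (Fin g))
    (α β : Fin g → k)
    (hα : FreeAlgebra.lift k α f₁ ≠ 0) (hβ : FreeAlgebra.lift k β f₂ ≠ 0) :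
    (∀ (n : ℕ) (X : Fin g → Matrix (Fin n) (Fin n) k),
        (scalarEval f₁ X).det = 0 → (scalarEval f₂ X).det = 0) ↔
      ∃ (lam₁ lam₂ : k), lam₁ ≠ 0 ∧ lam₂ ≠ 0 ∧
        ∃ (l m : ℕ) (a : Fin l → FreeAlgebra k (Fin g)) (b : Fin m → FreeAlgebra k (Fin g)),
          (∀ i, ScalarAtom (a i)) ∧ (∀ j, ScalarAtom (b j)) ∧
          f₁ = lam₁ • (List.ofFn a).prod ∧ f₂ = lam₂ • (List.ofFn b).prod ∧
          ∀ i, ∃ j, StablyAssociatedScalar (a i) (b j) := by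
  simp only [scalarEval]
  constructor
  · intro H
    obtain ⟨c, l, hc, hl, hla⟩ := exists_atomic_factorization β f₁
      (lift_ne_zero_of_freeLocus_subset hβ H)
    obtain ⟨d, l', hd, hl', hlb⟩ := exists_atomic_factorization β f₂ hβ
    refine ⟨c, d, hc, hd, l.length, l'.length, l.get, l'.get, fun i => (hla _ (l.get_mem i)).1,
      fun j => (hlb _ (l'.get_mem j)).1, by rwa [List.ofFn_get], by rwa [List.ofFn_get],
      fun i => ?_⟩
    refine exists_stablyAssociated (hla _ (l.get_mem i)).1 (fun j => (hlb _ (l'.get_mem j)).1)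
      (hla _ (l.get_mem i)).2 (fun j => (hlb _ (l'.get_mem j)).2) fun n X hX => ?_
    have h2 := H n X (by
      rw [hl, det_lift_smul_prod_eq_zero_iff X hc]
      exact ⟨_, l.get_mem i, hX⟩)
    rw [hl', det_lift_smul_prod_eq_zero_iff X hd] at h2
    obtain ⟨b, hb, hb0⟩ := h2
    obtain ⟨j, rfl⟩ := List.get_of_mem hb
    exact ⟨j, hb0⟩
  · rintro ⟨c, d, hc, hd, l, m, a, b, -, -, rfl, rfl, hab⟩ n X
    rw [det_lift_smul_prod_eq_zero_iff X hc, det_lift_smul_prod_eq_zero_iff X hd]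
    simp only [List.mem_ofFn]
    rintro ⟨_, ⟨i, rfl⟩, hi⟩
    obtain ⟨j, hj⟩ := hab i
    refine ⟨_, ⟨j, rfl⟩, ?_⟩
    by_contra hne
    have := isUnit_of_stablyAssociated hj (FreeAlgebra.lift k X).toRingHom
      ((Matrix.isUnit_iff_isUnit_det _).2 (isUnit_iff_ne_zero.2 hne))
    exact ((Matrix.isUnit_iff_isUnit_det _).1 this).ne_zero hi
end
end

section
/- Let k be an algebraically closed field of characteristic zero, let A₁,…,A_g ∈ M_d(k) be jointly nilpotent, and let b₁,…,b_g, c ∈ k^d. Set B_j = A_j + b_j·cᵀ for j = 1,…,g, and assume the perturbation is non-degenerate: (i) the only subspace of k^d that is invariant under all A_j and contains all the vectors b₁,…,b_g is k^d itself; (ii) the only subspace of k^d that is invariant under all transposes A₁ᵀ,…,A_gᵀ and contains c is k^d itself. Then for every subspace S ⊆ k^d that is invariant under all B₁,…,B_g there exists a subspace S^× ⊆ k^d that is invariant under all A₁,…,A_g and is complementary to S, i.e. S ∩ S^× = {0} and S + S^× = k^d. -/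
open Matrix

section KernelFiltration

variable {k ι : Type*} [Field k] {d : ℕ}

/-- The vectors annihilated by every product of `n` of the matrices `A j`. -/
def kernelFiltration (A : ι → Matrix (Fin d) (Fin d) k) : ℕ → Submodule k (Fin d → k)
  | 0 => ⊥
  | n + 1 => ⨅ j, (kernelFiltration A n).comap (A j).mulVecLin

theorem mem_kernelFiltration_succ {A : ι → Matrix (Fin d) (Fin d) k} {n : ℕ} {v : Fin d → k} :
    v ∈ kernelFiltration A (n + 1) ↔ ∀ j, (A j).mulVec v ∈ kernelFiltration A n := by
  simp [kernelFiltration]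

theorem mulVec_mem_kernelFiltration {A : ι → Matrix (Fin d) (Fin d) k} {n : ℕ} (j : ι)
    {v : Fin d → k} (hv : v ∈ kernelFiltration A n) :
    (A j).mulVec v ∈ kernelFiltration A n := by
  induction n generalizing j v with
  | zero =>
    have hv : v = 0 := hv
    simp [hv]
  | succ n ih =>
    exact mem_kernelFiltration_succ.2 fun i => ih i (mem_kernelFiltration_succ.1 hv j)

theorem mem_kernelFiltration_of_prod_mulVec {A : ι → Matrix (Fin d) (Fin d) k} {n : ℕ}
    {v : Fin d → k} (h : ∀ w : Fin n → ι, (List.ofFn fun i => A (w i)).prod.mulVec v = 0) :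
    v ∈ kernelFiltration A n := by
  induction n generalizing v with
  | zero => simpa [kernelFiltration] using h Fin.elim0
  | succ n ih =>
    refine mem_kernelFiltration_succ.2 fun j => ih fun w => ?_
    have hw := h (Fin.snoc w j)
    rw [List.ofFn_succ'] at hw
    simpa [List.concat_eq_append, ← Matrix.mulVec_mulVec] using hw

/-- An observable pair has no nonzero invariant subspace on which `c` vanishes. -/
theorem eq_bot_of_invariant_of_dotProduct_eq_zero {A : ι → Matrix (Fin d) (Fin d) k}
    {c : Fin d → k}
    (hobs : ∀ W : Submodule k (Fin d → k),
      (∀ j, ∀ v ∈ W, (A j)ᵀ.mulVec v ∈ W) → c ∈ W → W = ⊤)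
    {U : Submodule k (Fin d → k)} (hU : ∀ j, ∀ v ∈ U, (A j).mulVec v ∈ U)
    (hc : ∀ v ∈ U, c ⬝ᵥ v = 0) : U = ⊥ := by
  let W : Submodule k (Fin d → k) :=
    { carrier := {u | ∀ v ∈ U, u ⬝ᵥ v = 0}
      add_mem' := fun hx hy v hv => by rw [add_dotProduct, hx v hv, hy v hv, add_zero]
      zero_mem' := fun v _ => zero_dotProduct v
      smul_mem' := fun a x hx v hv => by rw [smul_dotProduct, hx v hv, smul_zero] }
  have hW : W = ⊤ := hobs W
    (fun j u hu v hv => by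
      rw [Matrix.mulVec_transpose, ← Matrix.dotProduct_mulVec]
      exact hu _ (hU j v hv)) hc
  refine (Submodule.eq_bot_iff U).2 fun v hv => ?_
  refine dotProduct_eq_zero v fun u => ?_
  have hu : u ∈ W := hW ▸ Submodule.mem_top
  rw [dotProduct_comm]
  exact hu v hv

end KernelFiltration

/-- Invariant subspaces of non-degenerate right rank-one perturbations of jointly nilpotent
tuples admit invariant complements for the original tuple. -/
theorem invariant_complement_of_rank_one_perturbation
    {k : Type*} [Field k] [IsAlgClosed k] [CharZero k] {g d : ℕ}
    (A : Fin g → Matrix (Fin d) (Fin d) k) (b : Fin g → Fin d → k) (c : Fin d → k)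
    (hnilp : ∃ m : ℕ, ∀ w : Fin m → Fin g, (List.ofFn fun i => A (w i)).prod = 0)
    (hndeg₁ : ∀ W : Submodule k (Fin d → k),
      (∀ j, ∀ v ∈ W, (A j).mulVec v ∈ W) → (∀ j, b j ∈ W) → W = ⊤)
    (hndeg₂ : ∀ W : Submodule k (Fin d → k),
      (∀ j, ∀ v ∈ W, (A j)ᵀ.mulVec v ∈ W) → c ∈ W → W = ⊤)
    (S : Submodule k (Fin d → k))
    (hS : ∀ j, ∀ v ∈ S, (A j + Matrix.vecMulVec (b j) c).mulVec v ∈ S) :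
    ∃ T : Submodule k (Fin d → k),
      (∀ j, ∀ v ∈ T, (A j).mulVec v ∈ T) ∧ S ⊓ T = ⊥ ∧ S ⊔ T = ⊤ := by
  classical
  have hB : ∀ j, ∀ v ∈ S, (A j).mulVec v + (c ⬝ᵥ v) • b j ∈ S := fun j v hv => by
    simpa [Matrix.add_mulVec, Matrix.vecMulVec_mulVec] using hS j v hv
  by_cases hbot : S = ⊥
  · exact ⟨⊤, by simp, by simp [hbot], by simp⟩
  have hex : ∃ n, S ⊓ kernelFiltration A n ≠ ⊥ := by
    obtain ⟨m, hm⟩ := hnilp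
    refine ⟨m, ?_⟩
    have htop : kernelFiltration A m = ⊤ :=
      eq_top_iff.2 fun v _ => mem_kernelFiltration_of_prod_mulVec fun w => by simp [hm w]
    simpa [htop] using hbot
  obtain ⟨n, hn, hmin⟩ : ∃ n, S ⊓ kernelFiltration A (n + 1) ≠ ⊥ ∧
      S ⊓ kernelFiltration A n = ⊥ := by
    cases hN : Nat.find hex with
    | zero => exact absurd (by simp [kernelFiltration]) (hN ▸ Nat.find_spec hex)
    | succ n =>
      exact ⟨n, hN ▸ Nat.find_spec hex, not_not.1 (Nat.find_min hex (by omega))⟩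
  obtain ⟨s, hs, hcs⟩ : ∃ s ∈ S ⊓ kernelFiltration A (n + 1), c ⬝ᵥ s ≠ 0 := by
    by_contra! hzero
    refine hn (eq_bot_of_invariant_of_dotProduct_eq_zero hndeg₂ (fun j v hv => ?_) hzero)
    refine ⟨?_, mulVec_mem_kernelFiltration j hv.2⟩
    simpa [hzero v hv] using hB j v hv.1
  refine ⟨kernelFiltration A n, fun j v => mulVec_mem_kernelFiltration j, hmin, ?_⟩
  have hAs : ∀ j, (A j).mulVec s ∈ S ⊔ kernelFiltration A n := fun j =>
    Submodule.mem_sup_right (mem_kernelFiltration_succ.1 hs.2 j)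
  have hb : ∀ j, b j ∈ S ⊔ kernelFiltration A n := fun j => by
    have h := Submodule.sub_mem _ (Submodule.mem_sup_left (hB j s hs.1)) (hAs j)
    rw [add_sub_cancel_left] at h
    exact (Submodule.smul_mem_iff _ hcs).1 h
  refine hndeg₁ _ (fun j v hv => ?_) hb
  obtain ⟨x, hx, y, hy, rfl⟩ := Submodule.mem_sup.1 hv
  rw [Matrix.mulVec_add]
  refine Submodule.add_mem _ ?_ (Submodule.mem_sup_right (mulVec_mem_kernelFiltration j hy))
  have h := Submodule.sub_mem _ (Submodule.mem_sup_left (hB j x hx))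
    (Submodule.smul_mem _ (c ⬝ᵥ x) (hb j))
  rwa [add_sub_cancel_right] at h
end

section
/- Let L = I_d − Σ_{j=1}^g A_j x_j be an LMI-minimal hermitian monic pencil over ℂ. Then there exists n₀ ∈ ℕ such that for all n ≥ n₀ the set ∂¹D_n(L) is Zariski dense in FL_n(L): every polynomial p ∈ MvPolynomial (Fin g × Fin n × Fin n) ℂ that vanishes when evaluated at the entries of every tuple X ∈ ∂¹D_n(L) also vanishes when evaluated at the entries of every tuple X ∈ FL_n(L). -/
open Matrix MvPolynomial
open scoped ComplexOrder

noncomputable section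

/-- Evaluation of the monic linear pencil `L = I_d - ∑ j, A j * x j` at a `g`-tuple `X` of
`n × n` matrices over a commutative `k`-algebra `R`, via the Kronecker product. -/
def pencilEval {k : Type*} [CommRing k] {g d n : ℕ} {R : Type*} [CommRing R] [Algebra k R]
    (A : Fin g → Matrix (Fin d) (Fin d) k) (X : Fin g → Matrix (Fin n) (Fin n) R) :
    Matrix (Fin d × Fin n) (Fin d × Fin n) R :=
  1 - ∑ j, Matrix.kroneckerMap (· * ·) ((A j).map fun a => algebraMap k R a) (X j)

/-- The free spectrahedron (LMI domain) of a hermitian monic pencil at level `n`: the tuples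
of hermitian `n × n` matrices where the pencil is positive semidefinite. -/
def lmiDom {g d : ℕ} (A : Fin g → Matrix (Fin d) (Fin d) ℂ) (n : ℕ) :
    Set (Fin g → Matrix (Fin n) (Fin n) ℂ) :=
  {X | (∀ j, (X j).IsHermitian) ∧ (pencilEval A X).PosSemidef}

open AlgebraicIndependent IntermediateField.algebraAdjoinAdjoin in
theorem AlgebraicIndependent.of_mem_adjoin {k F ι κ : Type*} [Field k] [Field F] [Algebra k F]
    [Fintype ι] [Fintype κ] {x : ι → F} {y : κ → F} (hx : AlgebraicIndependent k x)
    (hxy : ∀ i, x i ∈ IntermediateField.adjoin k (Set.range y)) :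
    Fintype.card ι ≤ Fintype.card κ ∧
      (Fintype.card κ ≤ Fintype.card ι → AlgebraicIndependent k y) := by
  classical
  let M := AlgebraicIndependent.matroid k F
  have hxM : M.Indep (Set.range x) := matroid_indep_iff.2 hx.to_subtype_range
  have hsub : Set.range x ⊆ M.closure (Set.range y) := by
    rintro _ ⟨i, rfl⟩
    rw [show M.closure (Set.range y) = _ from matroid_closure_eq]
    rw [SetLike.mem_coe, Subalgebra.mem_algebraicClosure]
    exact (Algebra.IsAlgebraic.isAlgebraic (R := Algebra.adjoin k (Set.range y))
      (⟨x i, hxy i⟩ : IntermediateField.adjoin k (Set.range y))).algebraMap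
  have h1 : (Set.range x).encard ≤ M.eRk (Set.range y) := by
    rw [← hxM.eRk_eq_encard, ← M.eRk_closure_eq (Set.range y)]
    exact M.eRk_mono hsub
  have h2 : (Set.range x).encard = Fintype.card ι := by
    rw [← Set.image_univ, hx.injective.encard_image, Set.encard_univ]
    simp
  have h3 : (Set.range y).encard ≤ Fintype.card κ := by
    rw [← Set.image_univ]
    exact (Set.encard_image_le _ _).trans (by simp)
  rw [h2] at h1
  have h4 := M.eRk_le_encard (Set.range y)
  refine ⟨by exact_mod_cast h1.trans (h4.trans h3), fun hle => ?_⟩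
  have hle' : (Fintype.card κ : ℕ∞) ≤ Fintype.card ι := by exact_mod_cast hle
  have h5 : M.eRk (Set.range y) = (Set.range y).encard :=
    le_antisymm h4 (h3.trans (hle'.trans h1))
  have h6 : M.Indep (Set.range y) :=
    (Matroid.indep_iff_eRk_eq_encard_of_finite (Set.finite_range y)).2 h5
  have h7 : Function.Injective y := by
    rw [← Set.injOn_univ]
    refine Set.Finite.injOn_of_encard_image_eq Set.finite_univ ?_
    rw [Set.image_univ]
    refine le_antisymm (h3.trans (by simp)) ?_
    simpa using hle'.trans (h1.trans h4)
  exact AlgebraicIndependent.of_subtype_range h7 (matroid_indep_iff.1 h6)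

theorem exists_algebraicIndependent_option_near {k ι : Type*} [Field k] [Countable k] [Algebra k ℂ]
    [Countable ι] {x : ι → ℂ} (hx : AlgebraicIndependent k x) (a : ℝ) {ε : ℝ} (hε : 0 < ε) :
    ∃ t : ℝ, |t - a| < ε ∧ AlgebraicIndependent k (fun o : Option ι => o.elim (t : ℂ) x) := by
  have : Countable (Algebra.adjoin k (Set.range x)) := by
    rw [Algebra.adjoin_range_eq_range_aeval]
    have : Countable (MvPolynomial ι k) := by
      rw [← Cardinal.mk_le_aleph0_iff]
      refine (MvPolynomial.cardinalMk_le_max_lift (σ := ι) (R := k)).trans ?_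
      simp
    exact (AlgHom.rangeRestrict_surjective (aeval x)).countable
  have hc : {t : ℝ | IsAlgebraic (Algebra.adjoin k (Set.range x)) (t : ℂ)}.Countable :=
    (Algebraic.countable (Algebra.adjoin k (Set.range x)) ℂ).preimage Complex.ofReal_injective
  have hu : ¬ (Set.Ioo (a - ε) (a + ε)).Countable := by
    rw [← Cardinal.le_aleph0_iff_set_countable, Cardinal.mk_Ioo_real (by linarith), not_le]
    exact Cardinal.aleph0_lt_continuum
  obtain ⟨t, ht, htc⟩ := Set.not_subset.1 fun h => hu (hc.mono h)
  refine ⟨t, ?_, (hx.option_iff_transcendental _).2 htc⟩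
  rw [abs_lt]
  constructor <;> linarith [ht.1, ht.2]

theorem exists_algebraicIndependent_near {k ι : Type*} [Field k] [Countable k] [Algebra k ℂ]
    [Fintype ι] (a : ι → ℝ) {ε : ℝ} (hε : 0 < ε) :
    ∃ t : ι → ℝ, (∀ i, |t i - a i| < ε) ∧ AlgebraicIndependent k (fun i => (t i : ℂ)) := by
  classical
  revert a
  refine Fintype.induction_empty_option (P := fun ι _ => ∀ a : ι → ℝ,
    ∃ t : ι → ℝ, (∀ i, |t i - a i| < ε) ∧ AlgebraicIndependent k (fun i => (t i : ℂ)))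
    ?_ ?_ ?_ ι
  · intro α β _ e h a
    obtain ⟨t, ht, hi⟩ := h (a ∘ e)
    exact ⟨t ∘ e.symm, fun i => by simpa using ht (e.symm i), hi.comp e.symm e.symm.injective⟩
  · intro a
    refine ⟨fun i => i.elim, fun i => i.elim, ?_⟩
    exact algebraicIndependent_empty_type_iff.2 (algebraMap k ℂ).injective
  · intro α _ h a
    obtain ⟨t, ht, hi⟩ := h (a ∘ some)
    obtain ⟨s, hs, hs'⟩ := exists_algebraicIndependent_option_near hi (a none) hε
    refine ⟨fun o => o.elim s t, ?_, ?_⟩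
    · rintro (_ | i)
      · exact hs
      · exact ht i
    · convert hs' using 2 with o
      cases o <;> rfl

/-- A matrix with entries in an intermediate field that is injective over the big field has a
left inverse with entries in the intermediate field. -/
theorem IntermediateField.exists_matrix_leftInverse {k F m n : Type*} [Field k] [Field F]
    [Algebra k F] [Fintype m] [Fintype n] [DecidableEq m] [DecidableEq n]
    (K : IntermediateField k F) (M : Matrix m n F)
    (hM : ∀ i j, M i j ∈ K) (hinj : ∀ v : n → F, M *ᵥ v = 0 → v = 0) :
    ∃ B : Matrix n m F, (∀ i j, B i j ∈ K) ∧ B * M = 1 := by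
  let M' : Matrix m n K := Matrix.of fun i j => ⟨M i j, hM i j⟩
  have hM' : M'.map (algebraMap K F) = M := by ext; rfl
  have hker : LinearMap.ker M'.mulVecLin = ⊥ := by
    rw [LinearMap.ker_eq_bot']
    intro v hv
    have h1 : M *ᵥ (algebraMap K F ∘ v) = 0 := by
      ext i
      rw [← hM', ← RingHom.map_mulVec]
      simpa using congrArg (algebraMap K F) (congrFun hv i)
    have h2 := hinj _ h1
    ext i
    exact congrFun h2 i
  obtain ⟨L, hL⟩ := LinearMap.exists_leftInverse_of_injective _ hker
  refine ⟨(LinearMap.toMatrix' L).map (algebraMap K F), fun i j => (LinearMap.toMatrix' L i j).2, ?_⟩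
  rw [← hM', ← Matrix.map_mul, ← LinearMap.toMatrix'_toLin' M', ← LinearMap.toMatrix'_comp]
  have : L ∘ₗ Matrix.toLin' M' = LinearMap.id := hL
  rw [this, LinearMap.toMatrix'_id]
  exact Matrix.map_one _ (map_zero _) (map_one _)

section FieldOfDefinition

variable {k F : Type*} [Field k] [Field F] [Algebra k F] {K : IntermediateField k F}
  {l m n : Type*} [Fintype m]

theorem IntermediateField.matrix_mul_mem {M : Matrix l m F} {N : Matrix m n F}
    (hM : ∀ i j, M i j ∈ K) (hN : ∀ i j, N i j ∈ K) (i : l) (j : n) : (M * N) i j ∈ K :=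
  sum_mem fun a _ => mul_mem (hM i a) (hN a j)

theorem IntermediateField.matrix_sum_mem {ι : Type*} [Fintype ι] {M : ι → Matrix l n F}
    (hM : ∀ a i j, M a i j ∈ K) (i : l) (j : n) : (∑ a, M a) i j ∈ K := by
  rw [Matrix.sum_apply]
  exact sum_mem fun a _ => hM a i j

/-- The affine reparametrisation `Z = c⁻¹ X + D B C` of the solutions `X` of `∑ X U N = c Q`
recovers both `D` and `X` rationally. -/
theorem mem_of_affine_param {g n r m : Type*} [Fintype g] [Fintype n] [Fintype r] [Fintype m]
    [DecidableEq r] [DecidableEq m] {X Z : g → Matrix n n F} {U : Matrix n r F} {C : Matrix r n F}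
    {N : g → Matrix r m F} {B : g → Matrix m r F} {Q D : Matrix n m F} {c : F} (hc : c ≠ 0)
    (hU : ∀ i j, U i j ∈ K) (hC : ∀ i j, C i j ∈ K) (hN : ∀ a i j, N a i j ∈ K)
    (hB : ∀ a i j, B a i j ∈ K) (hQ : ∀ i j, Q i j ∈ K) (hZ : ∀ a i j, Z a i j ∈ K) (hcK : c ∈ K)
    (hCU : C * U = 1) (hBN : ∑ a, B a * N a = 1) (hX : ∑ a, X a * U * N a = c • Q)
    (hZX : ∀ a, Z a = c⁻¹ • X a + D * B a * C) :
    (∀ i j, D i j ∈ K) ∧ ∀ a i j, X a i j ∈ K := by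
  have h1 : ∑ a, Z a * U * N a = Q + D := by
    have h2 : ∀ a, Z a * U * N a = c⁻¹ • (X a * U * N a) + D * (B a * N a) := by
      intro a
      rw [hZX, Matrix.add_mul, Matrix.add_mul, Matrix.smul_mul, Matrix.smul_mul,
        Matrix.mul_assoc (D * B a) C U, hCU, Matrix.mul_one, Matrix.mul_assoc D]
    simp_rw [h2]
    rw [Finset.sum_add_distrib, ← Finset.smul_sum, hX, ← Matrix.mul_sum, hBN, smul_smul,
      inv_mul_cancel₀ hc, one_smul, Matrix.mul_one]
  have hD : D = ∑ a, Z a * U * N a - Q := by rw [h1]; abel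
  have hDK : ∀ i j, D i j ∈ K := by
    intro i j
    rw [hD]
    exact sub_mem (IntermediateField.matrix_sum_mem (fun a => IntermediateField.matrix_mul_mem
      (IntermediateField.matrix_mul_mem (hZ a) hU) (hN a)) i j) (hQ i j)
  refine ⟨hDK, fun a i j => ?_⟩
  have hXa : X a = c • (Z a - D * B a * C) := by
    rw [hZX, add_sub_cancel_right, smul_smul, mul_inv_cancel₀ hc, one_smul]
  rw [hXa]
  exact mul_mem hcK (sub_mem (hZ a i j) (IntermediateField.matrix_mul_mem
    (IntermediateField.matrix_mul_mem hDK (hB a)) hC i j))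

end FieldOfDefinition

/-- The entries of a tuple of matrices as a single family. -/
def tupleEntries {g n F : Type*} (X : g → Matrix n n F) : g × n × n → F :=
  fun v => X v.1 v.2.1 v.2.2

section Generic

variable {k F : Type*} [Field k] [Field F] [Algebra k F]
  {g n d : Type*} [Fintype g] [Fintype n] [Fintype d] [DecidableEq d]

theorem AlgebraicIndependent.eigenvector_param {A : g → Matrix d d k} {B : g → Matrix d d k}
    (hB : ∑ a, B a * (A a)ᵀ = 1) {X : g → Matrix n n F} {t : Option (n × d) → F}
    (hx : AlgebraicIndependent k (Sum.elim (tupleEntries X) t)) {c : F} (hc : c ≠ 0)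
    {V : Matrix n d F} (hV : ∑ a, X a * V * ((A a).map (algebraMap k F))ᵀ = c • V)
    {e : n × d} (hVe : V e.1 e.2 = t none) {C : Matrix d n F}
    (hC : ∀ i j, C i j ∈ IntermediateField.adjoin k (Set.range fun e : n × d => V e.1 e.2))
    (hCV : C * V = 1) {Z : g → Matrix n n F} (hZ : ∀ a, Z a =
      c⁻¹ • X a + (Matrix.of fun i j => t (some (i, j))) * (B a).map (algebraMap k F) * C) :
    AlgebraicIndependent k (Sum.elim (fun e : n × d => V e.1 e.2) (tupleEntries Z)) := by
  obtain ⟨y', hnone, hinl, hinr, hsome⟩ : ∃ y' : Option ((n × d) ⊕ (g × n × n)) → F, y' none = c ∧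
      (∀ i j, y' (some (Sum.inl (i, j))) = V i j) ∧
      (∀ a i j, y' (some (Sum.inr (a, i, j))) = Z a i j) ∧
      y' ∘ some = Sum.elim (fun e : n × d => V e.1 e.2) (tupleEntries Z) :=
    ⟨fun o => o.elim c (Sum.elim (fun e : n × d => V e.1 e.2) (tupleEntries Z)), rfl,
      fun _ _ => rfl, fun _ _ _ => rfl, rfl⟩
  rw [← hsome]
  obtain ⟨K, hK⟩ : ∃ K, K = IntermediateField.adjoin k (Set.range y') := ⟨_, rfl⟩
  have hmem : ∀ o, y' o ∈ K := fun o => hK ▸ IntermediateField.subset_adjoin _ _ ⟨o, rfl⟩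
  have hVK : ∀ i j, V i j ∈ K := fun i j => hinl i j ▸ hmem _
  have hle : IntermediateField.adjoin k (Set.range fun e : n × d => V e.1 e.2) ≤ K := by
    rw [IntermediateField.adjoin_le_iff]
    rintro _ ⟨e, rfl⟩
    exact hVK _ _
  have hkK : ∀ M : Matrix d d k, ∀ i j, M.map (algebraMap k F) i j ∈ K :=
    fun M i j => K.algebraMap_mem _
  have hBm : ∑ a, (B a).map (algebraMap k F) * ((A a).map (algebraMap k F))ᵀ = 1 := by
    have := congrArg (algebraMap k F).mapMatrix hB
    rw [map_sum, map_one] at this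
    rw [← this]
    refine Finset.sum_congr rfl fun a _ => ?_
    rw [map_mul]
    rfl
  obtain ⟨hD, hX⟩ := mem_of_affine_param (K := K) (X := X) (Z := Z) (U := V) (C := C)
    (N := fun a => ((A a).map (algebraMap k F))ᵀ) (B := fun a => (B a).map (algebraMap k F))
    (Q := V) (D := Matrix.of fun i j => t (some (i, j))) hc hVK (fun i j => hle (hC i j))
    (fun a i j => hkK _ _ _) (fun a => hkK _) hVK
    (fun a i j => hinr a i j ▸ hmem _) (hnone ▸ hmem none) hCV hBm hV hZ
  have key := hx.of_mem_adjoin (y := y') (by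
    rw [← hK]
    rintro (⟨a, i, j⟩ | (_ | ⟨i, j⟩))
    · exact hX a i j
    · rw [Sum.elim_inr, ← hVe]
      exact hVK _ _
    · exact hD i j)
  have h3 := key.2 (by
    simp only [Fintype.card_option, Fintype.card_sum]
    omega)
  exact h3.comp _ (Option.some_injective _)

end Generic

section Rank

variable {F m n : Type*} [Field F] [Fintype n]

theorem Matrix.exists_rank_factorization (V : Matrix m n F) :
    ∃ (r : ℕ) (U : Matrix m (Fin r) F) (Y : Matrix (Fin r) n F),
      V.rank = r ∧ V = U * Y ∧ ∀ v, U *ᵥ v = 0 → v = 0 := by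
  classical
  obtain ⟨r, hr⟩ : ∃ r, V.rank = r := ⟨_, rfl⟩
  let b : Module.Basis (Fin r) F (LinearMap.range V.mulVecLin) :=
    Module.finBasisOfFinrankEq F _ hr
  refine ⟨r, Matrix.of fun i k => (b k : m → F) i,
    Matrix.of fun k j => b.repr ⟨V *ᵥ Pi.single j 1, LinearMap.mem_range_self V.mulVecLin _⟩ k,
    hr, ?_, ?_⟩
  · ext i j
    have h := b.sum_repr ⟨V *ᵥ Pi.single j 1, LinearMap.mem_range_self V.mulVecLin _⟩
    have h' := congrFun (congrArg Subtype.val h) i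
    rw [Matrix.mul_apply]
    simp only [Matrix.of_apply]
    rw [Submodule.coe_sum, Finset.sum_apply] at h'
    simp only [Submodule.coe_smul, Pi.smul_apply, smul_eq_mul, mulVec_single_one] at h'
    rw [show V i j = V.col j i from rfl, ← h']
    refine Finset.sum_congr rfl fun k _ => ?_
    rw [mul_comm]
    simp only [mulVec_single_one]
  · intro v hv
    have h : ∑ k, v k • b k = 0 := by
      apply Subtype.ext
      rw [Submodule.coe_sum]
      ext i
      have := congrFun hv i
      simp only [mulVec, dotProduct, Matrix.of_apply] at this
      simpa [Finset.sum_apply, mul_comm] using this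
    ext k
    exact Fintype.linearIndependent_iff.1 b.linearIndependent v h k

theorem Matrix.exists_submatrix_mulVec_injective [Finite m] (M : Matrix m n F) {s : ℕ} (hs : s ≤ M.rank) :
    ∃ f : Fin s → n, Function.Injective f ∧ ∀ v, M.submatrix id f *ᵥ v = 0 → v = 0 := by
  obtain ⟨κ, a, ha, hspan, hli⟩ := exists_linearIndependent' F M.col
  have : Finite κ := Finite.of_injective a ha
  have := Fintype.ofFinite κ
  have hcard : M.rank = Fintype.card κ := by
    rw [Matrix.rank_eq_finrank_span_cols, ← hspan, finrank_span_eq_card hli]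
  let e : Fin s → κ := (Fintype.equivFin κ).symm ∘ Fin.castLE (hcard ▸ hs)
  have he : Function.Injective e :=
    (Fintype.equivFin κ).symm.injective.comp (Fin.castLE_injective _)
  refine ⟨a ∘ e, ha.comp he, fun v hv => ?_⟩
  have h := Fintype.linearIndependent_iff.1 (hli.comp e he) v (by
    ext i
    have := congrFun hv i
    simpa [mulVec, dotProduct, mul_comm] using this)
  exact funext h

end Rank

section Generic

variable {k F : Type*} [Field k] [Field F] [Algebra k F]
  {g n d : Type*} [Fintype g] [Fintype n] [Fintype d]

theorem AlgebraicIndependent.card_le_of_eigenvector_factorization {A : g → Matrix d d k}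
    {X : g → Matrix n n F} {t : Option (n × d) → F}
    (hx : AlgebraicIndependent k (Sum.elim (tupleEntries X) t)) {c : F} (hc : c ≠ 0) {r : ℕ}
    {U : Matrix n (Fin r) F} {Y : Matrix (Fin r) d F}
    (hV : ∑ a, X a * (U * Y) * ((A a).map (algebraMap k F))ᵀ = c • (U * Y))
    (hU : ∀ v, U *ᵥ v = 0 → v = 0) {f : Fin (r + 1) → d} (hf : Function.Injective f)
    (hMf : ∀ v, (Matrix.of fun (q : g × Fin r) j =>
      (Y * ((A q.1).map (algebraMap k F))ᵀ) q.2 (f j)) *ᵥ v = 0 → v = 0) :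
    Fintype.card n ≤ r * Fintype.card d + 1 := by
  classical
  obtain ⟨M, hM⟩ : ∃ M : Matrix (g × Fin r) (Fin (r + 1)) F, M = Matrix.of fun q j =>
      (Y * ((A q.1).map (algebraMap k F))ᵀ) q.2 (f j) := ⟨_, rfl⟩
  rw [← hM] at hMf
  obtain ⟨N, hN⟩ : ∃ N : g → Matrix (Fin r) (Fin (r + 1)) F, ∀ a i j, N a i j = M (a, i) j :=
    ⟨fun a => Matrix.of fun i j => M (a, i) j, fun _ _ _ => rfl⟩
  obtain ⟨K₀, hK₀⟩ : ∃ K₀, K₀ = IntermediateField.adjoin k (Set.range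
    (Sum.elim (fun e : n × Fin r => U e.1 e.2) (fun e : Fin r × d => Y e.1 e.2))) := ⟨_, rfl⟩
  have hUK₀ : ∀ i j, U i j ∈ K₀ := fun i j =>
    hK₀ ▸ IntermediateField.subset_adjoin _ _ ⟨Sum.inl (i, j), rfl⟩
  have hYK₀ : ∀ i j, Y i j ∈ K₀ := fun i j =>
    hK₀ ▸ IntermediateField.subset_adjoin _ _ ⟨Sum.inr (i, j), rfl⟩
  have hNK₀ : ∀ a i j, M (a, i) j ∈ K₀ := fun a i j => hM ▸
    IntermediateField.matrix_mul_mem hYK₀ (fun _ _ => K₀.algebraMap_mem _) i (f j)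
  obtain ⟨C, hCK₀, hCU⟩ := IntermediateField.exists_matrix_leftInverse K₀ U hUK₀ hU
  obtain ⟨B', hBK₀, hBM⟩ := IntermediateField.exists_matrix_leftInverse K₀ M
    (fun q j => hNK₀ q.1 q.2 j) hMf
  obtain ⟨B, hB⟩ : ∃ B : g → Matrix (Fin (r + 1)) (Fin r) F, ∀ a i j, B a i j = B' i (a, j) :=
    ⟨fun a => Matrix.of fun i j => B' i (a, j), fun _ _ _ => rfl⟩
  have hBN : ∑ a, B a * N a = 1 := by
    rw [← hBM]
    ext i j
    rw [Matrix.sum_apply, Matrix.mul_apply, Fintype.sum_prod_type]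
    refine Finset.sum_congr rfl fun a _ => ?_
    rw [Matrix.mul_apply]
    exact Finset.sum_congr rfl fun l _ => by rw [hB, hN]
  obtain ⟨D, hDt⟩ : ∃ D : Matrix n (Fin (r + 1)) F, ∀ i j, D i j = t (some (i, f j)) :=
    ⟨Matrix.of fun i j => t (some (i, f j)), fun _ _ => rfl⟩
  obtain ⟨Z, hZ⟩ : ∃ Z : g → Matrix n n F, ∀ a, Z a = c⁻¹ • X a + D * B a * C :=
    ⟨_, fun _ => rfl⟩
  obtain ⟨y, hnone, hinl, hinr⟩ :
      ∃ y : Option (((n × Fin r) ⊕ (Fin r × d)) ⊕ (g × n × n)) → F, y none = c ∧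
      (∀ e, y (some (Sum.inl e)) = Sum.elim (fun e : n × Fin r => U e.1 e.2)
        (fun e : Fin r × d => Y e.1 e.2) e) ∧
      (∀ a i j, y (some (Sum.inr (a, i, j))) = Z a i j) :=
    ⟨fun o => o.elim c (Sum.elim (Sum.elim (fun e : n × Fin r => U e.1 e.2)
        (fun e : Fin r × d => Y e.1 e.2)) (tupleEntries Z)),
      rfl, fun _ => rfl, fun _ _ _ => rfl⟩
  obtain ⟨K, hK⟩ : ∃ K, K = IntermediateField.adjoin k (Set.range y) := ⟨_, rfl⟩
  have hmem : ∀ o, y o ∈ K := fun o => hK ▸ IntermediateField.subset_adjoin _ _ ⟨o, rfl⟩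
  have hle : K₀ ≤ K := by
    rw [hK₀, IntermediateField.adjoin_le_iff]
    rintro _ ⟨e, rfl⟩
    exact hinl e ▸ hmem _
  have hVK : ∀ i j, (U * Y) i j ∈ K := fun i j =>
    hle (IntermediateField.matrix_mul_mem hUK₀ hYK₀ i j)
  obtain ⟨hD, hX⟩ := mem_of_affine_param (K := K) (X := X) (Z := Z) (U := U) (C := C)
    (N := N) (B := B) (Q := (U * Y).submatrix id f) (D := D) hc (fun i j => hle (hUK₀ i j))
    (fun i j => hle (hCK₀ i j)) (fun a i j => hN a i j ▸ hle (hNK₀ a i j))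
    (fun a i j => hB a i j ▸ hle (hBK₀ i (a, j))) (fun i j => hVK i (f j))
    (fun a i j => hinr a i j ▸ hmem _) (hnone ▸ hmem none) hCU hBN
    (by
      ext i j
      have h := congrFun (congrFun hV i) (f j)
      rw [Matrix.sum_apply] at h ⊢
      rw [Matrix.smul_apply, Matrix.submatrix_apply, id, ← Matrix.smul_apply, ← h]
      refine Finset.sum_congr rfl fun a _ => ?_
      rw [← Matrix.mul_assoc (X a), Matrix.mul_assoc (X a * U), Matrix.mul_apply,
        Matrix.mul_apply]
      exact Finset.sum_congr rfl fun l _ => by rw [hN, hM]; rfl) hZ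
  have hx' : AlgebraicIndependent k (Sum.elim (tupleEntries X)
      fun e : n × Fin (r + 1) => D e.1 e.2) := by
    have h1 := hx.comp (Sum.map id fun e : n × Fin (r + 1) => some (e.1, f e.2))
      (Function.injective_id.sumMap fun e e' h => by
        simp only [Option.some.injEq, Prod.mk.injEq] at h
        exact Prod.ext h.1 (hf h.2))
    convert h1 using 1
    ext (_ | _)
    · rfl
    · exact hDt _ _
  have key := (hx'.of_mem_adjoin (y := y) (by
    rw [← hK]
    rintro (⟨a, i, j⟩ | ⟨i, j⟩)
    · exact hX a i j
    · exact hD i j)).1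
  simp only [Fintype.card_option, Fintype.card_sum, Fintype.card_prod, Fintype.card_fin] at key
  nlinarith

/-- An irreducible tuple strictly enlarges every proper nonzero row space. -/
theorem Matrix.lt_rank_stack_of_irreducible {A : g → Matrix d d F}
    (hA : ∀ S : Submodule F (d → F), (∀ a, ∀ v ∈ S, A a *ᵥ v ∈ S) → S = ⊥ ∨ S = ⊤)
    {r : ℕ} (hr : r < Fintype.card d) {Y : Matrix (Fin r) d F} (hY0 : Y ≠ 0) (hYr : Y.rank = r)
    {W : g → Matrix (Fin r) (Fin r) F} (hW : ∑ a, W a * (Y * (A a)ᵀ) = Y) :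
    r < (Matrix.of fun (q : g × Fin r) j => (Y * (A q.1)ᵀ) q.2 j).rank := by
  rw [Matrix.rank_eq_finrank_span_row] at hYr ⊢
  set S := Submodule.span F (Set.range Y.row) with hS
  set M := Matrix.of fun (q : g × Fin r) j => (Y * (A q.1)ᵀ) q.2 j with hM
  set S' := Submodule.span F (Set.range M.row) with hS'
  have hrow : ∀ a i, M.row (a, i) = A a *ᵥ Y.row i := by
    intro a i
    ext j
    simp [hM, Matrix.mul_apply, mulVec, dotProduct, mul_comm]
  have hle : S ≤ S' := by
    rw [hS, Submodule.span_le]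
    rintro _ ⟨i, rfl⟩
    have h : Y.row i = ∑ a, ∑ l, W a i l • M.row (a, l) := by
      ext j
      conv_lhs => rw [← hW]
      simp [Matrix.sum_apply, Matrix.mul_apply (M := W _), hM, Finset.sum_apply]
    rw [SetLike.mem_coe, h]
    exact sum_mem fun a _ => sum_mem fun l _ =>
      S'.smul_mem _ (Submodule.subset_span ⟨(a, l), rfl⟩)
  have hne : S ≠ S' := by
    intro h
    rcases hA S (by
      intro a v hv
      have h1 : S ≤ S.comap (A a).mulVecLin := by
        conv_lhs => rw [hS]
        rw [Submodule.span_le]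
        rintro _ ⟨i, rfl⟩
        change A a *ᵥ Y.row i ∈ S
        rw [h, ← hrow]
        exact Submodule.subset_span ⟨(a, i), rfl⟩
      exact h1 hv) with h0 | h0
    · apply hY0
      ext i j
      have : Y.row i ∈ S := Submodule.subset_span ⟨i, rfl⟩
      rw [h0, Submodule.mem_bot] at this
      exact congrFun this j
    · rw [h0, finrank_top, Module.finrank_fintype_fun_eq_card] at hYr
      omega
  rw [← hYr]
  exact Submodule.finrank_lt_finrank_of_lt (lt_of_le_of_ne hle hne)

/-- Every eigenvector of an irreducible pencil at a generic point, reshaped as a matrix, has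
full rank. -/
theorem AlgebraicIndependent.eigenvector_mulVec_injective {A : g → Matrix d d k}
    (hA : ∀ S : Submodule F (d → F), (∀ a, ∀ v ∈ S, (A a).map (algebraMap k F) *ᵥ v ∈ S) →
      S = ⊥ ∨ S = ⊤)
    (hn : Fintype.card d ^ 2 < Fintype.card n)
    {X : g → Matrix n n F} {t : Option (n × d) → F}
    (hx : AlgebraicIndependent k (Sum.elim (tupleEntries X) t)) {c : F} (hc : c ≠ 0)
    {V : Matrix n d F} (hV : ∑ a, X a * V * ((A a).map (algebraMap k F))ᵀ = c • V)
    (hV0 : V ≠ 0) (v : d → F) (hv : V *ᵥ v = 0) : v = 0 := by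
  classical
  by_contra hv0
  have hr : V.rank < Fintype.card d := by
    have h1 := LinearMap.finrank_range_add_finrank_ker V.mulVecLin
    have h2 : 0 < Module.finrank F (LinearMap.ker V.mulVecLin) := by
      rw [Module.finrank_pos_iff_exists_ne_zero]
      exact ⟨⟨v, hv⟩, fun h => hv0 (congrArg Subtype.val h)⟩
    rw [Module.finrank_fintype_fun_eq_card] at h1
    change V.rank + _ = _ at h1
    omega
  obtain ⟨r, U, Y, hVr, hUY, hU⟩ := V.exists_rank_factorization
  have hYrank : Y.rank = r := by
    apply le_antisymm
    · exact Y.rank_le_card_height.trans_eq (Fintype.card_fin r)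
    · refine hVr.symm.trans_le ?_
      conv_lhs => rw [hUY]
      exact Matrix.rank_mul_le_right _ _
  rw [hVr] at hr
  subst hUY
  have hY0 : Y ≠ 0 := by
    rintro rfl
    exact hV0 (Matrix.mul_zero _)
  obtain ⟨C, -, hCU⟩ := IntermediateField.exists_matrix_leftInverse (k := F) ⊤ U
    (fun _ _ => IntermediateField.mem_top) hU
  have hrank := Matrix.lt_rank_stack_of_irreducible hA hr hY0 hYrank
    (W := fun a => c⁻¹ • (C * X a * U)) (by
      have := congrArg (fun M => c⁻¹ • (C * M)) hV
      simp only [Matrix.mul_smul, smul_smul, inv_mul_cancel₀ hc, one_smul] at this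
      rw [← Matrix.mul_assoc C U Y, hCU, Matrix.one_mul] at this
      conv_rhs => rw [← this]
      rw [Matrix.mul_sum, Finset.smul_sum]
      refine Finset.sum_congr rfl fun a _ => ?_
      simp only [Matrix.smul_mul, Matrix.mul_assoc])
  obtain ⟨f, hf, hMf⟩ := Matrix.exists_submatrix_mulVec_injective _ hrank
  have key := hx.card_le_of_eigenvector_factorization hc hV hU hf hMf
  nlinarith

end Generic

section Generic

variable {k F : Type*} [Field k] [Field F] [Algebra k F]

theorem AlgebraicIndependent.exists_adjoin_algHom {ι : Type*} {x y : ι → F}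
    (hx : AlgebraicIndependent k x) (hy : AlgebraicIndependent k y) :
    ∃ φ : IntermediateField.adjoin k (Set.range x) →ₐ[k] F,
      (∀ i, φ ⟨x i, IntermediateField.subset_adjoin _ _ ⟨i, rfl⟩⟩ = y i) ∧
      ∀ z, φ z ∈ IntermediateField.adjoin k (Set.range y) := by
  refine ⟨(IntermediateField.val _).comp
    (hx.aevalEquivField.symm.trans hy.aevalEquivField).toAlgHom, fun i => ?_, fun z => ?_⟩
  · have h : hx.aevalEquivField (algebraMap (MvPolynomial ι k) _ (MvPolynomial.X i)) =
        ⟨x i, IntermediateField.subset_adjoin _ _ ⟨i, rfl⟩⟩ := by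
      apply Subtype.ext
      rw [AlgebraicIndependent.aevalEquivField_algebraMap_apply_coe, aeval_X]
    rw [← h]
    change ((hy.aevalEquivField (hx.aevalEquivField.symm (hx.aevalEquivField _)) : _) : F) = _
    rw [AlgEquiv.symm_apply_apply, AlgebraicIndependent.aevalEquivField_algebraMap_apply_coe,
      aeval_X]
  · exact Subtype.property _

variable {g n d : Type*} [Fintype g] [Fintype n] [Fintype d] [DecidableEq d]

theorem affine_param_recover {A B : g → Matrix d d F} (hB : ∑ a, B a * (A a)ᵀ = 1)
    {X Z : g → Matrix n n F} {c : F} (hc : c ≠ 0) {V D : Matrix n d F} {C : Matrix d n F}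
    (hV : ∑ a, X a * V * (A a)ᵀ = c • V) (hCV : C * V = 1)
    (hZ : ∀ a, Z a = c⁻¹ • X a + D * B a * C) (a : g) :
    Z a - (∑ a, Z a * V * (A a)ᵀ - V) * B a * C = c⁻¹ • X a := by
  have h1 : ∑ a, Z a * V * (A a)ᵀ = V + D := by
    have h2 : ∀ a, Z a * V * (A a)ᵀ = c⁻¹ • (X a * V * (A a)ᵀ) + D * (B a * (A a)ᵀ) := by
      intro a
      rw [hZ, Matrix.add_mul, Matrix.add_mul, Matrix.smul_mul, Matrix.smul_mul,
        Matrix.mul_assoc (D * B a) C V, hCV, Matrix.mul_one, Matrix.mul_assoc D]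
    simp_rw [h2]
    rw [Finset.sum_add_distrib, ← Finset.smul_sum, hV, ← Matrix.mul_sum, hB, smul_smul,
      inv_mul_cancel₀ hc, one_smul, Matrix.mul_one]
  rw [h1, add_sub_cancel_left, hZ, add_sub_cancel_right]

theorem sum_map_mul_transpose_eq_one {A B : g → Matrix d d k} (hB : ∑ a, B a * (A a)ᵀ = 1)
    (R : Type*) [CommRing R] [Algebra k R] :
    ∑ a, (B a).map (algebraMap k R) * ((A a).map (algebraMap k R))ᵀ = 1 := by
  have := congrArg (algebraMap k R).mapMatrix hB
  rw [map_sum, map_one] at this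
  rw [← this]
  refine Finset.sum_congr rfl fun a _ => ?_
  rw [map_mul]
  rfl

theorem AlgebraicIndependent.exists_scaled_eigenvector {A B : g → Matrix d d k}
    (hB : ∑ a, B a * (A a)ᵀ = 1)
    (hA : ∀ S : Submodule F (d → F), (∀ a, ∀ v ∈ S, (A a).map (algebraMap k F) *ᵥ v ∈ S) →
      S = ⊥ ∨ S = ⊤)
    (hn : Fintype.card d ^ 2 < Fintype.card n)
    {X : g → Matrix n n F} {t : Option (n × d) → F}
    (hx : AlgebraicIndependent k (Sum.elim (tupleEntries X) t)) {c : F} (hc : c ≠ 0)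
    {V : Matrix n d F} (hV : ∑ a, X a * V * ((A a).map (algebraMap k F))ᵀ = c • V)
    (hV0 : V ≠ 0) :
    ∃ (s : F) (V' : Matrix n d F) (e : n × d), V' = s • V ∧ V' e.1 e.2 = t none ∧
      ∑ a, X a * V' * ((A a).map (algebraMap k F))ᵀ = c • V' ∧ (∀ v, V' *ᵥ v = 0 → v = 0) ∧
      AlgebraicIndependent k (fun e : n × d => V' e.1 e.2) := by
  classical
  obtain ⟨i, j, hij⟩ : ∃ i j, V i j ≠ 0 := by
    by_contra! h
    exact hV0 (Matrix.ext h)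
  have ht : t none ≠ 0 := hx.ne_zero (Sum.inr none)
  have hs : t none / V i j ≠ 0 := div_ne_zero ht hij
  have hV' : ∑ a, X a * ((t none / V i j) • V) * ((A a).map (algebraMap k F))ᵀ =
      c • ((t none / V i j) • V) := by
    simp_rw [Matrix.mul_smul, Matrix.smul_mul]
    rw [← Finset.smul_sum, hV, smul_comm]
  have he : ((t none / V i j) • V) i j = t none := by
    rw [Matrix.smul_apply, smul_eq_mul, div_mul_cancel₀ _ hij]
  have hinj := fun v => hx.eigenvector_mulVec_injective hA hn hc hV'
    (smul_ne_zero hs hV0) v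
  obtain ⟨C, hC, hCV⟩ := IntermediateField.exists_matrix_leftInverse
    (IntermediateField.adjoin k (Set.range fun e : n × d => ((t none / V i j) • V) e.1 e.2))
    ((t none / V i j) • V)
    (fun i j => IntermediateField.subset_adjoin _ _ ⟨(i, j), rfl⟩) hinj
  refine ⟨t none / V i j, _, (i, j), rfl, he, hV', hinj, ?_⟩
  exact (hx.eigenvector_param hB hc hV' (e := (i, j)) he hC hCV (fun _ => rfl)).comp Sum.inl
    Sum.inl_injective

/-- The eigenspaces of an irreducible pencil at a generic point are lines. -/
theorem AlgebraicIndependent.eigenvector_eq_smul {A B : g → Matrix d d k}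
    (hB : ∑ a, B a * (A a)ᵀ = 1)
    (hA : ∀ S : Submodule F (d → F), (∀ a, ∀ v ∈ S, (A a).map (algebraMap k F) *ᵥ v ∈ S) →
      S = ⊥ ∨ S = ⊤)
    (hn : Fintype.card d ^ 2 < Fintype.card n)
    {X : g → Matrix n n F} {t : Option (n × d) → F}
    (hx : AlgebraicIndependent k (Sum.elim (tupleEntries X) t)) {c : F} (hc : c ≠ 0)
    {V W : Matrix n d F} (hV : ∑ a, X a * V * ((A a).map (algebraMap k F))ᵀ = c • V)
    (hW : ∑ a, X a * W * ((A a).map (algebraMap k F))ᵀ = c • W)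
    (hV0 : V ≠ 0) : ∃ s : F, W = s • V := by
  obtain ⟨i, j, hij⟩ : ∃ i j, V i j ≠ 0 := by
    by_contra! h
    exact hV0 (Matrix.ext h)
  refine ⟨W i j / V i j, ?_⟩
  by_contra hne
  obtain ⟨s, V', e, rfl, -, -, -, hind⟩ := hx.exists_scaled_eigenvector hB hA hn hc
    (V := W - (W i j / V i j) • V) (by
      simp_rw [Matrix.mul_sub, Matrix.mul_smul, Matrix.sub_mul, Matrix.smul_mul]
      rw [Finset.sum_sub_distrib, ← Finset.smul_sum, hV, hW, smul_sub, smul_comm c])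
    (sub_ne_zero.2 hne)
  have h := hind.ne_zero (i, j)
  apply h
  simp [div_mul_cancel₀ _ hij]

theorem affine_param_recover_map {R : Type*} [CommRing R] [Algebra k R] (σ : R →ₐ[k] F)
    {A B : g → Matrix d d k} (hB : ∑ a, B a * (A a)ᵀ = 1)
    {X Z : g → Matrix n n F} {c : F} (hc : c ≠ 0) {V D : Matrix n d F} {C : Matrix d n F}
    (hV : ∑ a, X a * V * ((A a).map (algebraMap k F))ᵀ = c • V) (hCV : C * V = 1)
    (hZ : ∀ a, Z a = c⁻¹ • X a + D * (B a).map (algebraMap k F) * C)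
    {Z' : g → Matrix n n R} {V' : Matrix n d R} {C' : Matrix d n R}
    (hZ' : ∀ a, (Z' a).map σ = Z a) (hV' : V'.map σ = V) (hC' : C'.map σ = C)
    (q : MvPolynomial (g × n × n) k) :
    aeval (tupleEntries fun a => c⁻¹ • X a) q = σ (aeval (fun v : g × n × n =>
      (Z' v.1 - (∑ a, Z' a * V' * ((A a).map (algebraMap k R))ᵀ - V') *
        (B v.1).map (algebraMap k R) * C') v.2.1 v.2.2) q) := by
  have hk : ∀ M : Matrix d d k, (M.map (algebraMap k R)).map σ = M.map (algebraMap k F) := by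
    intro M
    ext i j
    simp
  rw [MvPolynomial.comp_aeval_apply]
  congr 2
  ext ⟨a, i, j⟩
  have hsum : (∑ a, Z' a * V' * ((A a).map (algebraMap k R))ᵀ).map σ =
      ∑ a, Z a * V * ((A a).map (algebraMap k F))ᵀ := by
    ext i j
    rw [Matrix.map_apply, Matrix.sum_apply, map_sum, Matrix.sum_apply]
    refine Finset.sum_congr rfl fun a _ => ?_
    rw [← Matrix.map_apply (f := σ), Matrix.map_mul, Matrix.map_mul, hZ', hV', ← hk]
    rfl
  change _ = ((Z' a - (∑ a, Z' a * V' * ((A a).map (algebraMap k R))ᵀ - V') *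
        (B a).map (algebraMap k R) * C').map σ) i j
  rw [Matrix.map_sub _ (map_sub σ), Matrix.map_mul, Matrix.map_mul, Matrix.map_sub _ (map_sub σ),
    hsum, hZ', hV', hC', hk, affine_param_recover (sum_map_mul_transpose_eq_one hB F) hc hV hCV hZ]
  rfl

/-- All eigenpairs of an irreducible pencil at a generic point are conjugate. -/
theorem AlgebraicIndependent.aeval_eigenvalue_conj {A B : g → Matrix d d k}
    (hB : ∑ a, B a * (A a)ᵀ = 1)
    (hA : ∀ S : Submodule F (d → F), (∀ a, ∀ v ∈ S, (A a).map (algebraMap k F) *ᵥ v ∈ S) →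
      S = ⊥ ∨ S = ⊤)
    (hn : Fintype.card d ^ 2 < Fintype.card n)
    {X : g → Matrix n n F} {t : Option (n × d) → F}
    (hx : AlgebraicIndependent k (Sum.elim (tupleEntries X) t)) {c₁ c₂ : F} (hc₁ : c₁ ≠ 0)
    (hc₂ : c₂ ≠ 0) {V₁ V₂ : Matrix n d F}
    (hV₁ : ∑ a, X a * V₁ * ((A a).map (algebraMap k F))ᵀ = c₁ • V₁)
    (hV₂ : ∑ a, X a * V₂ * ((A a).map (algebraMap k F))ᵀ = c₂ • V₂)
    (hV₁0 : V₁ ≠ 0) (hV₂0 : V₂ ≠ 0) {q : MvPolynomial (g × n × n) k}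
    (hq : aeval (tupleEntries fun a => c₁⁻¹ • X a) q = 0) :
    aeval (tupleEntries fun a => c₂⁻¹ • X a) q = 0 := by
  classical
  obtain ⟨-, V, e₁, -, he₁, hV, hVinj, hVind⟩ :=
    hx.exists_scaled_eigenvector hB hA hn hc₁ hV₁ hV₁0
  obtain ⟨-, W, e₂, -, he₂, hW, hWinj, hWind⟩ :=
    hx.exists_scaled_eigenvector hB hA hn hc₂ hV₂ hV₂0
  obtain ⟨φV, hφV, hφVmem⟩ := hVind.exists_adjoin_algHom hWind
  obtain ⟨C, hC, hCV⟩ := IntermediateField.exists_matrix_leftInverse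
    (IntermediateField.adjoin k (Set.range fun e : n × d => V e.1 e.2)) V
    (fun i j => IntermediateField.subset_adjoin _ _ ⟨(i, j), rfl⟩) hVinj
  obtain ⟨C', hC'⟩ : ∃ C' : Matrix d n F, ∀ i j, C' i j = φV ⟨C i j, hC i j⟩ :=
    ⟨Matrix.of fun i j => φV ⟨C i j, hC i j⟩, fun _ _ => rfl⟩
  have hC'mem : ∀ i j, C' i j ∈ IntermediateField.adjoin k
      (Set.range fun e : n × d => W e.1 e.2) := fun i j => hC' i j ▸ hφVmem _
  have hC'W : C' * W = 1 := by
    have h1 : (Matrix.of fun i j => ⟨C i j, hC i j⟩ : Matrix d n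
        (IntermediateField.adjoin k (Set.range fun e : n × d => V e.1 e.2))) *
        (Matrix.of fun i j => ⟨V i j, IntermediateField.subset_adjoin _ _ ⟨(i, j), rfl⟩⟩ :
          Matrix n d (IntermediateField.adjoin k (Set.range fun e : n × d => V e.1 e.2))) = 1 := by
      apply Matrix.map_injective (f := IntermediateField.val _) Subtype.val_injective
      beta_reduce
      rw [Matrix.map_mul, Matrix.map_one _ (map_zero _) (map_one _), ← hCV]
      rfl
    have h2 := congrArg (fun M => M.map φV) h1
    simp only [Matrix.map_mul, Matrix.map_one _ (map_zero φV) (map_one φV)] at h2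
    rw [← h2]
    congr 1
    · ext i j
      exact hC' i j
    · ext i j
      exact (hφV (i, j)).symm
  obtain ⟨Z, hZ⟩ : ∃ Z : g → Matrix n n F, ∀ a, Z a = c₁⁻¹ • X a +
    (Matrix.of fun i j => t (some (i, j))) * (B a).map (algebraMap k F) * C := ⟨_, fun _ => rfl⟩
  obtain ⟨Z', hZ'⟩ : ∃ Z' : g → Matrix n n F, ∀ a, Z' a = c₂⁻¹ • X a +
    (Matrix.of fun i j => t (some (i, j))) * (B a).map (algebraMap k F) * C' := ⟨_, fun _ => rfl⟩
  have hy₁ := hx.eigenvector_param hB hc₁ hV he₁ hC hCV hZ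
  have hy₂ := hx.eigenvector_param hB hc₂ hW he₂ hC'mem hC'W hZ'
  obtain ⟨φ, hφ, -⟩ := hy₁.exists_adjoin_algHom hy₂
  have hle : IntermediateField.adjoin k (Set.range fun e : n × d => V e.1 e.2) ≤
      IntermediateField.adjoin k (Set.range
        (Sum.elim (fun e : n × d => V e.1 e.2) (tupleEntries Z))) := by
    apply IntermediateField.adjoin.mono
    rintro _ ⟨e, rfl⟩
    exact ⟨Sum.inl e, rfl⟩
  have hφC : φ.comp (IntermediateField.inclusion hle) = φV := by
    apply IntermediateField.adjoin_algHom_ext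
    rintro _ ⟨e, rfl⟩
    exact (hφ (Sum.inl e)).trans (hφV e).symm
  obtain ⟨Zl, hZl, hZl'⟩ : ∃ Zl : g → Matrix n n (IntermediateField.adjoin k (Set.range
      (Sum.elim (fun e : n × d => V e.1 e.2) (tupleEntries Z)))),
      (∀ a, (Zl a).map (IntermediateField.val _) = Z a) ∧ ∀ a, (Zl a).map φ = Z' a :=
    ⟨fun a => Matrix.of fun i j => ⟨Z a i j, IntermediateField.subset_adjoin _ _
      ⟨Sum.inr (a, i, j), rfl⟩⟩, fun a => rfl, fun a => by
      ext i j
      exact hφ (Sum.inr (a, i, j))⟩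
  obtain ⟨Vl, hVl, hVl'⟩ : ∃ Vl : Matrix n d (IntermediateField.adjoin k (Set.range
      (Sum.elim (fun e : n × d => V e.1 e.2) (tupleEntries Z)))),
      Vl.map (IntermediateField.val _) = V ∧ Vl.map φ = W :=
    ⟨Matrix.of fun i j => ⟨V i j, IntermediateField.subset_adjoin _ _
      ⟨Sum.inl (i, j), rfl⟩⟩, rfl, by
      ext i j
      exact hφ (Sum.inl (i, j))⟩
  obtain ⟨Cl, hCl, hCl'⟩ : ∃ Cl : Matrix d n (IntermediateField.adjoin k (Set.range
      (Sum.elim (fun e : n × d => V e.1 e.2) (tupleEntries Z)))),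
      Cl.map (IntermediateField.val _) = C ∧ Cl.map φ = C' :=
    ⟨Matrix.of fun i j => IntermediateField.inclusion hle ⟨C i j, hC i j⟩, rfl, by
      ext i j
      exact (DFunLike.congr_fun hφC ⟨C i j, hC i j⟩).trans (hC' i j).symm⟩
  have h1 := affine_param_recover_map (IntermediateField.val _) hB hc₁ hV hCV hZ hZl hVl hCl q
  have h2 := affine_param_recover_map φ hB hc₂ hW hC'W hZ' hZl' hVl' hCl' q
  rw [h1, map_eq_zero] at hq
  rw [h2, hq, map_zero]

end Generic

section Transfer

variable {k R : Type*} [CommRing k] [CommRing R] [Algebra k R]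
  {g n d : Type*} [Fintype g]

/-- The linear part `∑ j, A j ⊗ X j` of the pencil. -/
def pencilPart (A : g → Matrix d d k) (X : g → Matrix n n R) : Matrix (d × n) (d × n) R :=
  ∑ j, Matrix.kroneckerMap (· * ·) ((A j).map (algebraMap k R)) (X j)

theorem pencilPart_map {S : Type*} [CommRing S] [Algebra k S] (A : g → Matrix d d k)
    (X : g → Matrix n n R) (σ : R →ₐ[k] S) :
    (pencilPart A X).map σ = pencilPart A fun a => (X a).map σ := by
  ext p q
  simp [pencilPart, Matrix.sum_apply]

variable [Fintype n] [Fintype d]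

theorem pencilPart_mulVec_vec (A : g → Matrix d d k) (X : g → Matrix n n R) (V : Matrix n d R) :
    pencilPart A X *ᵥ vec V = vec (∑ a, X a * V * ((A a).map (algebraMap k R))ᵀ) := by
  rw [pencilPart, Matrix.sum_mulVec]
  ext p
  simp only [Finset.sum_apply, Matrix.vec, Matrix.sum_apply]
  refine Finset.sum_congr rfl fun a _ => ?_
  have := Matrix.kronecker_mulVec_vec (X a) V ((A a).map (algebraMap k R))
  exact congrFun this p

theorem aeval_tupleEntries_smul_monomial (X : g → Matrix n n R)
    (c : R) (m : g × n × n →₀ ℕ) (a : k) :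
    aeval (tupleEntries fun j => c • X j) (monomial m a) =
      c ^ m.degree * aeval (tupleEntries X) (monomial m a) := by
  rw [aeval_monomial, aeval_monomial]
  have : m.prod (fun i e => tupleEntries (fun j => c • X j) i ^ e) =
      c ^ m.degree * m.prod (fun i e => tupleEntries X i ^ e) := by
    rw [Finsupp.prod, Finsupp.prod, Finsupp.degree_apply, ← Finset.prod_pow_eq_pow_sum,
      ← Finset.prod_mul_distrib]
    refine Finset.prod_congr rfl fun i _ => ?_
    rw [← mul_pow]
    rfl
  rw [this]
  ring

end Transfer

section TransferField

variable {k : Type*} [Field k] {g n d : Type*} [Fintype g] [Fintype n] [Fintype d]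
  [DecidableEq n] [DecidableEq d]

/-- The polynomial matrix `∑ m, q_m X ^ m • T(X) ^ (D + 1 - |m|)` attached to `q = ∑ m, q_m X ^ m`,
where `T` is the linear part of a pencil and `D` is the degree of `q`. -/
def homogenizedMatrix {R : Type*} [CommRing R] [Algebra k R] (A : g → Matrix d d k)
    (q : MvPolynomial (g × n × n) k) (X : g → Matrix n n R) : Matrix (d × n) (d × n) R :=
  ∑ m ∈ q.support, aeval (tupleEntries X) (monomial m (coeff m q)) •
    pencilPart A X ^ (q.totalDegree + 1 - m.degree)

theorem homogenizedMatrix_map {R S : Type*} [CommRing R] [Algebra k R] [CommRing S] [Algebra k S]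
    (A : g → Matrix d d k) (q : MvPolynomial (g × n × n) k) (X : g → Matrix n n R)
    (σ : R →ₐ[k] S) :
    (homogenizedMatrix A q X).map σ = homogenizedMatrix A q fun a => (X a).map σ := by
  change σ.toRingHom.mapMatrix _ = _
  rw [homogenizedMatrix, homogenizedMatrix, map_sum]
  refine Finset.sum_congr rfl fun m _ => ?_
  rw [← pencilPart_map]
  change _ = _ • (σ.toRingHom.mapMatrix (pencilPart A X)) ^ _
  rw [← map_pow]
  ext i j
  simp only [RingHom.mapMatrix_apply, Matrix.map_apply, Matrix.smul_apply, smul_eq_mul, map_mul]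
  congr 1
  exact MvPolynomial.comp_aeval_apply σ (f := tupleEntries X) _

theorem pow_mulVec_of_eigenvector {R ι : Type*} [CommRing R] [Fintype ι] [DecidableEq ι]
    {M : Matrix ι ι R} {v : ι → R} {c : R} (h : M *ᵥ v = c • v) (r : ℕ) :
    M ^ r *ᵥ v = c ^ r • v := by
  induction r with
  | zero => simp
  | succ r ih => rw [pow_succ, ← Matrix.mulVec_mulVec, h, Matrix.mulVec_smul, ih, smul_smul, pow_succ']

theorem homogenizedMatrix_mulVec_zero {R : Type*} [CommRing R] [Algebra k R]
    (A : g → Matrix d d k) (q : MvPolynomial (g × n × n) k) (X : g → Matrix n n R)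
    {v : d × n → R} (hv : pencilPart A X *ᵥ v = 0) : homogenizedMatrix A q X *ᵥ v = 0 := by
  rw [homogenizedMatrix, Matrix.sum_mulVec]
  refine Finset.sum_eq_zero fun m hm => ?_
  have h1 : m.degree ≤ q.totalDegree := MvPolynomial.le_totalDegree hm
  rw [Matrix.smul_mulVec, pow_mulVec_of_eigenvector (c := 0) (by rw [hv, zero_smul]),
    zero_pow (by omega), zero_smul, smul_zero]

theorem homogenizedMatrix_mulVec {R : Type*} [Field R] [Algebra k R]
    (A : g → Matrix d d k) (q : MvPolynomial (g × n × n) k) (X : g → Matrix n n R)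
    {v : d × n → R} {c : R} (hc : c ≠ 0) (hv : pencilPart A X *ᵥ v = c • v) :
    homogenizedMatrix A q X *ᵥ v =
      (c ^ (q.totalDegree + 1) * aeval (tupleEntries fun a => c⁻¹ • X a) q) • v := by
  rw [homogenizedMatrix, Matrix.sum_mulVec]
  have hsum : aeval (tupleEntries fun a => c⁻¹ • X a) q = ∑ m ∈ q.support,
      aeval (tupleEntries fun a => c⁻¹ • X a) (monomial m (coeff m q)) := by
    conv_lhs => rw [q.as_sum, map_sum]
  rw [hsum, Finset.mul_sum, Finset.sum_smul]
  refine Finset.sum_congr rfl fun m hm => ?_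
  have h1 : m.degree ≤ q.totalDegree := MvPolynomial.le_totalDegree hm
  rw [Matrix.smul_mulVec, pow_mulVec_of_eigenvector hv, smul_smul,
    aeval_tupleEntries_smul_monomial, ← mul_assoc, inv_pow, ← pow_sub₀ _ hc (by omega),
    mul_comm]

theorem Matrix.IsHermitian.eq_zero_of_eigenvectors {ι : Type*} [Fintype ι] [DecidableEq ι]
    {T M : Matrix ι ι ℂ} (hT : T.IsHermitian)
    (h : ∀ (c : ℂ) (v : ι → ℂ), T *ᵥ v = c • v → M *ᵥ v = 0) : M = 0 := by
  have h1 : M * (hT.eigenvectorUnitary : Matrix ι ι ℂ) = 0 := by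
    ext i j
    have h2 := h (hT.eigenvalues j) _ (hT.mulVec_eigenvectorBasis j)
    have h3 := congrFun h2 i
    rw [Matrix.zero_apply, ← Pi.zero_apply (M := fun _ => ℂ) i, ← h3, Matrix.mul_apply]
    rfl
  have h2 := congrArg (· * star (hT.eigenvectorUnitary : Matrix ι ι ℂ)) h1
  simpa [Matrix.mul_assoc] using h2

/-- A polynomial vanishing on all the normalisations `μ⁻¹ X` of one generic hermitian tuple by its
nonzero eigenvalues vanishes on the whole free locus. -/
theorem AlgebraicIndependent.aeval_eq_zero_of_eigenvalues [Algebra k ℂ] {A : g → Matrix d d k}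
    {X : g → Matrix n n ℂ} (hx : AlgebraicIndependent k (tupleEntries X))
    (hherm : (pencilPart A X).IsHermitian) {q : MvPolynomial (g × n × n) k}
    (hq : ∀ (c : ℂ) (v : d × n → ℂ), c ≠ 0 → v ≠ 0 → pencilPart A X *ᵥ v = c • v →
      aeval (tupleEntries fun a => c⁻¹ • X a) q = 0)
    {Y : g → Matrix n n ℂ} {w : d × n → ℂ} (hw : w ≠ 0) (hY : pencilPart A Y *ᵥ w = w) :
    aeval (tupleEntries Y) q = 0 := by
  have h0 : homogenizedMatrix A q X = 0 := by
    refine hherm.eq_zero_of_eigenvectors fun c v hv => ?_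
    rcases eq_or_ne c 0 with rfl | hc
    · exact homogenizedMatrix_mulVec_zero A q X (by rw [hv, zero_smul])
    · rcases eq_or_ne v 0 with rfl | hv0
      · exact Matrix.mulVec_zero _
      · rw [homogenizedMatrix_mulVec A q X hc hv, hq c v hc hv0 hv, mul_zero, zero_smul]
  obtain ⟨G, hG⟩ : ∃ G : g → Matrix n n (MvPolynomial (g × n × n) k),
      ∀ a i j, G a i j = MvPolynomial.X (a, i, j) :=
    ⟨fun a => Matrix.of fun i j => MvPolynomial.X (a, i, j), fun _ _ _ => rfl⟩
  have hGmap : ∀ Z : g → Matrix n n ℂ, ∀ a, (G a).map (aeval (tupleEntries Z)) = Z a := by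
    intro Z a
    ext i j
    rw [Matrix.map_apply, hG, aeval_X]
    rfl
  have h1 : homogenizedMatrix A q G = 0 := by
    apply Matrix.map_injective hx
    beta_reduce
    rw [homogenizedMatrix_map]
    simp_rw [hGmap]
    rw [h0, Matrix.map_zero _ (map_zero _)]
  have h2 : homogenizedMatrix A q Y = 0 := by
    have := homogenizedMatrix_map A q G (aeval (tupleEntries Y))
    simp_rw [hGmap] at this
    rw [← this, h1, Matrix.map_zero _ (map_zero _)]
  have h3 := homogenizedMatrix_mulVec A q Y (v := w) one_ne_zero (by rw [hY, one_smul])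
  rw [h2, Matrix.zero_mulVec, one_pow, one_mul, inv_one] at h3
  simp_rw [one_smul] at h3
  exact (smul_eq_zero.1 h3.symm).resolve_right hw

end TransferField

section Form

variable {g n d : Type*} [Fintype g] [Fintype n] [Fintype d]

/-- The action `V ↦ ∑ a, X a * V * (A a)ᵀ` of the linear part of a pencil on reshaped vectors. -/
def pencilAct (A : g → Matrix d d ℂ) (X : g → Matrix n n ℂ) (V : Matrix n d ℂ) : Matrix n d ℂ :=
  ∑ a, X a * V * (A a)ᵀ

/-- The hermitian form of a monic pencil on reshaped vectors. -/
def pencilForm (A : g → Matrix d d ℂ) (X : g → Matrix n n ℂ) (V : Matrix n d ℂ) : ℝ :=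
  (trace (Vᴴ * (V - pencilAct A X V))).re

theorem pencilPart_mulVec_vec_eq (A : g → Matrix d d ℂ) (X : g → Matrix n n ℂ)
    (V : Matrix n d ℂ) : pencilPart A X *ᵥ vec V = vec (pencilAct A X V) := by
  rw [pencilPart_mulVec_vec]
  simp [pencilAct]

theorem pencilPart_isHermitian {A : g → Matrix d d ℂ} {X : g → Matrix n n ℂ}
    (hA : ∀ a, (A a).IsHermitian) (hX : ∀ a, (X a).IsHermitian) :
    (pencilPart A X).IsHermitian := by
  rw [pencilPart]
  rw [Matrix.IsHermitian, Matrix.conjTranspose_sum]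
  refine Finset.sum_congr rfl fun a _ => ?_
  have := Matrix.conjTranspose_kronecker ((A a).map (algebraMap ℂ ℂ)) (X a)
  refine this.trans ?_
  rw [(hX a).eq]
  simp [(hA a).eq]

theorem pencilAct_smul (A : g → Matrix d d ℂ) (X : g → Matrix n n ℂ) (c : ℂ) (V : Matrix n d ℂ) :
    pencilAct A (fun a => c • X a) V = c • pencilAct A X V := by
  rw [pencilAct, pencilAct, Finset.smul_sum]
  simp_rw [Matrix.smul_mul]

theorem pencilAct_mulVec_smul (A : g → Matrix d d ℂ) (X : g → Matrix n n ℂ) (c : ℂ)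
    (V : Matrix n d ℂ) : pencilAct A X (c • V) = c • pencilAct A X V := by
  rw [pencilAct, pencilAct, Finset.smul_sum]
  simp_rw [Matrix.mul_smul, Matrix.smul_mul]

theorem pencilForm_smul (A : g → Matrix d d ℂ) (X : g → Matrix n n ℂ) (c : ℝ) (V : Matrix n d ℂ) :
    pencilForm A (fun a => (c : ℂ) • X a) V =
      c * pencilForm A X V + (1 - c) * (trace (Vᴴ * V)).re := by
  rw [pencilForm, pencilForm, pencilAct_smul, Matrix.mul_sub, Matrix.mul_sub, Matrix.mul_smul,
    trace_sub, trace_sub, trace_smul]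
  simp
  ring

theorem re_trace_conjTranspose_mul_self (V : Matrix n d ℂ) :
    (trace (Vᴴ * V)).re = ∑ i, ∑ j, ‖V i j‖ ^ 2 := by
  simp only [trace, Matrix.diag, Matrix.mul_apply, conjTranspose_apply, Complex.re_sum]
  rw [Finset.sum_comm]
  refine Finset.sum_congr rfl fun i _ => Finset.sum_congr rfl fun j _ => ?_
  rw [Complex.star_def, Complex.conj_mul']
  norm_cast

theorem re_trace_conjTranspose_mul_self_nonneg (V : Matrix n d ℂ) :
    0 ≤ (trace (Vᴴ * V)).re := by
  rw [re_trace_conjTranspose_mul_self]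
  positivity

theorem re_trace_conjTranspose_mul_self_pos {V : Matrix n d ℂ} (hV : V ≠ 0) :
    0 < (trace (Vᴴ * V)).re := by
  refine lt_of_le_of_ne (re_trace_conjTranspose_mul_self_nonneg V) fun h => hV ?_
  rw [re_trace_conjTranspose_mul_self] at h
  ext i j
  have h1 := (Finset.sum_eq_zero_iff_of_nonneg (fun i _ => by positivity)).1 h.symm i
    (Finset.mem_univ i)
  have h2 := (Finset.sum_eq_zero_iff_of_nonneg (fun i _ => by positivity)).1 h1 j
    (Finset.mem_univ j)
  simpa using h2

variable [DecidableEq n] [DecidableEq d]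

theorem one_sub_pencilPart_posSemidef_iff {A : g → Matrix d d ℂ} {X : g → Matrix n n ℂ}
    (hA : ∀ a, (A a).IsHermitian) (hX : ∀ a, (X a).IsHermitian) :
    (1 - pencilPart A X).PosSemidef ↔ ∀ V, 0 ≤ pencilForm A X V := by
  have hH : (1 - pencilPart A X).IsHermitian :=
    Matrix.isHermitian_one.sub (pencilPart_isHermitian hA hX)
  have key : ∀ V, star (vec V) ⬝ᵥ ((1 - pencilPart A X) *ᵥ vec V) =
      trace (Vᴴ * (V - pencilAct A X V)) := by
    intro V
    rw [Matrix.sub_mulVec, Matrix.one_mulVec, pencilPart_mulVec_vec_eq, ← vec_sub,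
      star_vec_dotProduct_vec]
  rw [Matrix.posSemidef_iff_dotProduct_mulVec]
  constructor
  · rintro ⟨-, h⟩ V
    have := h (vec V)
    rw [key] at this
    exact (Complex.le_def.1 this).1
  · refine fun h => ⟨hH, fun x => ?_⟩
    obtain ⟨V, rfl⟩ := vec_bijective.2 x
    rw [Complex.le_def]
    refine ⟨?_, ?_⟩
    · rw [key]
      exact h V
    · exact (hH.im_star_dotProduct_mulVec_self (vec V)).symm

end Form

section Isometry

theorem Submodule.exists_isometry_decomposition {e : Type*} [Fintype e] [DecidableEq e]
    (S : Submodule ℂ (e → ℂ)) :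
    ∃ (s t : ℕ) (U : Matrix e (Fin s) ℂ) (W : Matrix e (Fin t) ℂ),
      Uᴴ * U = 1 ∧ Wᴴ * W = 1 ∧ Uᴴ * W = 0 ∧ U * Uᴴ + W * Wᴴ = 1 ∧
      LinearMap.range U.mulVecLin = S ∧ s + t = Fintype.card e := by
  obtain ⟨S', hS'⟩ : ∃ S' : Submodule ℂ (EuclideanSpace ℂ e),
      ∀ v, v ∈ S' ↔ WithLp.ofLp v ∈ S :=
    ⟨S.comap (WithLp.linearEquiv 2 ℂ (e → ℂ)).toLinearMap, fun v => Iff.rfl⟩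
  have hin : ∀ v w : EuclideanSpace ℂ e, inner ℂ v w = star (WithLp.ofLp v) ⬝ᵥ WithLp.ofLp w := by
    intro v w
    rw [EuclideanSpace.inner_eq_star_dotProduct, dotProduct_comm]
  obtain ⟨b⟩ : Nonempty (OrthonormalBasis (Fin (Module.finrank ℂ S')) ℂ S') :=
    ⟨stdOrthonormalBasis ℂ S'⟩
  obtain ⟨b', hb'⟩ : ∃ b' : OrthonormalBasis (Fin (Module.finrank ℂ S'ᗮ)) ℂ S'ᗮ, True :=
    ⟨stdOrthonormalBasis ℂ S'ᗮ, trivial⟩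
  have hst : Module.finrank ℂ S' + Module.finrank ℂ S'ᗮ = Fintype.card e := by
    rw [Submodule.finrank_add_finrank_orthogonal, finrank_euclideanSpace]
  obtain ⟨U, hU⟩ : ∃ U : Matrix e (Fin (Module.finrank ℂ S')) ℂ,
      ∀ i j, U i j = WithLp.ofLp (b j : EuclideanSpace ℂ e) i := ⟨fun i j => _, fun _ _ => rfl⟩
  obtain ⟨W, hW⟩ : ∃ W : Matrix e (Fin (Module.finrank ℂ S'ᗮ)) ℂ,
      ∀ i j, W i j = WithLp.ofLp (b' j : EuclideanSpace ℂ e) i := ⟨fun i j => _, fun _ _ => rfl⟩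
  have hUU : Uᴴ * U = 1 := by
    ext i j
    rw [Matrix.one_apply, ← orthonormal_iff_ite.1 b.orthonormal i j, Submodule.coe_inner, hin]
    simp [Matrix.mul_apply, dotProduct, hU]
  have hWW : Wᴴ * W = 1 := by
    ext i j
    rw [Matrix.one_apply, ← orthonormal_iff_ite.1 b'.orthonormal i j, Submodule.coe_inner, hin]
    simp [Matrix.mul_apply, dotProduct, hW]
  have hUW : Uᴴ * W = 0 := by
    ext i j
    have := Submodule.inner_right_of_mem_orthogonal (b i).2 (b' j).2
    rw [hin] at this
    rw [Matrix.zero_apply, ← this]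
    simp [Matrix.mul_apply, dotProduct, hU, hW]
  have hWU : Wᴴ * U = 0 := by
    rw [← conjTranspose_eq_zero, conjTranspose_mul, conjTranspose_conjTranspose, hUW]
  have hsum : U * Uᴴ + W * Wᴴ = 1 := by
    rw [← fromCols_mul_fromRows,
      fromCols_mul_fromRows_eq_one_comm (Fintype.equivOfCardEq (by simpa using hst.symm)),
      fromRows_mul_fromCols, hUU, hWW, hUW, hWU, fromBlocks_one]
  refine ⟨_, _, U, W, hUU, hWW, hUW, hsum, ?_, hst⟩
  have hWv : ∀ v ∈ S, Wᴴ *ᵥ v = 0 := by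
    intro v hv
    ext j
    have := Submodule.inner_left_of_mem_orthogonal ((hS' (WithLp.toLp 2 v)).2 hv) (b' j).2
    rw [hin] at this
    rw [Pi.zero_apply, ← this]
    simp [mulVec, dotProduct, hW]
  refine le_antisymm ?_ fun v hv => ?_
  · rintro _ ⟨c, rfl⟩
    rw [mulVecLin_apply, mulVec_eq_sum]
    refine S.sum_mem fun j _ => ?_
    have : Uᵀ j = WithLp.ofLp (b j : EuclideanSpace ℂ e) := by
      ext i
      exact hU i j
    have h2 := (hS' _).1 (b j).2
    rw [← this] at h2
    simpa using S.smul_mem (c j) h2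
  · refine ⟨Uᴴ *ᵥ v, ?_⟩
    have : (U * Uᴴ + W * Wᴴ) *ᵥ v = v := by rw [hsum, one_mulVec]
    rwa [add_mulVec, ← mulVec_mulVec, ← mulVec_mulVec, hWv v hv, mulVec_zero, add_zero] at this

theorem Matrix.IsHermitian.exists_reducing_decomposition {g e : Type*} [Fintype e] [DecidableEq e]
    {A : g → Matrix e e ℂ} (hA : ∀ a, (A a).IsHermitian) (S : Submodule ℂ (e → ℂ))
    (hS : ∀ a, ∀ v ∈ S, A a *ᵥ v ∈ S) :
    ∃ (s t : ℕ) (U : Matrix e (Fin s) ℂ) (W : Matrix e (Fin t) ℂ)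
      (B : g → Matrix (Fin s) (Fin s) ℂ) (C : g → Matrix (Fin t) (Fin t) ℂ),
      Uᴴ * U = 1 ∧ Wᴴ * W = 1 ∧ U * Uᴴ + W * Wᴴ = 1 ∧
      LinearMap.range U.mulVecLin = S ∧ s + t = Fintype.card e ∧
      (∀ a, (B a).IsHermitian) ∧ (∀ a, (C a).IsHermitian) ∧
      (∀ a, A a * U = U * B a) ∧ (∀ a, A a * W = W * C a) := by
  obtain ⟨s, t, U, W, hU, hW, hUW, hsum, hr, hst⟩ := S.exists_isometry_decomposition
  have hWU : Wᴴ * U = 0 := by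
    rw [← conjTranspose_eq_zero, conjTranspose_mul, conjTranspose_conjTranspose, hUW]
  have hfix : ∀ v ∈ S, U *ᵥ (Uᴴ *ᵥ v) = v := by
    rw [← hr]
    rintro _ ⟨c, rfl⟩
    rw [mulVecLin_apply, mulVec_mulVec, mulVec_mulVec, Matrix.mul_assoc, hU, Matrix.mul_one]
  have hAU : ∀ a, A a * U = U * (Uᴴ * A a * U) := by
    intro a
    refine Matrix.ext_of_mulVec_single fun j => ?_
    have h1 : U *ᵥ Pi.single j 1 ∈ S := by
      rw [← hr]
      exact ⟨_, rfl⟩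
    have h2 := hfix _ (hS a _ h1)
    simp only [← mulVec_mulVec]
    exact h2.symm
  have hUAW : ∀ a, Uᴴ * (A a * W) = 0 := by
    intro a
    have : Wᴴ * (A a * U) = 0 := by
      rw [hAU, ← Matrix.mul_assoc, hWU, Matrix.zero_mul]
    rw [← conjTranspose_eq_zero, conjTranspose_mul, conjTranspose_mul, conjTranspose_conjTranspose,
      (hA a).eq, Matrix.mul_assoc, this]
  refine ⟨s, t, U, W, fun a => Uᴴ * A a * U, fun a => Wᴴ * A a * W, hU, hW, hsum, hr, hst,
    fun a => isHermitian_conjTranspose_mul_mul U (hA a),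
    fun a => isHermitian_conjTranspose_mul_mul W (hA a), hAU, fun a => ?_⟩
  have : (U * Uᴴ + W * Wᴴ) * (A a * W) = A a * W := by rw [hsum, Matrix.one_mul]
  rw [Matrix.add_mul, Matrix.mul_assoc, hUAW, Matrix.mul_zero, zero_add] at this
  simpa only [Matrix.mul_assoc] using this.symm

end Isometry

section Intertwine

variable {g n d e : Type*} [Fintype g] [Fintype n] [Fintype d] [Fintype e]

theorem pencilAct_mul {A : g → Matrix d d ℂ} {B : g → Matrix e e ℂ} {W : Matrix d e ℂ}
    (hW : ∀ a, W * (B a)ᵀ = (A a)ᵀ * W) (X : g → Matrix n n ℂ) (V : Matrix n d ℂ) :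
    pencilAct B X (V * W) = pencilAct A X V * W := by
  rw [pencilAct, pencilAct, Matrix.sum_mul]
  refine Finset.sum_congr rfl fun a _ => ?_
  simp only [Matrix.mul_assoc, hW]

theorem pencilForm_mul {A : g → Matrix d d ℂ} {B : g → Matrix e e ℂ} {W : Matrix d e ℂ}
    (hW : ∀ a, W * (B a)ᵀ = (A a)ᵀ * W) (X : g → Matrix n n ℂ) (V : Matrix n d ℂ) :
    pencilForm B X (V * W) = (trace (Vᴴ * (V - pencilAct A X V) * (W * Wᴴ))).re := by
  rw [pencilForm, pencilAct_mul hW, ← Matrix.sub_mul, conjTranspose_mul, Matrix.mul_assoc,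
    trace_mul_comm]
  simp only [Matrix.mul_assoc]

theorem intertwine_transpose {A : Matrix d d ℂ} {B : Matrix e e ℂ} {U : Matrix d e ℂ}
    (h : A * U = U * B) : Uᵀ * Aᵀ = Bᵀ * Uᵀ := by
  rw [← transpose_mul, h, transpose_mul]

theorem intertwine_conjTranspose_transpose {A : Matrix d d ℂ} {B : Matrix e e ℂ}
    {U : Matrix d e ℂ} (hA : A.IsHermitian) (hB : B.IsHermitian) (h : A * U = U * B) :
    Uᴴᵀ * Bᵀ = Aᵀ * Uᴴᵀ := by
  have := congrArg conjTranspose h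
  rw [conjTranspose_mul, conjTranspose_mul, hA.eq, hB.eq] at this
  rw [← transpose_mul, ← transpose_mul, this]

end Intertwine

section Irreducible

variable {g n d e : Type*} [Fintype g] [Fintype n] [Fintype d] [Fintype e]

theorem exists_irreducible_summand [DecidableEq d]
    {A : g → Matrix d d ℂ} (hA : ∀ a, (A a).IsHermitian)
    {X : g → Matrix n n ℂ} {V : Matrix n d ℂ} (hV0 : V ≠ 0) (hV : pencilAct A X V = V) :
    ∃ (s t : ℕ) (U : Matrix d (Fin s) ℂ) (W : Matrix d (Fin t) ℂ)
      (B : g → Matrix (Fin s) (Fin s) ℂ) (C : g → Matrix (Fin t) (Fin t) ℂ) (V' : Matrix n (Fin s) ℂ),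
      Uᴴ * U = 1 ∧ Wᴴ * W = 1 ∧ U * Uᴴ + W * Wᴴ = 1 ∧ s + t = Fintype.card d ∧
      (∀ a, (B a).IsHermitian) ∧ (∀ a, (C a).IsHermitian) ∧
      (∀ a, A a * U = U * B a) ∧ (∀ a, A a * W = W * C a) ∧
      (∀ S : Submodule ℂ (Fin s → ℂ), (∀ a, ∀ v ∈ S, B a *ᵥ v ∈ S) → S = ⊥ ∨ S = ⊤) ∧
      V' ≠ 0 ∧ pencilAct B X V' = V' := by
  classical
  obtain ⟨m, S, ⟨hS, hSm, V, hV0, hV, hVS⟩, hmin⟩ :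
      ∃ (m : ℕ) (S : Submodule ℂ (d → ℂ)), ((∀ a, ∀ v ∈ S, A a *ᵥ v ∈ S) ∧
        Module.finrank ℂ S = m ∧
        ∃ V : Matrix n d ℂ, V ≠ 0 ∧ pencilAct A X V = V ∧ ∀ i, V i ∈ S) ∧
        ∀ S' : Submodule ℂ (d → ℂ), (∀ a, ∀ v ∈ S', A a *ᵥ v ∈ S') →
          (∃ V : Matrix n d ℂ, V ≠ 0 ∧ pencilAct A X V = V ∧ ∀ i, V i ∈ S') →
          m ≤ Module.finrank ℂ S' := by
    have hex : ∃ m : ℕ, ∃ S : Submodule ℂ (d → ℂ), (∀ a, ∀ v ∈ S, A a *ᵥ v ∈ S) ∧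
        Module.finrank ℂ S = m ∧
        ∃ V : Matrix n d ℂ, V ≠ 0 ∧ pencilAct A X V = V ∧ ∀ i, V i ∈ S :=
      ⟨_, ⊤, by simp, rfl, V, hV0, hV, by simp⟩
    obtain ⟨S, hS⟩ := Nat.find_spec hex
    exact ⟨_, S, hS, fun S' h1 h2 => Nat.find_min' hex ⟨S', h1, rfl, h2⟩⟩
  obtain ⟨s, t, U, W, B, C, hU, hW, hsum, hr, hst, hB, hC, hAU, hAW⟩ :=
    Matrix.IsHermitian.exists_reducing_decomposition hA S hS
  have hUinj : Function.Injective U.mulVecLin := by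
    intro v w h
    have := congrArg (fun u => Uᴴ *ᵥ u) h
    simpa [mulVec_mulVec, hU] using this
  have hsm : s = m := by
    rw [← hSm, ← hr, LinearMap.finrank_range_of_inj hUinj, Module.finrank_fin_fun]
  have hfix : V * Uᴴᵀ * Uᵀ = V := by
    rw [Matrix.mul_assoc, ← transpose_mul]
    refine Matrix.ext fun i j => ?_
    have h1 : (U * Uᴴ) *ᵥ (V i) = V i := by
      have h := hVS i
      rw [← hr] at h
      obtain ⟨c, hc⟩ := h
      rw [← hc, mulVecLin_apply, mulVec_mulVec, Matrix.mul_assoc, hU, Matrix.mul_one]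
    rw [Matrix.mul_apply]
    conv_rhs => rw [← h1]
    rw [mulVec, dotProduct]
    exact Finset.sum_congr rfl fun k _ => mul_comm _ _
  have hV' : pencilAct B X (V * Uᴴᵀ) = V * Uᴴᵀ := by
    rw [pencilAct_mul fun a => intertwine_conjTranspose_transpose (hA a) (hB a) (hAU a), hV]
  have hV'0 : V * Uᴴᵀ ≠ 0 := by
    intro h
    rw [h, Matrix.zero_mul] at hfix
    exact hV0 hfix.symm
  have hsmall : ∀ (r : ℕ) (P : Matrix (Fin s) (Fin r) ℂ) (D : g → Matrix (Fin r) (Fin r) ℂ),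
      Pᴴ * P = 1 → (∀ a, (D a).IsHermitian) → (∀ a, B a * P = P * D a) →
      V * Uᴴᵀ * Pᴴᵀ ≠ 0 → s ≤ r := by
    intro r P D hP hD hBP hne
    have hUP : ∀ a, A a * (U * P) = U * P * D a := by
      intro a
      rw [← Matrix.mul_assoc, hAU, Matrix.mul_assoc, hBP, Matrix.mul_assoc]
    have hQ : pencilAct D X (V * Uᴴᵀ * Pᴴᵀ) = V * Uᴴᵀ * Pᴴᵀ := by
      rw [pencilAct_mul fun a => intertwine_conjTranspose_transpose (hB a) (hD a) (hBP a), hV']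
    have hUPi : (U * P)ᴴ * (U * P) = 1 := by
      rw [conjTranspose_mul, Matrix.mul_assoc, ← Matrix.mul_assoc Uᴴ, hU, Matrix.one_mul, hP]
    have := hmin (LinearMap.range (U * P).mulVecLin) ?_
      ⟨V * Uᴴᵀ * Pᴴᵀ * (U * P)ᵀ, ?_, ?_, ?_⟩
    · rw [hsm]
      refine this.trans ((LinearMap.finrank_range_le _).trans ?_)
      rw [Module.finrank_fin_fun]
    · rintro a _ ⟨c, rfl⟩
      refine ⟨D a *ᵥ c, ?_⟩
      rw [mulVecLin_apply, mulVecLin_apply, mulVec_mulVec, mulVec_mulVec, hUP]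
    · intro h
      apply hne
      have h2 := congrArg (· * (U * P)ᴴᵀ) h
      beta_reduce at h2
      rwa [Matrix.mul_assoc _ (U * P)ᵀ, ← transpose_mul, hUPi, transpose_one, Matrix.mul_one,
        Matrix.zero_mul] at h2
    · rw [pencilAct_mul fun a => intertwine_transpose (hUP a), hQ]
    · intro i
      refine ⟨(V * Uᴴᵀ * Pᴴᵀ) i, ?_⟩
      ext j
      rw [mulVecLin_apply, mulVec, dotProduct, Matrix.mul_apply]
      exact Finset.sum_congr rfl fun k _ => mul_comm _ _
  refine ⟨s, t, U, W, B, C, V * Uᴴᵀ, hU, hW, hsum, hst, hB, hC, hAU, hAW, ?_, hV'0, hV'⟩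
  intro T hT
  obtain ⟨r, q, P, Q, D, E, hP, hQ, hPQ, hPr, hrq, hD, hE, hBP, hBQ⟩ :=
    Matrix.IsHermitian.exists_reducing_decomposition hB T hT
  rw [Fintype.card_fin] at hrq
  have hPinj : Function.Injective P.mulVecLin := by
    intro v w h
    have := congrArg (fun u => Pᴴ *ᵥ u) h
    simpa [mulVec_mulVec, hP] using this
  have hTr : Module.finrank ℂ T = r := by
    rw [← hPr, LinearMap.finrank_range_of_inj hPinj, Module.finrank_fin_fun]
  by_cases hne : V * Uᴴᵀ * Pᴴᵀ = 0
  · left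
    have hne' : V * Uᴴᵀ * Qᴴᵀ ≠ 0 := by
      intro h
      apply hV'0
      have h2 : V * Uᴴᵀ * (P * Pᴴ + Q * Qᴴ)ᵀ = V * Uᴴᵀ := by
        rw [hPQ, transpose_one, Matrix.mul_one]
      rw [← h2, transpose_add, transpose_mul, transpose_mul, Matrix.mul_add, ← Matrix.mul_assoc,
        ← Matrix.mul_assoc _ Qᴴᵀ, hne, h, Matrix.zero_mul, Matrix.zero_mul, add_zero]
    have := hsmall q Q E hQ hE hBQ hne'
    exact Submodule.finrank_eq_zero.1 (by omega)
  · right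
    have := hsmall r P D hP hD hBP hne
    refine Submodule.eq_top_of_finrank_eq ?_
    rw [Module.finrank_fin_fun]
    omega

end Irreducible

section Separation

variable {g n m d e f : Type*} [Fintype g] [Fintype n] [Fintype m] [Fintype d] [Fintype e]
  [Fintype f]

theorem pencilForm_mul_transpose [DecidableEq e] {A : g → Matrix d d ℂ} {B : g → Matrix e e ℂ}
    {U : Matrix d e ℂ} (hU : Uᴴ * U = 1) (h : ∀ a, A a * U = U * B a) (X : g → Matrix n n ℂ)
    (V : Matrix n e ℂ) : pencilForm A X (V * Uᵀ) = pencilForm B X V := by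
  have : Uᵀ * Uᵀᴴ = 1 := by
    rw [← transpose_one, ← hU, transpose_mul]
    rfl
  rw [pencilForm_mul fun a => intertwine_transpose (h a), this, Matrix.mul_one, pencilForm]

theorem pencilForm_eq_add [DecidableEq d] {A : g → Matrix d d ℂ} {B : g → Matrix e e ℂ}
    {C : g → Matrix f f ℂ} {U : Matrix d e ℂ} {W : Matrix d f ℂ} (hUW : U * Uᴴ + W * Wᴴ = 1)
    (hA : ∀ a, (A a).IsHermitian) (hB : ∀ a, (B a).IsHermitian) (hC : ∀ a, (C a).IsHermitian)
    (hU : ∀ a, A a * U = U * B a) (hW : ∀ a, A a * W = W * C a) (X : g → Matrix n n ℂ)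
    (V : Matrix n d ℂ) :
    pencilForm A X V = pencilForm B X (V * Uᴴᵀ) + pencilForm C X (V * Wᴴᵀ) := by
  have h1 : Uᴴᵀ * Uᴴᵀᴴ + Wᴴᵀ * Wᴴᵀᴴ = 1 := by
    have h2 : Uᴴᵀᴴ = Uᵀ := by
      ext
      simp
    have h3 : Wᴴᵀᴴ = Wᵀ := by
      ext
      simp
    rw [← transpose_one, ← hUW, transpose_add, transpose_mul, transpose_mul, h2, h3]
  rw [pencilForm_mul fun a => intertwine_conjTranspose_transpose (hA a) (hB a) (hU a),
    pencilForm_mul fun a => intertwine_conjTranspose_transpose (hA a) (hC a) (hW a),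
    ← Complex.add_re, ← trace_add, ← Matrix.mul_add, h1, Matrix.mul_one, pencilForm]

theorem pencilForm_conj [DecidableEq n] (A : g → Matrix d d ℂ) (Y : g → Matrix m m ℂ)
    (J : Matrix n m ℂ) (V : Matrix n d ℂ) :
    pencilForm A (fun a => J * Y a * Jᴴ) V =
      pencilForm A Y (Jᴴ * V) + (trace (Vᴴ * ((1 - J * Jᴴ) * V))).re := by
  have : pencilAct A (fun a => J * Y a * Jᴴ) V = J * pencilAct A Y (Jᴴ * V) := by
    rw [pencilAct, pencilAct, Matrix.mul_sum]
    simp only [Matrix.mul_assoc]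
  rw [pencilForm, pencilForm, this, ← Complex.add_re, ← trace_add]
  congr 2
  simp only [conjTranspose_mul, conjTranspose_conjTranspose, Matrix.mul_sub, Matrix.sub_mul,
    Matrix.one_mul, Matrix.mul_assoc]
  abel

theorem mem_lmiDom_iff {g d n : ℕ} {A : Fin g → Matrix (Fin d) (Fin d) ℂ}
    (hA : ∀ a, (A a).IsHermitian) {X : Fin g → Matrix (Fin n) (Fin n) ℂ} :
    X ∈ lmiDom A n ↔ (∀ j, (X j).IsHermitian) ∧ ∀ V, 0 ≤ pencilForm A X V := by
  refine and_congr_right fun hX => ?_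
  exact one_sub_pencilPart_posSemidef_iff hA hX

theorem exists_tuple_compression {s n m : ℕ} (hn : s ≤ n) {B : g → Matrix (Fin s) (Fin s) ℂ}
    {C : g → Matrix f f ℂ} {Y : g → Matrix (Fin m) (Fin m) ℂ} (hY : ∀ a, (Y a).IsHermitian)
    (hC : ∀ V, 0 ≤ pencilForm C Y V) {V : Matrix (Fin m) (Fin s) ℂ} (hB : pencilForm B Y V < 0) :
    ∃ X : g → Matrix (Fin n) (Fin n) ℂ, (∀ a, (X a).IsHermitian) ∧
      (∀ V, 0 ≤ pencilForm C X V) ∧ ∃ V, pencilForm B X V < 0 := by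
  obtain ⟨r, t, U, W, hU, hW, hUW, hsum, hr, hrt⟩ :=
    (LinearMap.range V.mulVecLin).exists_isometry_decomposition
  have hUinj : Function.Injective U.mulVecLin := by
    intro v w h
    have := congrArg (fun u => Uᴴ *ᵥ u) h
    simpa [mulVec_mulVec, hU] using this
  have hrn : r ≤ n := by
    have h1 := LinearMap.finrank_range_le V.mulVecLin
    rw [← hr, LinearMap.finrank_range_of_inj hUinj, Module.finrank_fin_fun,
      Module.finrank_fin_fun] at h1
    exact h1.trans hn
  obtain ⟨E, hE⟩ : ∃ E : Matrix (Fin n) (Fin r) ℂ, Eᴴ * E = 1 := by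
    refine ⟨(1 : Matrix (Fin n) (Fin n) ℂ).submatrix id (Fin.castLE hrn), ?_⟩
    have := Matrix.submatrix_mul_equiv (1 : Matrix (Fin n) (Fin n) ℂ) (1 : Matrix (Fin n) (Fin n) ℂ)
      (Fin.castLE hrn) (Equiv.refl _) (Fin.castLE hrn)
    rw [Equiv.coe_refl] at this
    rw [conjTranspose_submatrix, conjTranspose_one, this, Matrix.one_mul,
      submatrix_one _ (Fin.castLE_injective hrn)]
  obtain ⟨J, hJ⟩ : ∃ J : Matrix (Fin n) (Fin m) ℂ, J = E * Uᴴ := ⟨_, rfl⟩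
  have hJJ : Jᴴ * J = U * Uᴴ := by
    rw [hJ, conjTranspose_mul, conjTranspose_conjTranspose, Matrix.mul_assoc,
      ← Matrix.mul_assoc Eᴴ, hE, Matrix.one_mul]
  have hJJ' : J * Jᴴ = E * Eᴴ := by
    rw [hJ, conjTranspose_mul, conjTranspose_conjTranspose, Matrix.mul_assoc,
      ← Matrix.mul_assoc Uᴴ, hU, Matrix.one_mul]
  have hV : U * Uᴴ * V = V := by
    refine Matrix.ext_of_mulVec_single fun j => ?_
    obtain ⟨c, hc⟩ : V *ᵥ Pi.single j 1 ∈ LinearMap.range U.mulVecLin := by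
      rw [hr]
      exact ⟨_, rfl⟩
    rw [← mulVec_mulVec, ← hc, mulVecLin_apply, mulVec_mulVec, Matrix.mul_assoc, hU,
      Matrix.mul_one]
  have hproj : (1 - J * Jᴴ)ᴴ * (1 - J * Jᴴ) = 1 - J * Jᴴ := by
    have : E * Eᴴ * (E * Eᴴ) = E * Eᴴ := by
      rw [Matrix.mul_assoc, ← Matrix.mul_assoc Eᴴ, hE, Matrix.one_mul]
    rw [hJJ', conjTranspose_sub, conjTranspose_one, conjTranspose_mul,
      conjTranspose_conjTranspose, Matrix.sub_mul, Matrix.mul_sub, Matrix.mul_sub, this]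
    simp
  refine ⟨fun a => J * Y a * Jᴴ, fun a => isHermitian_mul_mul_conjTranspose J (hY a),
    fun V => ?_, J * V, ?_⟩
  · rw [pencilForm_conj]
    refine add_nonneg (hC _) ?_
    rw [← hproj, Matrix.mul_assoc, ← Matrix.mul_assoc, ← conjTranspose_mul]
    exact re_trace_conjTranspose_mul_self_nonneg _
  · rw [pencilForm_conj, ← Matrix.mul_assoc, hJJ, hV]
    have : (1 - J * Jᴴ) * (J * V) = 0 := by
      rw [Matrix.sub_mul, Matrix.mul_assoc, ← Matrix.mul_assoc Jᴴ, hJJ, hV, Matrix.one_mul,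
        sub_self]
    rw [this, Matrix.mul_zero]
    simpa using hB

theorem exists_tuple_strict {B : g → Matrix e e ℂ} {C : g → Matrix f f ℂ} {X : g → Matrix n n ℂ}
    (hX : ∀ a, (X a).IsHermitian) (hC : ∀ V, 0 ≤ pencilForm C X V) {V : Matrix n e ℂ}
    (hB : pencilForm B X V < 0) :
    ∃ X : g → Matrix n n ℂ, (∀ a, (X a).IsHermitian) ∧
      (∀ V, V ≠ 0 → 0 < pencilForm C X V) ∧ pencilForm B X V < 0 := by
  obtain ⟨N, hN⟩ : ∃ N, N = (trace (Vᴴ * V)).re := ⟨_, rfl⟩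
  have hN0 : 0 ≤ N := hN ▸ re_trace_conjTranspose_mul_self_nonneg V
  obtain ⟨b, hb⟩ : ∃ b, b = pencilForm B X V := ⟨_, rfl⟩
  rw [← hb] at hB
  obtain ⟨t, ht⟩ : ∃ t, t = (N - b / 2) / (N - b) := ⟨_, rfl⟩
  have hNb : 0 < N - b := by linarith
  have ht0 : 0 < t := ht ▸ div_pos (by linarith) hNb
  have ht1 : t < 1 := by
    rw [ht, div_lt_one hNb]
    linarith
  refine ⟨fun a => (t : ℂ) • X a, fun a => ?_, fun V hV => ?_, ?_⟩
  · rw [Matrix.IsHermitian, conjTranspose_smul, (hX a).eq]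
    simp
  · rw [pencilForm_smul]
    have h1 := hC V
    have h2 := re_trace_conjTranspose_mul_self_pos hV
    have h3 := mul_nonneg ht0.le h1
    have h4 := mul_pos (sub_pos.2 ht1) h2
    linarith
  · rw [pencilForm_smul, ← hN, ← hb]
    have : t * b + (1 - t) * N = b / 2 := by
      rw [ht]
      field_simp
      ring
    linarith

theorem exists_separating_tuple {g d s t n : ℕ} {A : Fin g → Matrix (Fin d) (Fin d) ℂ}
    (hmin : ∀ (d' : ℕ) (A' : Fin g → Matrix (Fin d') (Fin d') ℂ),
      (∀ j, (A' j).IsHermitian) → (∀ n : ℕ, lmiDom A' n = lmiDom A n) → d ≤ d')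
    {B : Fin g → Matrix (Fin s) (Fin s) ℂ} {C : Fin g → Matrix (Fin t) (Fin t) ℂ}
    {U : Matrix (Fin d) (Fin s) ℂ} {W : Matrix (Fin d) (Fin t) ℂ}
    (hWW : Wᴴ * W = 1) (hUW : U * Uᴴ + W * Wᴴ = 1)
    (hA : ∀ a, (A a).IsHermitian) (hB : ∀ a, (B a).IsHermitian) (hC : ∀ a, (C a).IsHermitian)
    (hU : ∀ a, A a * U = U * B a) (hW : ∀ a, A a * W = W * C a) (ht : t < d) (hn : s ≤ n) :
    ∃ X : Fin g → Matrix (Fin n) (Fin n) ℂ, (∀ a, (X a).IsHermitian) ∧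
      (∀ V, V ≠ 0 → 0 < pencilForm C X V) ∧ ∃ V, pencilForm B X V < 0 := by
  obtain ⟨m, Y, hYC, hYA⟩ : ∃ m, ∃ Y ∈ lmiDom C m, Y ∉ lmiDom A m := by
    by_contra! hcon
    refine absurd (hmin t C hC fun n => Set.Subset.antisymm (hcon n) fun X hX => ?_) ht.not_ge
    rw [mem_lmiDom_iff hA] at hX
    rw [mem_lmiDom_iff hC]
    exact ⟨hX.1, fun V => pencilForm_mul_transpose hWW hW X V ▸ hX.2 _⟩
  rw [mem_lmiDom_iff hC] at hYC
  rw [mem_lmiDom_iff hA] at hYA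
  obtain ⟨V, hV⟩ : ∃ V, pencilForm A Y V < 0 := by
    by_contra! hcon
    exact hYA ⟨hYC.1, hcon⟩
  rw [pencilForm_eq_add hUW hA hB hC hU hW] at hV
  obtain ⟨X, hX, hXC, V', hV'⟩ := exists_tuple_compression hn hYC.1 hYC.2
    (lt_of_le_of_lt (le_add_of_nonneg_right (hYC.2 _)) hV)
  obtain ⟨X', h1, h2, h3⟩ := exists_tuple_strict hX hXC hV'
  exact ⟨X', h1, h2, V', h3⟩

end Separation

section Generic

variable {g n : Type*}

/-- The tuple of hermitian matrices with real coordinates `h`. -/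
def hermitianTuple (h : g × n × n → ℝ) (a : g) : Matrix n n ℂ :=
  Matrix.of fun i j => ((h (a, i, j) + h (a, j, i) : ℝ) : ℂ) / 2 +
    Complex.I * (((h (a, i, j) - h (a, j, i) : ℝ) : ℂ) / 2)

theorem hermitianTuple_isHermitian (h : g × n × n → ℝ) (a : g) :
    (hermitianTuple h a).IsHermitian := by
  ext i j
  simp only [hermitianTuple, conjTranspose_apply, of_apply, star_add, star_mul', star_div₀,
    Complex.star_def, Complex.conj_ofReal, Complex.conj_I, map_ofNat]
  push_cast
  ring

theorem exists_hermitianTuple_eq {X : g → Matrix n n ℂ} (hX : ∀ a, (X a).IsHermitian) :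
    ∃ h, hermitianTuple h = X := by
  refine ⟨fun v => (X v.1 v.2.1 v.2.2).re + (X v.1 v.2.1 v.2.2).im, ?_⟩
  ext a i j
  have h1 : X a j i = star (X a i j) := ((hX a).apply i j).symm ▸ (star_star _).symm
  have h2 := Complex.re_add_im (X a i j)
  simp only [hermitianTuple, of_apply, h1, Complex.star_def, Complex.conj_re, Complex.conj_im]
  push_cast
  linear_combination h2

theorem ofReal_eq_hermitianTuple (h : g × n × n → ℝ) (a : g) (i j : n) :
    (h (a, i, j) : ℂ) = (hermitianTuple h a i j + hermitianTuple h a j i) / 2 -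
      Complex.I * ((hermitianTuple h a i j - hermitianTuple h a j i) / 2) := by
  simp only [hermitianTuple, of_apply]
  push_cast
  linear_combination ((h (a, i, j) : ℂ) - h (a, j, i)) / 2 * Complex.I_sq

theorem continuous_hermitianTuple : Continuous (hermitianTuple (g := g) (n := n)) := by
  refine continuous_pi fun a => continuous_matrix fun i j => ?_
  simp only [hermitianTuple, of_apply]
  fun_prop

open Topology in
theorem exists_generic_hermitian {k ι : Type*} [Field k] [Countable k] [Algebra k ℂ] [Fintype g]
    [Fintype n] [Fintype ι] {z : k} (hz : algebraMap k ℂ z = Complex.I) {X₀ : g → Matrix n n ℂ}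
    (hX₀ : ∀ a, (X₀ a).IsHermitian) {P : (g → Matrix n n ℂ) → Prop} (hP : ∀ᶠ X in 𝓝 X₀, P X) :
    ∃ X : g → Matrix n n ℂ, (∀ a, (X a).IsHermitian) ∧ P X ∧
      ∃ t : ι → ℂ, AlgebraicIndependent k (Sum.elim (tupleEntries X) t) := by
  obtain ⟨h₀, rfl⟩ := exists_hermitianTuple_eq hX₀
  obtain ⟨ε, hε, hball⟩ := Metric.eventually_nhds_iff.1
    ((continuous_hermitianTuple.tendsto h₀).eventually hP)
  obtain ⟨t, ht, hind⟩ := exists_algebraicIndependent_near (k := k)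
    (Sum.elim h₀ (fun _ : ι => 0)) hε
  refine ⟨hermitianTuple fun v => t (Sum.inl v), hermitianTuple_isHermitian _, hball ?_,
    fun i => t (Sum.inr i), ?_⟩
  · rw [dist_pi_lt_iff hε]
    intro v
    rw [Real.dist_eq]
    exact ht (Sum.inl v)
  · refine (hind.of_mem_adjoin fun v => ?_).2 le_rfl
    rcases v with ⟨a, i, j⟩ | i
    · have h := ofReal_eq_hermitianTuple (fun v => t (Sum.inl v)) a i j
      beta_reduce at h
      rw [h, ← hz]
      have hm : ∀ i j, hermitianTuple (fun v => t (Sum.inl v)) a i j ∈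
          IntermediateField.adjoin k (Set.range (Sum.elim
            (tupleEntries (hermitianTuple fun v => t (Sum.inl v))) fun i => (t (Sum.inr i) : ℂ))) :=
        fun i j => IntermediateField.subset_adjoin _ _ ⟨Sum.inl (a, i, j), rfl⟩
      refine sub_mem (div_mem (add_mem (hm _ _) (hm _ _)) (ofNat_mem _ 2))
        (mul_mem (IntermediateField.algebraMap_mem _ _)
          (div_mem (sub_mem (hm _ _) (hm _ _)) (ofNat_mem _ 2)))
    · exact IntermediateField.subset_adjoin _ _ ⟨Sum.inr i, rfl⟩

theorem continuous_pencilForm {d : Type*} [Fintype g] [Fintype n] [Fintype d]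
    (A : g → Matrix d d ℂ) :
    Continuous fun q : (g → Matrix n n ℂ) × Matrix n d ℂ => pencilForm A q.1 q.2 := by
  unfold pencilForm pencilAct
  fun_prop

open Topology in
theorem eventually_pencilForm_pos {d : Type*} [Fintype g] [Fintype n] [Fintype d]
    {A : g → Matrix d d ℂ} {X₀ : g → Matrix n n ℂ} (h : ∀ V, V ≠ 0 → 0 < pencilForm A X₀ V) :
    ∀ᶠ X in 𝓝 X₀, ∀ V, V ≠ 0 → 0 < pencilForm A X V := by
  have hK : IsCompact (Metric.sphere (0 : n → d → ℂ) 1) := isCompact_sphere _ _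
  have hc : Continuous fun q : (g → Matrix n n ℂ) × (n → d → ℂ) =>
      pencilForm A q.1 (Matrix.of q.2) :=
    (continuous_pencilForm A).comp (continuous_fst.prodMk continuous_snd)
  have h1 : ∀ᶠ X in 𝓝 X₀, ∀ V ∈ Metric.sphere (0 : n → d → ℂ) 1,
      0 < pencilForm A X (Matrix.of V) := by
    refine hK.eventually_forall_of_forall_eventually fun V hV => ?_
    have hne : Matrix.of V ≠ 0 := by
      intro h0
      have : V = 0 := h0
      simp [this] at hV
    exact hc.continuousAt.eventually (lt_mem_nhds (h _ hne))
  filter_upwards [h1] with X hX V hV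
  obtain ⟨V, rfl⟩ : ∃ V' : n → d → ℂ, Matrix.of V' = V := ⟨V, rfl⟩
  obtain ⟨r, hr⟩ : ∃ r : ℝ, r = ‖V‖ := ⟨_, rfl⟩
  have hr0 : 0 < r := hr ▸ norm_pos_iff.2 fun h0 => hV (by rw [h0]; rfl)
  have h2 := hX ((r⁻¹ : ℝ) • V) (by
    rw [mem_sphere_zero_iff_norm, norm_smul, ← hr, Real.norm_of_nonneg (by positivity),
      inv_mul_cancel₀ hr0.ne'])
  have h3 : Matrix.of ((r⁻¹ : ℝ) • V) = ((r⁻¹ : ℝ) : ℂ) • Matrix.of V := by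
    ext i j
    simp
  have h4 : pencilForm A X (((r⁻¹ : ℝ) : ℂ) • Matrix.of V) =
      r⁻¹ ^ 2 * pencilForm A X (Matrix.of V) := by
    rw [pencilForm, pencilForm, pencilAct_mulVec_smul, conjTranspose_smul, ← smul_sub,
      Matrix.smul_mul, Matrix.mul_smul, trace_smul, trace_smul, smul_eq_mul, smul_eq_mul,
      ← mul_assoc, Complex.star_def, Complex.conj_ofReal, ← Complex.ofReal_mul,
      Complex.re_ofReal_mul, sq]
  rw [h3, h4] at h2
  exact (pos_iff_pos_of_mul_pos h2).1 (by positivity)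

theorem IntermediateField.countable_adjoin {F : Type*} [Field F] [Algebra ℚ F] {S : Set F}
    (hS : S.Countable) : Countable (IntermediateField.adjoin ℚ S) := by
  have := IntermediateField.lift_cardinalMk_adjoin_le ℚ S
  rw [← Cardinal.mk_le_aleph0_iff]
  refine Cardinal.lift_le_aleph0.1 (this.trans ?_)
  have h := hS.to_subtype
  simp

end Generic

section Density

theorem pencilAct_eigenvalue_exists {g n d : Type*} [Fintype g] [Fintype n] [Fintype d]
    {A : g → Matrix d d ℂ} {X : g → Matrix n n ℂ} (hA : ∀ a, (A a).IsHermitian)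
    (hX : ∀ a, (X a).IsHermitian) {V₀ : Matrix n d ℂ} (hV₀ : pencilForm A X V₀ < 0) :
    ∃ c : ℝ, 1 < c ∧ (∃ V, V ≠ 0 ∧ pencilAct A X V = (c : ℂ) • V) ∧
      ∀ V, 0 ≤ pencilForm A (fun a => ((c⁻¹ : ℝ) : ℂ) • X a) V := by
  classical
  have hT := pencilPart_isHermitian hA hX
  have hne : V₀ ≠ 0 := by
    rintro rfl
    simp [pencilForm] at hV₀
  obtain ⟨i₀, j₀, hij⟩ : ∃ i j, V₀ i j ≠ 0 := by
    by_contra! h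
    exact hne (Matrix.ext h)
  have : Nonempty (d × n) := ⟨(j₀, i₀)⟩
  obtain ⟨m, hm⟩ := Finite.exists_max hT.eigenvalues
  obtain ⟨c, hc⟩ : ∃ c, c = hT.eigenvalues m := ⟨_, rfl⟩
  have hpsd : ((c : ℂ) • (1 : Matrix (d × n) (d × n) ℂ) - pencilPart A X).PosSemidef := by
    have h1 := hT.spectral_theorem
    have hU := Matrix.mem_unitaryGroup_iff.1 hT.eigenvectorUnitary.2
    have h2 : (c : ℂ) • (1 : Matrix (d × n) (d × n) ℂ) - pencilPart A X =
        (hT.eigenvectorUnitary : Matrix (d × n) (d × n) ℂ) *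
          diagonal (fun i => ((c - hT.eigenvalues i : ℝ) : ℂ)) *
          (hT.eigenvectorUnitary : Matrix (d × n) (d × n) ℂ)ᴴ := by
      have h3 : diagonal (fun i => ((c - hT.eigenvalues i : ℝ) : ℂ)) =
          (c : ℂ) • (1 : Matrix (d × n) (d × n) ℂ) -
            diagonal (RCLike.ofReal ∘ hT.eigenvalues) := by
        rw [smul_one_eq_diagonal, diagonal_sub]
        congr 1
        ext i
        simp
      rw [h3, Matrix.mul_sub, Matrix.sub_mul, Matrix.mul_smul, Matrix.mul_one, Matrix.smul_mul,
        ← star_eq_conjTranspose, hU]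
      congr 1
    rw [h2]
    refine PosSemidef.mul_mul_conjTranspose_same (PosSemidef.diagonal fun i => ?_) _
    rw [Pi.zero_apply, Complex.zero_le_real, sub_nonneg, hc]
    exact hm i
  have hform : ∀ V : Matrix n d ℂ,
      0 ≤ c * (trace (Vᴴ * V)).re - (trace (Vᴴ * pencilAct A X V)).re := by
    intro V
    have := hpsd.dotProduct_mulVec_nonneg (vec V)
    rw [Matrix.sub_mulVec, pencilPart_mulVec_vec_eq, smul_mulVec, Matrix.one_mulVec, ← vec_smul,
      ← vec_sub, star_vec_dotProduct_vec, Matrix.mul_sub, Matrix.mul_smul, trace_sub,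
      trace_smul] at this
    simpa using (Complex.le_def.1 this).1
  have hc1 : 1 < c := by
    have h1 := hform V₀
    rw [pencilForm, Matrix.mul_sub, trace_sub, Complex.sub_re] at hV₀
    have h2 := re_trace_conjTranspose_mul_self_pos hne
    by_contra! hle
    nlinarith
  refine ⟨c, hc1, ?_, fun V => ?_⟩
  · obtain ⟨v, hv⟩ : ∃ v : d × n → ℂ, v = hT.eigenvectorBasis m := ⟨_, rfl⟩
    obtain ⟨V, hV⟩ := vec_bijective.2 v
    have h1 := hT.mulVec_eigenvectorBasis m
    rw [← hv, ← hV, pencilPart_mulVec_vec_eq, ← hc] at h1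
    refine ⟨V, ?_, ?_⟩
    · rintro rfl
      refine hT.eigenvectorBasis.toBasis.ne_zero m ?_
      ext p
      rw [OrthonormalBasis.coe_toBasis]
      have := congrFun hv p
      rw [← hV] at this
      simpa using this.symm
    · apply vec_inj.1
      rw [h1]
      ext p
      simp [vec]
  · rw [pencilForm_smul, pencilForm, Matrix.mul_sub, trace_sub, Complex.sub_re]
    have h1 := hform V
    have h2 : 0 ≤ c⁻¹ * (c * (trace (Vᴴ * V)).re - (trace (Vᴴ * pencilAct A X V)).re) :=
      mul_nonneg (by positivity) h1
    have h3 : c⁻¹ * c = 1 := inv_mul_cancel₀ (by positivity)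
    rw [mul_sub, ← mul_assoc, h3] at h2
    linarith

open Topology in
theorem eval_eq_zero_of_generic_eigenvalue {g n s : Type*} [Fintype g] [Fintype n] [Fintype s]
    [DecidableEq n] [DecidableEq s] {B : g → Matrix s s ℂ} (hB : ∀ a, (B a).IsHermitian)
    (hirr : ∀ S : Submodule ℂ (s → ℂ), (∀ a, ∀ v ∈ S, B a *ᵥ v ∈ S) → S = ⊥ ∨ S = ⊤)
    (hn : Fintype.card s ^ 2 < Fintype.card n) {p : MvPolynomial (g × n × n) ℂ}
    {X₀ : g → Matrix n n ℂ} (hX₀ : ∀ a, (X₀ a).IsHermitian) {P : (g → Matrix n n ℂ) → Prop}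
    (hP : ∀ᶠ X in 𝓝 X₀, P X)
    (h : ∀ X : g → Matrix n n ℂ, (∀ a, (X a).IsHermitian) → P X →
      ∃ (c : ℂ) (V : Matrix n s ℂ), c ≠ 0 ∧ V ≠ 0 ∧ pencilAct B X V = c • V ∧
        ((∀ W, pencilAct B X W = c • W → ∃ r : ℂ, W = r • V) →
          eval (tupleEntries fun a => c⁻¹ • X a) p = 0))
    {Y : g → Matrix n n ℂ} {V : Matrix n s ℂ} (hV0 : V ≠ 0) (hV : pencilAct B Y V = V) :
    eval (tupleEntries Y) p = 0 := by
  classical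
  obtain ⟨S, hSc, hSB, hSp, hSI⟩ : ∃ S : Set ℂ, S.Countable ∧ (∀ a i j, B a i j ∈ S) ∧
      (∀ m, coeff m p ∈ S) ∧ Complex.I ∈ S := by
    refine ⟨(Set.range fun v : g × s × s => B v.1 v.2.1 v.2.2) ∪
      (insert 0 ((fun m => coeff m p) '' (p.support : Set (g × n × n →₀ ℕ)))) ∪ {Complex.I},
      ?_, fun a i j => Or.inl (Or.inl ⟨(a, i, j), rfl⟩), fun m => Or.inl (Or.inr ?_), Or.inr rfl⟩
    · exact ((Set.finite_range _).union (((Finset.finite_toSet _).image _).insert _)).union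
        (Set.finite_singleton _) |>.countable
    · by_cases hm : coeff m p = 0
      · exact Or.inl hm
      · exact Or.inr ⟨m, mem_support_iff.2 hm, rfl⟩
  obtain ⟨K, hKc, hK⟩ : ∃ K : IntermediateField ℚ ℂ, Countable K ∧ S ⊆ K :=
    ⟨_, IntermediateField.countable_adjoin hSc, IntermediateField.subset_adjoin _ _⟩
  obtain ⟨B', hB'⟩ : ∃ B' : g → Matrix s s K, ∀ a, (B' a).map (algebraMap K ℂ) = B a :=
    ⟨fun a => Matrix.of fun i j => ⟨B a i j, hK (hSB a i j)⟩, fun a => rfl⟩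
  obtain ⟨q, rfl⟩ : p ∈ Set.range (MvPolynomial.map (σ := g × n × n) (algebraMap K ℂ)) := by
    rw [mem_range_map_iff_coeffs_subset]
    intro x hx
    obtain ⟨m, -, rfl⟩ := mem_coeffs_iff.1 hx
    exact ⟨⟨coeff m p, hK (hSp m)⟩, rfl⟩
  have heval : ∀ Z : g → Matrix n n ℂ,
      eval (tupleEntries Z) (MvPolynomial.map (algebraMap K ℂ) q) = aeval (tupleEntries Z) q := by
    intro Z
    rw [eval_map, aeval_def]
  have hirr' : ∀ T : Submodule ℂ (s → ℂ),
      (∀ a, ∀ v ∈ T, (B' a).map (algebraMap K ℂ) *ᵥ v ∈ T) → T = ⊥ ∨ T = ⊤ := by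
    simpa only [hB'] using hirr
  have hact : ∀ (Z : g → Matrix n n ℂ) (W : Matrix n s ℂ),
      ∑ a, Z a * W * ((B' a).map (algebraMap K ℂ))ᵀ = pencilAct B Z W := by
    intro Z W
    simp only [hB']
    rfl
  have hker : ∀ v : s → ℂ, (∀ a, (B a)ᵀ *ᵥ v = 0) → v = 0 := by
    intro v hv
    obtain ⟨T, hT⟩ : ∃ T : Submodule ℂ (s → ℂ), ∀ w, w ∈ T ↔ ∀ a, B a *ᵥ w = 0 :=
      ⟨⨅ a, LinearMap.ker (B a).mulVecLin, by simp⟩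
    have hv' : star v ∈ T := by
      rw [hT]
      intro a
      have h1 := congrArg star (hv a)
      rw [star_mulVec, star_zero, ← mulVec_transpose] at h1
      have h2 : (B a)ᵀᴴᵀ = B a := by
        conv_rhs => rw [← (hB a).eq]
        rfl
      rwa [h2] at h1
    rcases hirr T fun a w hw => by rw [(hT w).1 hw a]; exact T.zero_mem with hbot | htop
    · rw [hbot, Submodule.mem_bot] at hv'
      simpa using hv'
    · have hB0 : ∀ a, B a = 0 := by
        intro a
        refine Matrix.ext_of_mulVec_single fun j => ?_
        rw [Matrix.zero_mulVec]
        refine (hT _).1 ?_ a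
        rw [htop]
        trivial
      refine absurd ?_ hV0
      rw [← hV, pencilAct]
      simp [hB0]
  obtain ⟨D, hD⟩ : ∃ D : g → Matrix s s K, ∑ a, D a * (B' a)ᵀ = 1 := by
    obtain ⟨E, hE, hE1⟩ := IntermediateField.exists_matrix_leftInverse (⊥ : IntermediateField K K)
      (Matrix.of fun (v : g × s) j => (B' v.1)ᵀ v.2 j) (fun i j => ⟨_, rfl⟩) (by
        intro v hv
        have h1 := hker (fun i => algebraMap K ℂ (v i)) (by
          intro a
          rw [← hB']
          ext i
          have h2 := congrArg (algebraMap K ℂ) (congrFun hv (a, i))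
          simpa [mulVec, dotProduct] using h2)
        ext i
        have := congrFun h1 i
        simpa using this)
    refine ⟨fun a => Matrix.of fun i j => E i (a, j), ?_⟩
    rw [← hE1]
    ext i j
    simp [Matrix.sum_apply, Matrix.mul_apply, Fintype.sum_prod_type]
  obtain ⟨X, hX, hPX, t, hind⟩ := exists_generic_hermitian (k := K) (ι := Option (n × s))
    (z := ⟨Complex.I, hK hSI⟩) rfl hX₀ hP
  obtain ⟨c, W, hc, hW0, hW, hcW⟩ := h X hX hPX
  rw [heval] at hcW ⊢
  have h0 := hcW fun W' hW' => hind.eigenvector_eq_smul hD hirr' hn hc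
    ((hact X W).trans hW) ((hact X W').trans hW') hW0
  have hpart : ∀ Z : g → Matrix n n ℂ, pencilPart B' Z = pencilPart B Z := by
    intro Z
    simp only [pencilPart, hB']
    rfl
  refine (hind.comp Sum.inl Sum.inl_injective).aeval_eq_zero_of_eigenvalues (A := B') ?_
    (fun c' v hc' hv hv' => ?_) (w := vec V) ?_ ?_
  · rw [hpart]
    exact pencilPart_isHermitian hB hX
  · obtain ⟨V', rfl⟩ := vec_bijective.2 v
    rw [hpart, pencilPart_mulVec_vec_eq, ← vec_smul, vec_inj] at hv'
    refine hind.aeval_eigenvalue_conj hD hirr' hn hc hc' ((hact X W).trans hW)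
      ((hact X V').trans hv') hW0 ?_ h0
    rintro rfl
    exact hv vec_zero
  · intro h1
    rw [← vec_zero, vec_inj] at h1
    exact hV0 h1
  · rw [hpart, pencilPart_mulVec_vec_eq, hV]

end Density

section Kernel

open Topology in
theorem eventually_pencilForm_neg {g n d : Type*} [Fintype g] [Fintype n] [Fintype d]
    {A : g → Matrix d d ℂ} {X₀ : g → Matrix n n ℂ} {V : Matrix n d ℂ}
    (h : pencilForm A X₀ V < 0) : ∀ᶠ X in 𝓝 X₀, pencilForm A X V < 0 := by
  have hc : Continuous fun X : g → Matrix n n ℂ => pencilForm A X V := by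
    unfold pencilForm pencilAct
    fun_prop
  exact hc.continuousAt.eventually (gt_mem_nhds h)

theorem mem_ker_pencilEval_vec_iff {g d n : ℕ} {A : Fin g → Matrix (Fin d) (Fin d) ℂ}
    {X : Fin g → Matrix (Fin n) (Fin n) ℂ} {V : Matrix (Fin n) (Fin d) ℂ} :
    pencilEval A X *ᵥ vec V = 0 ↔ pencilAct A X V = V := by
  have h : pencilEval A X = 1 - pencilPart A X := rfl
  rw [h, Matrix.sub_mulVec, Matrix.one_mulVec, pencilPart_mulVec_vec_eq, sub_eq_zero, vec_inj,
    eq_comm]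

theorem finrank_ker_pencilEval_eq_one {g d n s t : ℕ} {A : Fin g → Matrix (Fin d) (Fin d) ℂ}
    {B : Fin g → Matrix (Fin s) (Fin s) ℂ} {C : Fin g → Matrix (Fin t) (Fin t) ℂ}
    {U : Matrix (Fin d) (Fin s) ℂ} {W : Matrix (Fin d) (Fin t) ℂ}
    (hUU : Uᴴ * U = 1) (hUW : U * Uᴴ + W * Wᴴ = 1)
    (hA : ∀ a, (A a).IsHermitian) (hB : ∀ a, (B a).IsHermitian) (hC : ∀ a, (C a).IsHermitian)
    (hU : ∀ a, A a * U = U * B a) (hW : ∀ a, A a * W = W * C a)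
    {X : Fin g → Matrix (Fin n) (Fin n) ℂ} (hX : ∀ V, V ≠ 0 → 0 < pencilForm C X V)
    {V : Matrix (Fin n) (Fin s) ℂ} (hV0 : V ≠ 0) (hV : pencilAct B X V = V)
    (h : ∀ V', pencilAct B X V' = V' → ∃ r : ℂ, V' = r • V) :
    Module.finrank ℂ (LinearMap.ker (pencilEval A X).mulVecLin) = 1 := by
  rw [finrank_eq_one_iff']
  have hVU : pencilAct A X (V * Uᵀ) = V * Uᵀ := by
    rw [pencilAct_mul fun a => intertwine_transpose (hU a), hV]
  refine ⟨⟨vec (V * Uᵀ), mem_ker_pencilEval_vec_iff.2 hVU⟩, fun h0 => hV0 ?_, ?_⟩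
  · have h1 := congrArg Subtype.val h0
    have h2 : V * Uᵀ = 0 := vec_inj.1 (h1.trans vec_zero.symm)
    have h3 : V * (Uᴴ * U)ᵀ = 0 := by
      rw [transpose_mul, ← Matrix.mul_assoc, h2, Matrix.zero_mul]
    simpa [hUU] using h3
  · rintro ⟨w, hw⟩
    obtain ⟨Z, rfl⟩ := vec_bijective.2 w
    have hZ : pencilAct A X Z = Z := mem_ker_pencilEval_vec_iff.1 hw
    have h1 : Z * Wᴴᵀ = 0 := by
      by_contra hne
      have h2 := hX _ hne
      rw [pencilForm, pencilAct_mul fun a => intertwine_conjTranspose_transpose (hA a) (hC a) (hW a),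
        hZ, sub_self, Matrix.mul_zero] at h2
      simp at h2
    obtain ⟨r, hr⟩ := h (Z * Uᴴᵀ) (by
      rw [pencilAct_mul fun a => intertwine_conjTranspose_transpose (hA a) (hB a) (hU a), hZ])
    refine ⟨r, Subtype.ext ?_⟩
    change r • vec (V * Uᵀ) = vec Z
    rw [← vec_smul, vec_inj, ← Matrix.smul_mul, ← hr]
    have h2 : Z * (U * Uᴴ + W * Wᴴ)ᵀ = Z := by
      rw [hUW, transpose_one, Matrix.mul_one]
    rwa [transpose_add, transpose_mul, transpose_mul, Matrix.mul_add, ← Matrix.mul_assoc,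
      ← Matrix.mul_assoc _ Wᴴᵀ, h1, Matrix.zero_mul, add_zero] at h2

end Kernel

/-- For an LMI-minimal hermitian monic pencil `L`, the set `∂¹D_n(L)` of boundary points with
one-dimensional kernel is Zariski dense in the free locus `FL_n(L)` for all large `n`. -/
theorem boundary_one_dim_kernel_zariski_dense
    {g d : ℕ} (A : Fin g → Matrix (Fin d) (Fin d) ℂ)
    (hherm : ∀ j, (A j).IsHermitian)
    (hmin : ∀ (d' : ℕ) (A' : Fin g → Matrix (Fin d') (Fin d') ℂ),
      (∀ j, (A' j).IsHermitian) → (∀ n : ℕ, lmiDom A' n = lmiDom A n) → d ≤ d') :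
    ∃ n₀ : ℕ, ∀ n ≥ n₀, ∀ p : MvPolynomial (Fin g × Fin n × Fin n) ℂ,
      (∀ X ∈ lmiDom A n,
        Module.finrank ℂ (LinearMap.ker (pencilEval A X).mulVecLin) = 1 →
          MvPolynomial.eval (fun v => X v.1 v.2.1 v.2.2) p = 0) →
      ∀ X : Fin g → Matrix (Fin n) (Fin n) ℂ, (pencilEval A X).det = 0 →
        MvPolynomial.eval (fun v => X v.1 v.2.1 v.2.2) p = 0 := by
  classical
  refine ⟨d ^ 2 + 1, fun n hn p hp Y hY => ?_⟩
  obtain ⟨v, hv0, hv⟩ := Matrix.exists_mulVec_eq_zero_iff.2 hY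
  obtain ⟨V, rfl⟩ := vec_bijective.2 v
  obtain ⟨s, t, U, W, B, C, V', hUU, hWW, hUW, hst, hB, hC, hU, hW, hirr, hV'0, hV'⟩ :=
    exists_irreducible_summand hherm (V := V) (fun h => hv0 (by rw [h, vec_zero]))
      (mem_ker_pencilEval_vec_iff.1 hv)
  rw [Fintype.card_fin] at hst
  have hs : 0 < s := by
    rcases Nat.eq_zero_or_pos s with rfl | h
    · exact absurd (Matrix.ext fun i j => j.elim0) hV'0
    · exact h
  have hsn : s ^ 2 < n := by
    have : s ^ 2 ≤ d ^ 2 := Nat.pow_le_pow_left (by omega) 2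
    omega
  obtain ⟨X₀, hX₀, hX₀C, V₀, hV₀⟩ := exists_separating_tuple hmin hWW hUW hherm hB hC hU hW
    (by omega) ((Nat.le_self_pow two_ne_zero s).trans hsn.le)
  refine eval_eq_zero_of_generic_eigenvalue hB hirr (by simpa using hsn) hX₀
    (P := fun X => (∀ V, V ≠ 0 → 0 < pencilForm C X V) ∧ pencilForm B X V₀ < 0) ?_ ?_ hV'0 hV'
  · refine (eventually_pencilForm_pos hX₀C).and ?_
    exact eventually_pencilForm_neg hV₀
  · rintro X hX ⟨hXC, hXB⟩
    obtain ⟨c, hc, ⟨V₁, hV₁0, hV₁⟩, hpos⟩ := pencilAct_eigenvalue_exists hB hX hXB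
    have hc0 : (c : ℂ) ≠ 0 := Complex.ofReal_ne_zero.2 (by positivity)
    refine ⟨c, V₁, hc0, hV₁0, hV₁, fun huniq => ?_⟩
    rw [← Complex.ofReal_inv]
    have hXC' : ∀ V, V ≠ 0 → 0 < pencilForm C (fun a => ((c⁻¹ : ℝ) : ℂ) • X a) V := by
      intro V hV
      rw [pencilForm_smul]
      have h1 := mul_pos (inv_pos.2 (zero_lt_one.trans hc)) (hXC V hV)
      have h2 := mul_nonneg (sub_nonneg.2 (inv_le_one_of_one_le₀ hc.le))
        (re_trace_conjTranspose_mul_self_nonneg V)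
      linarith
    refine hp (fun a => ((c⁻¹ : ℝ) : ℂ) • X a) ((mem_lmiDom_iff hherm).2 ⟨fun a => ?_, fun V => ?_⟩)
      (finrank_ker_pencilEval_eq_one hUU hUW hherm hB hC hU hW hXC' hV₁0 ?_ fun V hV => ?_)
    · rw [Matrix.IsHermitian, conjTranspose_smul, (hX a).eq, Complex.star_def, Complex.conj_ofReal]
    · rw [pencilForm_eq_add hUW hherm hB hC hU hW]
      refine add_nonneg (hpos _) ?_
      by_cases h0 : V * Wᴴᵀ = 0
      · rw [h0]
        simp [pencilForm]
      · exact (hXC' _ h0).le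
    · rw [pencilAct_smul, hV₁, smul_smul, Complex.ofReal_inv, inv_mul_cancel₀ hc0, one_smul]
    · refine huniq V ?_
      rw [pencilAct_smul] at hV
      conv_rhs => rw [← hV]
      rw [smul_smul, Complex.ofReal_inv, mul_inv_cancel₀ hc0, one_smul]
end
end
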